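/- Fix ε > 0 and set D(x) = exp[C(log x)^{1/2}] for a suitable positive constant C. There is a constant A > 0 such that for all sufficiently large x there exist at least D(x)^{1−ε} integers d ≤ D(x), each a fundamental discriminant with associated real primitive Dirichlet character χ_d, for which (#{(p,q) : p, q prime, pq ≤ x, χ_d(p) = χ_d(q) = 1}) / ((1/4)·#{(p,q) : p, q prime, pq ≤ x, gcd(pq, d) = 1}) ≥ 1 + (log log log x − A)/log log x. -/

import Mathlib

open Filter

/-- The Dirichlet L-function of `χ` (extended by `0` for modulus `0`). -/
noncomputable def LFun (d : ℕ) (χ : DirichletCharacter ℂ d) (s : ℂ) : ℂ :=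
  if h : d ≠ 0 then
    letI : NeZero d := ⟨h⟩
    DirichletCharacter.LFunction χ s
  else 0

/-- `𝓛_χ = Σ_p χ(p)/p` has value `L`: the partial sums over primes `p < y`
converge to `L` as `y → ∞`. -/
def HasCurlyL {d : ℕ} (χ : DirichletCharacter ℂ d) (L : ℝ) : Prop :=
  Filter.Tendsto
    (fun y : ℕ => ∑ p ∈ (Finset.range y).filter Nat.Prime, (χ p).re / (p : ℝ))
    Filter.atTop (nhds L)

/-- Number of ordered pairs `(p, q)` of primes with `p * q ≤ x` satisfying `P p q`. -/
noncomputable def pairCount (x : ℝ) (P : ℕ → ℕ → Prop) : ℕ :=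
  Nat.card {pq : ℕ × ℕ // pq.1.Prime ∧ pq.2.Prime ∧ ((pq.1 * pq.2 : ℕ) : ℝ) ≤ x ∧ P pq.1 pq.2}

/-- The race ratio `#{pq ≤ x : χ(p) = χ(q) = η} / ((1/4) #{pq ≤ x : gcd(pq, d) = 1})`,
where products of two primes are counted as ordered pairs. -/
noncomputable def raceRatio {d : ℕ} (χ : DirichletCharacter ℂ d) (η : ℂ) (x : ℝ) : ℝ :=
  (pairCount x (fun p q => χ p = η ∧ χ q = η) : ℝ) /
    ((1 / 4 : ℝ) * (pairCount x (fun p q => Nat.gcd (p * q) d = 1) : ℝ))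

/-- A positive integer is a fundamental discriminant if it is `≡ 1 (mod 4)` and squarefree,
or is `4m` with `m ≡ 2, 3 (mod 4)` squarefree. -/
def IsFundamentalDiscriminant (d : ℕ) : Prop :=
  0 < d ∧ ((d % 4 = 1 ∧ Squarefree d) ∨
    (d % 4 = 0 ∧ Squarefree (d / 4) ∧ (d / 4 % 4 = 2 ∨ d / 4 % 4 = 3)))

/-- The Generalized Riemann Hypothesis for Dirichlet L-functions: all zeros in the
critical strip lie on the critical line. -/
def GRH : Prop :=
  ∀ (d : ℕ), d ≠ 0 → ∀ (χ : DirichletCharacter ℂ d) (s : ℂ),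
    LFun d χ s = 0 → 0 < s.re → s.re < 1 → s.re = 1 / 2

/-- `L(s, χ)` has no real zero `β` with `1 - c / log d ≤ β ≤ 1` (a Siegel zero). -/
def HasNoSiegelZero (c : ℝ) (d : ℕ) (χ : DirichletCharacter ℂ d) : Prop :=
  ¬ ∃ β : ℝ, 1 - c / Real.log d ≤ β ∧ β ≤ 1 ∧ LFun d χ (β : ℂ) = 0

/-- The logarithmic integral `Li(t) = ∫_2^t du / log u`. -/
noncomputable def Li (t : ℝ) : ℝ := ∫ u in (2:ℝ)..t, 1 / Real.log u

section

open Filter Topology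

namespace RaceProof

noncomputable def zt (n : ℕ) (s : ℂ) : ℂ :=
  (s - 1) * ((n + 1 : ℝ) : ℂ) ^ (-s) - ((n + 1 : ℝ) : ℂ) ^ (1 - s) + ((n + 2 : ℝ) : ℂ) ^ (1 - s)

lemma norm_zt_le (n : ℕ) (s : ℂ) (hs : 1 / 2 ≤ s.re) :
    ‖zt n s‖ ≤ ‖s - 1‖ * ‖s‖ * (n + 1 : ℝ) ^ (-(3 / 2) : ℝ) := by
  set M : ℝ := ‖s - 1‖ * ‖s‖ * (n + 1 : ℝ) ^ (-(3 / 2) : ℝ) with hM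
  have hn : (0 : ℝ) < n + 1 := by positivity
  have hM0 : 0 ≤ M := by positivity
  -- first derivative
  have d1 : ∀ u : ℝ, 0 < u → ∀ r : ℂ, HasDerivAt (fun x : ℝ => (x : ℂ) ^ r) (r * (u : ℂ) ^ (r - 1)) u := by
    intro u hu r
    have h := (Complex.hasStrictDerivAt_cpow_const (x := (u : ℂ)) (c := r)
      (Or.inl (by simpa using hu))).hasDerivAt.comp_ofReal
    simpa using h
  have b2 : ∀ u ∈ Set.Icc (n + 1 : ℝ) (n + 2), ‖(1 - s) * (-s * (u : ℂ) ^ (-s - 1))‖ ≤ M := by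
    intro u hu
    have hu0 : 0 < u := hn.trans_le hu.1
    rw [norm_mul, norm_mul, norm_neg, Complex.norm_cpow_eq_rpow_re_of_pos hu0, norm_sub_rev, hM, ← mul_assoc]
    gcongr
    have h1 : (1 : ℝ) ≤ u := by have := hu.1; have : (0 : ℝ) ≤ n := by positivity
                                linarith
    calc u ^ (-s - 1).re ≤ u ^ (-(3 / 2) : ℝ) :=
          Real.rpow_le_rpow_of_exponent_le h1 (by simp; linarith)
      _ ≤ _ := Real.rpow_le_rpow_of_nonpos hn hu.1 (by norm_num)
  have c1 : ∀ u ∈ Set.Icc (n + 1 : ℝ) (n + 2),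
      ‖(1 - s) * (u : ℂ) ^ (-s) - (1 - s) * ((n + 1 : ℝ) : ℂ) ^ (-s)‖ ≤ M := by
    intro u hu
    have := (convex_Icc (n + 1 : ℝ) (n + 2)).norm_image_sub_le_of_norm_hasDerivWithin_le
      (f := fun x : ℝ => (1 - s) * (x : ℂ) ^ (-s))
      (f' := fun u : ℝ => (1 - s) * (-s * (u : ℂ) ^ (-s - 1)))
      (fun x hx => ((d1 x (hn.trans_le hx.1) (-s)).const_mul (1 - s)).hasDerivWithinAt) b2
      (Set.left_mem_Icc.2 (by linarith)) hu
    refine this.trans ?_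
    have h3 : ‖u - (n + 1 : ℝ)‖ ≤ 1 := by
      rw [Real.norm_eq_abs, abs_le]; constructor <;> linarith [hu.1, hu.2]
    nlinarith
  have := (convex_Icc (n + 1 : ℝ) (n + 2)).norm_image_sub_le_of_norm_hasDerivWithin_le
      (f := fun x : ℝ => (x : ℂ) ^ (1 - s) - (x : ℂ) * ((1 - s) * ((n + 1 : ℝ) : ℂ) ^ (-s)))
      (f' := fun u : ℝ => (1 - s) * (u : ℂ) ^ (-s) - (1 - s) * ((n + 1 : ℝ) : ℂ) ^ (-s))
      (fun x hx => by
        have e := (d1 x (hn.trans_le hx.1) (1 - s)).fun_sub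
          ((Complex.ofRealCLM.hasDerivAt (x := x)).mul_const ((1 - s) * ((n + 1 : ℝ) : ℂ) ^ (-s)))
        have e2 : (1 - s - 1) = -s := by ring
        rw [e2] at e
        simpa using e.hasDerivWithinAt) c1
      (Set.left_mem_Icc.2 (by linarith)) (Set.right_mem_Icc.2 (by linarith))
  have e : ‖(n + 2 : ℝ) - (n + 1)‖ = 1 := by norm_num
  rw [e, mul_one] at this
  refine (le_of_eq ?_).trans this
  congr 1
  unfold zt
  push_cast
  ring

noncomputable def C0 : ℝ := ∑' n : ℕ, (n + 1 : ℝ) ^ (-(3 / 2) : ℝ)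

lemma summable_C0 : Summable fun n : ℕ => (n + 1 : ℝ) ^ (-(3 / 2) : ℝ) := by
  have := (summable_nat_add_iff 1).2 (Real.summable_nat_rpow.2 (by norm_num : (-(3 / 2) : ℝ) < -1))
  simpa using this

lemma C0_nonneg : 0 ≤ C0 := tsum_nonneg fun n => by positivity

/-- `Z s = (s-1) ζ(s)` -/
noncomputable def Z (s : ℂ) : ℂ := 1 + ∑' n : ℕ, zt n s

lemma summable_zt (s : ℂ) (hs : 1 / 2 ≤ s.re) : Summable fun n => zt n s :=
  .of_norm_bounded (summable_C0.mul_left (‖s - 1‖ * ‖s‖)) fun n => norm_zt_le n s hs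

lemma norm_Z_sub_one_le (s : ℂ) (hs : 1 / 2 ≤ s.re) : ‖Z s - 1‖ ≤ ‖s - 1‖ * ‖s‖ * C0 := by
  unfold Z C0
  rw [add_sub_cancel_left, ← tsum_mul_left]
  exact tsum_of_norm_bounded (summable_C0.mul_left (‖s - 1‖ * ‖s‖)).hasSum fun n => norm_zt_le n s hs

lemma differentiable_zt (n : ℕ) : Differentiable ℂ (zt n) := by
  intro s
  have h1 : ((n + 1 : ℝ) : ℂ) ≠ 0 := by exact_mod_cast (by positivity : (n + 1 : ℝ) ≠ 0)
  have h2 : ((n + 2 : ℝ) : ℂ) ≠ 0 := by exact_mod_cast (by positivity : (n + 2 : ℝ) ≠ 0)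
  unfold zt
  have : ∀ (b : ℂ), b ≠ 0 → ∀ f : ℂ → ℂ, DifferentiableAt ℂ f s → DifferentiableAt ℂ (fun s => b ^ f s) s :=
    fun b hb f hf => hf.const_cpow (Or.inl hb)
  exact (((differentiableAt_id.sub_const 1).mul (this _ h1 _ differentiableAt_id.neg)).sub
    (this _ h1 _ (differentiableAt_id.const_sub 1))).add (this _ h2 _ (differentiableAt_id.const_sub 1))

lemma differentiableAt_Z (s : ℂ) (hs : 1 / 2 < s.re) : DifferentiableAt ℂ Z s := by
  set U : Set ℂ := {z | 1 / 2 < z.re} ∩ Metric.ball 0 (‖s‖ + 1)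
  have hU : IsOpen U := (isOpen_lt continuous_const Complex.continuous_re).inter Metric.isOpen_ball
  have hsU : s ∈ U := ⟨hs, by simp⟩
  have : DifferentiableOn ℂ (fun z => ∑' n, zt n z) U := by
    apply Complex.differentiableOn_tsum_of_summable_norm
      (summable_C0.mul_left ((‖s‖ + 1 + 1) * (‖s‖ + 1)))
      (fun n => (differentiable_zt n).differentiableOn) hU
    intro n z hz
    have hz2 : ‖z‖ ≤ ‖s‖ + 1 := by have := hz.2; simp at this; exact this.le
    refine (norm_zt_le n z hz.1.le).trans ?_
    gcongr
    refine (norm_sub_le _ _).trans ?_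
    simpa using hz2
  exact ((this s hsU).differentiableAt (hU.mem_nhds hsU)).const_add 1

lemma Z_eq (s : ℂ) (hs : 1 < s.re) : Z s = (s - 1) * riemannZeta s := by
  have hsum1 : Summable fun n : ℕ => ((n + 1 : ℝ) : ℂ) ^ (-s) := by
    have := (summable_nat_add_iff 1).2 (Complex.summable_one_div_nat_cpow.2 hs)
    refine this.congr fun n => ?_
    rw [Complex.cpow_neg]; push_cast; simp
  have hz : riemannZeta s = ∑' n : ℕ, ((n + 1 : ℝ) : ℂ) ^ (-s) := by
    rw [zeta_eq_tsum_one_div_nat_add_one_cpow hs]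
    refine tsum_congr fun n => ?_
    rw [Complex.cpow_neg]; push_cast; simp
  have hs2 : Summable fun n : ℕ => (((n + 1 : ℕ) + 1 : ℝ) : ℂ) ^ (1 - s) - ((n + 1 : ℝ) : ℂ) ^ (1 - s) := by
    refine ((summable_zt s (by linarith)).sub (hsum1.mul_left (s - 1))).congr fun n => ?_
    unfold zt
    push_cast
    ring_nf
  have ht : ∑' n : ℕ, ((((n + 1 : ℕ) + 1 : ℝ) : ℂ) ^ (1 - s) - ((n + 1 : ℝ) : ℂ) ^ (1 - s)) = -1 := by
    have h1 := hs2.hasSum.tendsto_sum_nat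
    have h2 : ∀ N : ℕ, ∑ n ∈ Finset.range N, ((((n + 1 : ℕ) + 1 : ℝ) : ℂ) ^ (1 - s) - ((n + 1 : ℝ) : ℂ) ^ (1 - s))
        = ((N + 1 : ℝ) : ℂ) ^ (1 - s) - 1 := by
      intro N
      rw [Finset.sum_range_sub (fun n : ℕ => ((n + 1 : ℝ) : ℂ) ^ (1 - s))]
      simp
    simp_rw [h2] at h1
    have h3 : Tendsto (fun N : ℕ => ((N + 1 : ℝ) : ℂ) ^ (1 - s) - 1) atTop (𝓝 (0 - 1)) := by
      refine Tendsto.sub_const ?_ 1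
      rw [tendsto_zero_iff_norm_tendsto_zero]
      have : ∀ N : ℕ, ‖((N + 1 : ℝ) : ℂ) ^ (1 - s)‖ = (N + 1 : ℝ) ^ (-(s.re - 1)) := by
        intro N
        rw [Complex.norm_cpow_eq_rpow_re_of_pos (by positivity)]
        simp
      simp_rw [this]
      exact (tendsto_rpow_neg_atTop (by linarith)).comp
        (tendsto_atTop_add_const_right _ 1 tendsto_natCast_atTop_atTop)
    rw [tendsto_nhds_unique h1 h3]; simp
  have : ∀ n, zt n s = (s - 1) * ((n + 1 : ℝ) : ℂ) ^ (-s)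
      + ((((n + 1 : ℕ) + 1 : ℝ) : ℂ) ^ (1 - s) - ((n + 1 : ℝ) : ℂ) ^ (1 - s)) := by
    intro n; unfold zt; push_cast; ring_nf
  unfold Z
  rw [hz, tsum_congr this, (hsum1.mul_left (s - 1)).tsum_add hs2, tsum_mul_left, ht]
  ring

end RaceProof

end

section

open Filter Topology

namespace RaceProof

lemma norm_Z_le (s : ℂ) (hs : 1 / 2 ≤ s.re) : ‖Z s‖ ≤ (1 + C0) * (1 + ‖s‖) ^ 2 := by
  have h1 := norm_Z_sub_one_le s hs
  have h2 : ‖Z s‖ ≤ ‖Z s - 1‖ + 1 := by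
    have := norm_add_le (Z s - 1) 1
    simpa using this
  have h3 : ‖s - 1‖ ≤ ‖s‖ + 1 := by simpa using norm_sub_le s 1
  have h0 := C0_nonneg
  have h4 : ‖s - 1‖ * ‖s‖ * C0 ≤ (‖s‖ + 1) * ‖s‖ * C0 := by gcongr
  nlinarith [norm_nonneg s, mul_nonneg h0 (norm_nonneg s)]

lemma differentiableOn_Z : DifferentiableOn ℂ Z {s | 1 / 2 < s.re} :=
  fun s hs => (differentiableAt_Z s hs).differentiableWithinAt

lemma isOpen_half : IsOpen {s : ℂ | 1 / 2 < s.re} := isOpen_lt continuous_const Complex.continuous_re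

lemma differentiableAt_deriv_Z (s : ℂ) (hs : 1 / 2 < s.re) : DifferentiableAt ℂ (deriv Z) s :=
  ((differentiableOn_Z.deriv isOpen_half) s hs).differentiableAt (isOpen_half.mem_nhds hs)

lemma cauchy_bound (f : ℂ → ℂ) (s : ℂ) (B : ℝ) (hf : ∀ z, ‖z - s‖ ≤ 1 / 8 → DifferentiableAt ℂ f z)
    (hB : ∀ z, ‖z - s‖ = 1 / 8 → ‖f z‖ ≤ B) : ‖deriv f s‖ ≤ 8 * B := by
  have := Complex.norm_deriv_le_of_forall_mem_sphere_norm_le (c := s) (R := 1 / 8) (C := B) (F := ℂ) (f := f)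
    (by norm_num) (DifferentiableOn.diffContOnCl (by
      intro z hz
      rw [closure_ball _ (by norm_num)] at hz
      refine (hf z ?_).differentiableWithinAt
      simpa [dist_eq_norm] using hz)) (fun z hz => hB z (by simpa [dist_eq_norm] using hz))
  linarith

lemma re_ge_of_near {z s : ℂ} {r : ℝ} (h : ‖z - s‖ ≤ r) : s.re - r ≤ z.re := by
  have := (Complex.abs_re_le_norm (z - s)).trans h
  rw [Complex.sub_re, abs_le] at this
  linarith

lemma norm_le_of_near {z s : ℂ} {r : ℝ} (h : ‖z - s‖ ≤ r) : ‖z‖ ≤ ‖s‖ + r := by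
  have := norm_add_le (z - s) s
  simp at this; linarith

lemma norm_deriv_Z_le (s : ℂ) (hs : 3 / 4 ≤ s.re) : ‖deriv Z s‖ ≤ 8 * ((1 + C0) * (2 + ‖s‖) ^ 2) := by
  have h0 := C0_nonneg
  apply cauchy_bound
  · intro z hz
    exact differentiableAt_Z z (by linarith [re_ge_of_near hz])
  · intro z hz
    refine (norm_Z_le z (by linarith [re_ge_of_near hz.le])).trans ?_
    have := norm_le_of_near hz.le
    have h2 : (1 + ‖z‖) ^ 2 ≤ (2 + ‖s‖) ^ 2 := pow_le_pow_left₀ (by positivity) (by linarith) 2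
    exact mul_le_mul_of_nonneg_left h2 (by linarith)

lemma norm_deriv2_Z_le (s : ℂ) (hs : 1 ≤ s.re) :
    ‖deriv (deriv Z) s‖ ≤ 8 * (8 * ((1 + C0) * (3 + ‖s‖) ^ 2)) := by
  have h0 := C0_nonneg
  apply cauchy_bound
  · intro z hz
    exact differentiableAt_deriv_Z z (by linarith [re_ge_of_near hz])
  · intro z hz
    refine (norm_deriv_Z_le z (by linarith [re_ge_of_near hz.le])).trans ?_
    have := norm_le_of_near hz.le
    have h2 : (2 + ‖z‖) ^ 2 ≤ (3 + ‖s‖) ^ 2 := pow_le_pow_left₀ (by positivity) (by linarith) 2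
    have := mul_le_mul_of_nonneg_left h2 (show 0 ≤ 1 + C0 by linarith)
    linarith

/-- the point `1 + x + i y` -/
noncomputable def pt (x y : ℝ) : ℂ := 1 + x + Complex.I * y

@[simp] lemma pt_re (x y : ℝ) : (pt x y).re = 1 + x := by simp [pt]
@[simp] lemma pt_im (x y : ℝ) : (pt x y).im = y := by simp [pt]

lemma norm_pt_le (x y : ℝ) (hx : 0 ≤ x) (hx1 : x ≤ 1) : ‖pt x y‖ ≤ 2 + |y| := by
  have := Complex.norm_le_abs_re_add_abs_im (pt x y)
  rw [pt_re, pt_im, abs_of_nonneg (by linarith)] at this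
  linarith

lemma Z_bounds : ∃ C : ℝ, 1 ≤ C ∧ ∀ x y : ℝ, 0 ≤ x → x ≤ 1 → ‖Z (pt x y)‖ ≤ C * (2 + |y|) ^ 2 ∧
    ‖deriv Z (pt x y)‖ ≤ C * (2 + |y|) ^ 2 ∧ ‖deriv (deriv Z) (pt x y)‖ ≤ C * (2 + |y|) ^ 2 := by
  have h0 := C0_nonneg
  refine ⟨576 * (1 + C0), by linarith, fun x y hx hx1 => ?_⟩
  have hp := norm_pt_le x y hx hx1
  have hn := norm_nonneg (pt x y)
  have hy := abs_nonneg y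
  have key : ∀ a : ℝ, a ≤ 3 → 0 ≤ a → (1 + C0) * (a + ‖pt x y‖) ^ 2 ≤ (1 + C0) * (9 * (2 + |y|) ^ 2) := by
    intro a ha ha0
    have : (a + ‖pt x y‖) ≤ 3 * (2 + |y|) := by linarith
    have : (a + ‖pt x y‖) ^ 2 ≤ (3 * (2 + |y|)) ^ 2 := by gcongr
    gcongr
    linarith
  have hpos : 0 ≤ (1 + C0) * (2 + |y|) ^ 2 := by positivity
  refine ⟨?_, ?_, ?_⟩
  · refine (norm_Z_le _ (by simp; linarith)).trans ((key 1 (by norm_num) (by norm_num)).trans (by nlinarith))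
  · refine (norm_deriv_Z_le _ (by simp; linarith)).trans ?_
    have := key 2 (by norm_num) (by norm_num)
    nlinarith
  · refine (norm_deriv2_Z_le _ (by simp; linarith)).trans ?_
    have := key 3 (by norm_num) (by norm_num)
    nlinarith

lemma three_four_one (x y : ℝ) (hx : 0 < x) :
    1 ≤ ‖riemannZeta (pt x 0)‖ ^ 3 * ‖riemannZeta (pt x y)‖ ^ 4 * ‖riemannZeta (pt x (2 * y))‖ := by
  have := DirichletCharacter.norm_LFunction_product_ge_one (N := 1) (1 : DirichletCharacter ℂ 1) hx y
  simp only [DirichletCharacter.LFunctionTrivChar, one_pow, DirichletCharacter.LFunction_modOne_eq,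
    norm_mul, norm_pow] at this
  have e1 : pt x 0 = 1 + x := by simp [pt]
  have e2 : pt x (2 * y) = 1 + x + 2 * Complex.I * y := by simp [pt]; ring
  rw [e1, e2, pt]
  exact this

lemma three_four_one_Z (x y : ℝ) (hx : 0 < x) :
    2 * x ^ 3 * |y| ^ 5 ≤ ‖Z (pt x 0)‖ ^ 3 * ‖Z (pt x y)‖ ^ 4 * ‖Z (pt x (2 * y))‖ := by
  have h := three_four_one x y hx
  have key : ∀ u : ℝ, ‖Z (pt x u)‖ = ‖pt x u - 1‖ * ‖riemannZeta (pt x u)‖ := by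
    intro u; rw [Z_eq _ (by simp [hx]), norm_mul]
  have k1 : x ≤ ‖pt x 0 - 1‖ := by
    have := Complex.abs_re_le_norm (pt x 0 - 1)
    simp [abs_of_pos hx] at this; exact this
  have k2 : ∀ u : ℝ, |u| ≤ ‖pt x u - 1‖ := by
    intro u
    have := Complex.abs_im_le_norm (pt x u - 1)
    simpa using this
  have k3 := k2 y
  have k4 := k2 (2 * y)
  rw [abs_mul, abs_two] at k4
  rw [key, key, key]
  calc 2 * x ^ 3 * |y| ^ 5 = (x ^ 3 * |y| ^ 4 * (2 * |y|)) * 1 := by ring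
    _ ≤ (‖pt x 0 - 1‖ ^ 3 * ‖pt x y - 1‖ ^ 4 * ‖pt x (2 * y) - 1‖) * (‖riemannZeta (pt x 0)‖ ^ 3 * ‖riemannZeta (pt x y)‖ ^ 4 * ‖riemannZeta (pt x (2 * y))‖) := by
        gcongr
    _ = _ := by ring

lemma Z_lower : ∃ ρ c : ℝ, 0 < ρ ∧ ρ ≤ 1 ∧ 0 < c ∧ ∀ x y : ℝ, 0 < x → x ≤ ρ →
    c / (2 + |y|) ^ 8 ≤ ‖Z (pt x y)‖ := by
  obtain ⟨C, hC1, hC⟩ := Z_bounds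
  have h0 := C0_nonneg
  set ρ : ℝ := 1 / (12 * (1 + C0)) with hρ
  have hρ0 : 0 < ρ := by positivity
  have hρ1 : ρ ≤ 1 / 12 := by
    rw [hρ, div_le_div_iff₀ (by positivity) (by norm_num)]; linarith
  -- constants
  set c2 : ℝ := ρ ^ 5 / (128 * C ^ 4) with hc2
  have hc20 : 0 < c2 := by positivity
  set κ : ℝ := min ρ (c2 / (16 * C ^ 4)) with hκ
  have hκ0 : 0 < κ := by positivity
  have hκ2 : κ * (16 * C ^ 4) ≤ c2 := by
    rw [← le_div_iff₀ (by positivity)]; exact min_le_right _ _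
  refine ⟨ρ, min (κ * C) (1 / 2), hρ0, by linarith, by positivity, fun x y hx hxρ => ?_⟩
  set τ : ℝ := 2 + |y| with hτ
  have hτ1 : 1 ≤ τ := by have := abs_nonneg y; linarith
  by_cases hy : |y| ≤ ρ
  · -- near 1
    have h1 : ‖pt x y - 1‖ ≤ 2 * ρ := by
      have := Complex.norm_le_abs_re_add_abs_im (pt x y - 1)
      simp [abs_of_pos hx] at this
      linarith
    have h2 := norm_pt_le x y hx.le (by linarith)
    have h3 := norm_Z_sub_one_le (pt x y) (by simp; linarith)
    have h4 : ‖pt x y - 1‖ * ‖pt x y‖ * C0 ≤ (2 * ρ) * 3 * (1 + C0) := by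
      gcongr <;> linarith
    have h5 : (2 * ρ) * 3 * (1 + C0) = 1 / 2 := by rw [hρ]; field_simp; norm_num
    have h6 : 1 / 2 ≤ ‖Z (pt x y)‖ := by
      have := norm_sub_le (Z (pt x y)) (Z (pt x y) - 1)
      simp at this; linarith
    refine le_trans ?_ h6
    refine (div_le_self (by positivity) (one_le_pow₀ hτ1)).trans (min_le_right _ _)
  · push Not at hy
    -- fourth power bound
    have four : ∀ u : ℝ, 0 < u → u ≤ ρ → c2 * u ^ 3 / τ ^ 2 ≤ ‖Z (pt u y)‖ ^ 4 := by
      intro u hu huρ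
      have h := three_four_one_Z u y hu
      have b1 := (hC u 0 hu.le (by linarith)).1
      have b2 := (hC u (2 * y) hu.le (by linarith)).1
      rw [abs_zero] at b1
      rw [abs_mul, abs_two] at b2
      have b3 : ‖Z (pt u (2 * y))‖ ≤ 4 * C * τ ^ 2 := by
        refine b2.trans ?_
        have : (2 + 2 * |y|) ^ 2 ≤ (2 * τ) ^ 2 := by gcongr; rw [hτ]; linarith
        nlinarith
      have b4 : ‖Z (pt u 0)‖ ≤ 4 * C := by linarith
      have h1 : 2 * u ^ 3 * ρ ^ 5 ≤ (4 * C) ^ 3 * ‖Z (pt u y)‖ ^ 4 * (4 * C * τ ^ 2) :=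
        calc 2 * u ^ 3 * ρ ^ 5 ≤ 2 * u ^ 3 * |y| ^ 5 := by gcongr
          _ ≤ _ := h
          _ ≤ _ := by gcongr
      rw [div_le_iff₀ (by positivity), hc2, div_mul_eq_mul_div, div_le_iff₀ (by positivity)]
      nlinarith
    set a : ℝ := κ / τ ^ 10 with ha
    have ha0 : 0 < a := by positivity
    have haρ : a ≤ ρ := (div_le_self hκ0.le (one_le_pow₀ hτ1)).trans (min_le_left _ _)
    have hfin : min (κ * C) (1 / 2) / τ ^ 8 ≤ a * C * τ ^ 2 := by
      have : a * C * τ ^ 2 = κ * C / τ ^ 8 := by rw [ha]; field_simp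
      rw [this]; gcongr; exact min_le_left _ _
    have big : ∀ u : ℝ, a ≤ u → u ≤ ρ → 2 * (a * C * τ ^ 2) ≤ ‖Z (pt u y)‖ := by
      intro u hu huρ
      have h4 := four u (ha0.trans_le hu) huρ
      refine le_of_pow_le_pow_left₀ (n := 4) (by norm_num) (norm_nonneg _) (le_trans ?_ h4)
      have h5 : c2 * a ^ 3 / τ ^ 2 ≤ c2 * u ^ 3 / τ ^ 2 := by gcongr
      refine le_trans ?_ h5
      rw [le_div_iff₀ (by positivity)]
      have : (2 * (a * C * τ ^ 2)) ^ 4 * τ ^ 2 = (a * τ ^ 10) * (16 * C ^ 4) * a ^ 3 := by ring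
      rw [this]
      have : a * τ ^ 10 = κ := by rw [ha]; field_simp
      rw [this]
      gcongr
    by_cases hxa : a ≤ x
    · have := big x hxa hxρ
      have : 0 ≤ a * C * τ ^ 2 := by positivity
      linarith
    · push Not at hxa
      have h1 := big a le_rfl haρ
      have h2 : ‖Z (pt a y) - Z (pt x y)‖ ≤ C * τ ^ 2 * ‖pt a y - pt x y‖ := by
        have hconv : Convex ℝ {s : ℂ | 1 ≤ s.re ∧ s.re ≤ 2 ∧ s.im = y} := by
          refine (convex_halfSpace_re_ge 1).inter ((convex_halfSpace_re_le 2).inter ?_)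
          exact (convex_singleton y).linear_preimage Complex.imLm
        refine hconv.norm_image_sub_le_of_norm_deriv_le (𝕜 := ℂ) (f := Z) ?_ ?_ ?_ ?_
        · intro s hs; exact differentiableAt_Z s (by linarith [hs.1])
        · intro s hs
          have : s = pt (s.re - 1) y := by
            apply Complex.ext <;> simp [hs.2.2]
          rw [this]
          exact (hC (s.re - 1) y (by linarith [hs.1]) (by linarith [hs.2.1])).2.1
        · simp; constructor <;> linarith
        · simp; constructor <;> linarith
      have h3 : ‖pt a y - pt x y‖ ≤ a := by
        have : pt a y - pt x y = ((a - x : ℝ) : ℂ) := by simp [pt]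
        rw [this, Complex.norm_real, Real.norm_eq_abs, abs_of_nonneg (by linarith)]
        linarith
      have h4 : C * τ ^ 2 * ‖pt a y - pt x y‖ ≤ C * τ ^ 2 * a := by gcongr
      have h5 : ‖Z (pt a y)‖ ≤ ‖Z (pt x y)‖ + ‖Z (pt a y) - Z (pt x y)‖ := by
        have := norm_add_le (Z (pt x y)) (Z (pt a y) - Z (pt x y))
        simpa using this
      nlinarith

end RaceProof

end

section

open Filter Topology MeasureTheory

namespace RaceProof

/-- normalised Chebyshev function -/
noncomputable def hh (v : ℝ) : ℝ := Chebyshev.psi (Real.exp v) * Real.exp (-v)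

lemma hh_nonneg (v : ℝ) : 0 ≤ hh v := mul_nonneg (Chebyshev.psi_nonneg _) (Real.exp_pos _).le

lemma hh_le (v : ℝ) : hh v ≤ 6 := by
  have h := Chebyshev.psi_le_const_mul_self (Real.exp_pos v).le
  have h2 : hh v ≤ (Real.log 4 + 4) * Real.exp v * Real.exp (-v) := by
    unfold hh; gcongr
  rw [mul_assoc, ← Real.exp_add, add_neg_cancel, Real.exp_zero, mul_one] at h2
  have : Real.log 4 = 2 * Real.log 2 := by
    rw [show (4:ℝ) = 2 ^ 2 by norm_num, Real.log_pow]; norm_num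
  have := Real.log_two_lt_d9
  linarith

lemma measurable_hh : Measurable hh := by
  unfold hh
  have : Measurable Chebyshev.psi := Chebyshev.psi_mono.measurable
  fun_prop

lemma hh_mono {v w : ℝ} (h : v ≤ w) : hh v * Real.exp (-(w - v)) ≤ hh w := by
  unfold hh
  rw [mul_assoc, ← Real.exp_add]
  have : -v + -(w - v) = -w := by ring
  rw [this]
  exact mul_le_mul_of_nonneg_right (Chebyshev.psi_mono (Real.exp_le_exp.2 h)) (Real.exp_pos _).le

lemma psi_laplace (s : ℂ) (hs : 1 < s.re) :
    ∫ v in Set.Ioi (0:ℝ), (hh v : ℂ) * Complex.exp (-(s - 1) * v) =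
      (- deriv riemannZeta s / riemannZeta s) / s := by
  have hs0 : s ≠ 0 := by rintro rfl; simp at hs; linarith
  have h1 := LSeries_eq_mul_integral_of_nonneg (fun n => ArithmeticFunction.vonMangoldt n) (r := 1)
    zero_le_one (s := s) hs ?_ (fun n => ArithmeticFunction.vonMangoldt_nonneg)
  · have h2 := ArithmeticFunction.LSeries_vonMangoldt_eq_deriv_riemannZeta_div hs
    rw [← h2, h1, mul_div_cancel_left₀ _ hs0, ← Real.exp_zero, ← Real.image_exp_Ioi,
      integral_image_eq_integral_abs_deriv_smul measurableSet_Ioi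
      (fun x _ => (Real.hasDerivAt_exp x).hasDerivWithinAt) Real.exp_injective.injOn]
    refine setIntegral_congr_fun measurableSet_Ioi (fun v _ => ?_)
    simp only [hh, Chebyshev.psi]
    rw [abs_of_pos (Real.exp_pos v), Complex.real_smul, 
      Complex.cpow_def_of_ne_zero (by simp), ← Complex.ofReal_log (Real.exp_pos v).le, Real.log_exp]
    push_cast
    rw [show Finset.Icc 1 ⌊Real.exp v⌋₊ = Finset.Ioc 0 ⌊Real.exp v⌋₊ from rfl]
    have : Complex.exp (-v) * Complex.exp (-(s-1) * v) = Complex.exp v * Complex.exp (v * -(s+1)) := by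
      rw [← Complex.exp_add, ← Complex.exp_add]; congr 1; ring
    rw [mul_assoc, this]; ring
  · refine Asymptotics.IsBigO.of_bound 6 (Eventually.of_forall fun n => ?_)
    have := Chebyshev.psi_le_const_mul_self (Nat.cast_nonneg (α := ℝ) n)
    have h4 : Real.log 4 = 2 * Real.log 2 := by
      rw [show (4:ℝ) = 2 ^ 2 by norm_num, Real.log_pow]; norm_num
    have h2 := Real.log_two_lt_d9
    have hn := Nat.cast_nonneg (α := ℝ) n
    have h5 : Chebyshev.psi n = ∑ k ∈ Finset.Icc 1 n, ArithmeticFunction.vonMangoldt k := by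
      simp [Chebyshev.psi]; rfl
    rw [← h5, Real.norm_of_nonneg (Chebyshev.psi_nonneg _), Real.rpow_one, Real.norm_of_nonneg hn]
    nlinarith

/-- the transform of `hh - 1` -/
noncomputable def GG (s : ℂ) : ℂ := -(1 + deriv Z s / Z s) / s

lemma Z_ne_zero (s : ℂ) (hs : 1 < s.re) : Z s ≠ 0 := by
  rw [Z_eq s hs]
  refine mul_ne_zero ?_ (riemannZeta_ne_zero_of_one_lt_re hs)
  intro h
  have := congrArg Complex.re h
  simp at this; linarith

lemma integrableOn_hh (s : ℂ) (hs : 1 < s.re) :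
    IntegrableOn (fun v : ℝ => (hh v : ℂ) * Complex.exp (-(s - 1) * v)) (Set.Ioi 0) := by
  refine Integrable.bdd_mul (c := 6) (integrableOn_exp_mul_complex_Ioi (by simp; linarith) 0)
    (by have := measurable_hh; fun_prop) (Eventually.of_forall fun v => ?_)
  rw [Complex.norm_real, Real.norm_of_nonneg (hh_nonneg v)]; exact hh_le v

lemma hh_laplace (s : ℂ) (hs : 1 < s.re) :
    ∫ v in Set.Ioi (0:ℝ), ((hh v - 1 : ℝ) : ℂ) * Complex.exp (-(s - 1) * v) = GG s := by
  have e : ∀ v : ℝ, ((hh v - 1 : ℝ) : ℂ) * Complex.exp (-(s - 1) * v) =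
      (hh v : ℂ) * Complex.exp (-(s - 1) * v) - Complex.exp (-(s - 1) * v) := by
    intro v; push_cast; ring
  have hs0 : s ≠ 0 := by rintro rfl; simp at hs; linarith
  have hs1 : s - 1 ≠ 0 := by
    intro h
    have := congrArg Complex.re h
    simp at this; linarith
  have hre : (-(s - 1)).re < 0 := by simp; linarith
  simp_rw [e]
  rw [integral_sub (integrableOn_hh s hs) (integrableOn_exp_mul_complex_Ioi hre 0),
    psi_laplace s hs, integral_exp_mul_complex_Ioi hre]
  have hζ := riemannZeta_ne_zero_of_one_lt_re hs
  have hd : deriv Z s = riemannZeta s + (s - 1) * deriv riemannZeta s := by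
    have h1 : Z =ᶠ[𝓝 s] fun s => (s - 1) * riemannZeta s := by
      have : {z : ℂ | 1 < z.re} ∈ 𝓝 s := (isOpen_lt continuous_const Complex.continuous_re).mem_nhds hs
      filter_upwards [this] with z hz
      exact Z_eq z hz
    rw [h1.deriv_eq]
    have h2 : DifferentiableAt ℂ riemannZeta s := differentiableAt_riemannZeta (by
      intro h; rw [h] at hs; simp at hs)
    have h3 := ((hasDerivAt_id s).sub_const 1).mul h2.hasDerivAt
    have := h3.deriv
    simp only [id] at this
    rw [show (fun s => (s - 1) * riemannZeta s) = (fun x => x - 1) * riemannZeta from rfl]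
    rw [this]; ring
  simp only [GG, hd, Z_eq s hs]
  have hs2 : -(s - 1) ≠ 0 := neg_ne_zero.2 hs1
  simp only [Complex.ofReal_zero, mul_zero, Complex.exp_zero]
  rw [div_neg]
  field_simp
  ring

lemma hasDerivAt_GG (s : ℂ) (hs : 1 < s.re) :
    HasDerivAt GG ((1 + deriv Z s / Z s) / s ^ 2 -
      (deriv (deriv Z) s / Z s - (deriv Z s / Z s) ^ 2) / s) s := by
  have hs0 : s ≠ 0 := by rintro rfl; simp at hs; linarith
  have hz := Z_ne_zero s hs
  have h1 := (differentiableAt_Z s (by linarith)).hasDerivAt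
  have h2 := (differentiableAt_deriv_Z s (by linarith)).hasDerivAt
  have h3 := ((h2.div h1 hz).const_add 1).neg.div (hasDerivAt_id s) hs0
  convert! h3 using 1
  simp only [id, Pi.neg_apply, Pi.div_apply]
  field_simp
  ring

lemma GG_bounds : ∃ ρ C : ℝ, 0 < ρ ∧ ρ ≤ 1 ∧ 0 < C ∧ ∀ x y : ℝ, 0 < x → x ≤ ρ →
    ‖GG (pt x y)‖ ≤ C * (2 + |y|) ^ 20 ∧ ‖deriv GG (pt x y)‖ ≤ C * (2 + |y|) ^ 20 := by
  obtain ⟨ρ, c, hρ, hρ1, hc, hl⟩ := Z_lower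
  obtain ⟨C, hC, hb⟩ := Z_bounds
  set B : ℝ := max 1 (C / c) with hB
  have hB1 : 1 ≤ B := le_max_left _ _
  refine ⟨ρ, 4 * B ^ 2, hρ, hρ1, by positivity, fun x y hx hxρ => ?_⟩
  obtain ⟨-, b1, b2⟩ := hb x y hx.le (hxρ.trans hρ1)
  have l := hl x y hx hxρ
  set τ : ℝ := 2 + |y| with hτ
  have hτ1 : 1 ≤ τ := by have := abs_nonneg y; linarith
  have hs : 1 < (pt x y).re := by simp [hx]
  have hz : 0 < ‖Z (pt x y)‖ := norm_pos_iff.2 (Z_ne_zero _ hs)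
  have key : ∀ w : ℂ, ‖w‖ ≤ C * τ ^ 2 → ‖w / Z (pt x y)‖ ≤ B * τ ^ 10 := by
    intro w hw
    rw [norm_div, div_le_iff₀ hz]
    calc ‖w‖ ≤ C * τ ^ 2 := hw
      _ = C / c * τ ^ 10 * (c / τ ^ 8) := by field_simp
      _ ≤ B * τ ^ 10 * ‖Z (pt x y)‖ := by gcongr; exact le_max_right _ _
  have k1 := key _ b1
  have k2 := key _ b2
  have h1s : 1 ≤ ‖pt x y‖ := by
    have := Complex.abs_re_le_norm (pt x y)
    rw [abs_of_pos (by linarith)] at this; linarith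
  have hτ10 : 1 ≤ τ ^ 10 := one_le_pow₀ hτ1
  have hBτ : 1 ≤ B * τ ^ 10 := one_le_mul_of_one_le_of_one_le hB1 hτ10
  have hsq : B * τ ^ 10 ≤ B ^ 2 * τ ^ 20 := by
    have : B ^ 2 * τ ^ 20 = (B * τ ^ 10) * (B * τ ^ 10) := by ring
    rw [this]; nlinarith
  have n1 : ‖1 + deriv Z (pt x y) / Z (pt x y)‖ ≤ 1 + B * τ ^ 10 := by
    refine (norm_add_le _ _).trans ?_; simpa using k1
  constructor
  · rw [GG, norm_div, norm_neg]
    refine (div_le_self (norm_nonneg _) h1s).trans ?_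
    nlinarith
  · rw [(hasDerivAt_GG _ hs).deriv]
    refine (norm_sub_le _ _).trans ?_
    rw [norm_div, norm_div, norm_pow]
    refine (add_le_add (div_le_self (norm_nonneg _) (one_le_pow₀ h1s)) (div_le_self (norm_nonneg _) h1s)).trans ?_
    have n2 : ‖deriv (deriv Z) (pt x y) / Z (pt x y) - (deriv Z (pt x y) / Z (pt x y)) ^ 2‖ ≤
        B * τ ^ 10 + B ^ 2 * τ ^ 20 := by
      refine (norm_sub_le _ _).trans (add_le_add k2 ?_)
      rw [norm_pow]
      calc _ ≤ (B * τ ^ 10) ^ 2 := by gcongr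
        _ = _ := by ring
    nlinarith

end RaceProof

end

section

open Filter Topology MeasureTheory

namespace RaceProof

/-- auxiliary amplitude -/
noncomputable def uu (a b : ℝ) (t : ℝ) : ℂ := Complex.exp (-(b:ℂ) * (t:ℂ) ^ 2) * GG (pt a t)

lemma hasDerivAt_uu (a b t : ℝ) (ha : 0 < a) : HasDerivAt (uu a b)
    (Complex.exp (-(b:ℂ) * (t:ℂ) ^ 2) * (-(b:ℂ) * (2 * t)) * GG (pt a t) +
      Complex.exp (-(b:ℂ) * (t:ℂ) ^ 2) * (deriv GG (pt a t) * Complex.I)) t := by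
  have hs : 1 < (pt a t).re := by simp [ha]
  have h1 : HasDerivAt (fun t : ℝ => pt a t) Complex.I t := by
    unfold pt
    have := ((Complex.ofRealCLM.hasDerivAt (x := t)).const_mul Complex.I).const_add (1 + (a:ℂ))
    simpa using this
  have h2 : HasDerivAt (fun t : ℝ => GG (pt a t)) (deriv GG (pt a t) * Complex.I) t :=
    HasDerivAt.comp (𝕜 := ℝ) (𝕜' := ℂ) (h₂ := GG) t (hasDerivAt_GG _ hs).differentiableAt.hasDerivAt h1
  have h3 : HasDerivAt (fun t : ℝ => -(b:ℂ) * (t:ℂ) ^ 2) (-(b:ℂ) * (2 * t)) t := by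
    have := ((Complex.ofRealCLM.hasDerivAt (x := t)).pow 2).const_mul (-(b:ℂ))
    simpa using this
  exact (h3.cexp).mul h2

lemma pow_le_exp (u : ℝ) (hu : 0 ≤ u) : (2 + u) ^ 21 ≤ 2 ^ 21 * Real.exp (441 / 4) * Real.exp (u ^ 2 / 4) := by
  have h1 : 2 + u ≤ 2 * Real.exp (u / 2) := by
    have := Real.add_one_le_exp (u / 2); linarith
  calc (2 + u) ^ 21 ≤ (2 * Real.exp (u / 2)) ^ 21 := by gcongr
    _ = 2 ^ 21 * Real.exp (21 * (u / 2)) := by rw [mul_pow, ← Real.exp_nat_mul]; norm_num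
    _ ≤ 2 ^ 21 * Real.exp (441 / 4 + u ^ 2 / 4) := by
        gcongr; nlinarith [sq_nonneg (u - 21)]
    _ = _ := by rw [Real.exp_add]; ring

lemma J_bound : ∃ ρ C : ℝ, 0 < ρ ∧ ρ ≤ 1 ∧ 0 < C ∧ ∀ a T w : ℝ, 0 < a → a ≤ ρ → 1 ≤ T → 0 < w →
    |∫ v in Set.Ioi (0:ℝ), (hh v - 1) * Real.exp (-a * v) * Real.exp (-(T ^ 2 / 2) * (v - w) ^ 2)|
      ≤ C * T ^ 21 / w := by
  obtain ⟨ρ, C, hρ, hρ1, hC, hG⟩ := GG_bounds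
  set C1 : ℝ := C * (2 ^ 21 * Real.exp (441 / 4)) with hC1
  refine ⟨ρ, C1 * √(4 * Real.pi), hρ, hρ1, by positivity, fun a T w ha haρ hT hw => ?_⟩
  have hT0 : 0 < T := by linarith
  set b : ℝ := 1 / (2 * T ^ 2) with hb
  have hb0 : 0 < b := by positivity
  have h2b : 2 * b ≤ 1 := by
    rw [hb, mul_one_div, div_le_one (by positivity)]; nlinarith
  -- pointwise bounds
  have expo : ∀ t : ℝ, C * (2 + |t|) ^ 21 * Real.exp (-b * t ^ 2) ≤
      C1 * T ^ 21 * Real.exp (-(b / 2) * t ^ 2) := by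
    intro t
    have h1 : 2 + |t| ≤ T * (2 + |t| / T) := by
      rw [mul_add, mul_div_cancel₀ _ hT0.ne']; linarith
    have h2 := pow_le_exp (|t| / T) (by positivity)
    have h3 : (|t| / T) ^ 2 / 4 = (b / 2) * t ^ 2 := by
      rw [div_pow, sq_abs, hb]; field_simp; norm_num
    rw [h3] at h2
    calc C * (2 + |t|) ^ 21 * Real.exp (-b * t ^ 2)
        ≤ C * (T * (2 + |t| / T)) ^ 21 * Real.exp (-b * t ^ 2) := by gcongr
      _ = C * T ^ 21 * (2 + |t| / T) ^ 21 * Real.exp (-b * t ^ 2) := by ring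
      _ ≤ C * T ^ 21 * (2 ^ 21 * Real.exp (441 / 4) * Real.exp (b / 2 * t ^ 2)) * Real.exp (-b * t ^ 2) := by gcongr
      _ = C1 * T ^ 21 * (Real.exp (b / 2 * t ^ 2) * Real.exp (-b * t ^ 2)) := by rw [hC1]; ring
      _ = _ := by rw [← Real.exp_add]; congr 2; ring
  have hexp : ∀ t : ℝ, ‖Complex.exp (-(b:ℂ) * (t:ℂ) ^ 2)‖ = Real.exp (-b * t ^ 2) := by
    intro t
    rw [Complex.norm_exp]; congr 1
    have : (-(b:ℂ) * (t:ℂ) ^ 2) = ((-b * t ^ 2 : ℝ) : ℂ) := by push_cast; ring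
    rw [this, Complex.ofReal_re]
  have bu : ∀ t : ℝ, ‖uu a b t‖ ≤ C1 * T ^ 21 * Real.exp (-(b / 2) * t ^ 2) := by
    intro t
    refine le_trans ?_ (expo t)
    rw [uu, norm_mul, hexp, mul_comm]
    have h1 := (hG a t ha haρ).1
    have h2 : (2 + |t|) ^ 20 ≤ (2 + |t|) ^ 21 := by
      apply pow_le_pow_right₀ _ (by norm_num); linarith [abs_nonneg t]
    gcongr
    exact h1.trans (by gcongr)
  have bu' : ∀ t : ℝ, ‖deriv (uu a b) t‖ ≤ C1 * T ^ 21 * Real.exp (-(b / 2) * t ^ 2) := by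
    intro t
    refine le_trans ?_ (expo t)
    rw [(hasDerivAt_uu a b t ha).deriv]
    refine (norm_add_le _ _).trans ?_
    simp only [norm_mul, hexp, Complex.norm_I, mul_one]
    have h1 := (hG a t ha haρ).1
    have h2 := (hG a t ha haρ).2
    have h3 : ‖-(b:ℂ)‖ * (‖(2:ℂ)‖ * ‖(t:ℂ)‖) ≤ |t| := by
      rw [norm_neg, Complex.norm_real, Complex.norm_real, Real.norm_of_nonneg hb0.le, Real.norm_eq_abs]
      simp only [Complex.norm_ofNat]
      nlinarith [abs_nonneg t]
    calc _ ≤ Real.exp (-b * t ^ 2) * |t| * (C * (2 + |t|) ^ 20) + Real.exp (-b * t ^ 2) * (C * (2 + |t|) ^ 20) := by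
          gcongr
      _ = C * (2 + |t|) ^ 20 * (|t| + 1) * Real.exp (-b * t ^ 2) := by ring
      _ ≤ C * (2 + |t|) ^ 20 * (2 + |t|) * Real.exp (-b * t ^ 2) := by
          have h4 : |t| + 1 ≤ 2 + |t| := by linarith
          gcongr
      _ = _ := by ring
  have hIntegr : Integrable (fun t : ℝ => C1 * T ^ 21 * Real.exp (-(b / 2) * t ^ 2)) :=
    (integrable_exp_neg_mul_sq (by positivity)).const_mul _
  have hval : ∫ t : ℝ, C1 * T ^ 21 * Real.exp (-(b / 2) * t ^ 2) = C1 * √(4 * Real.pi) * T ^ 22 := by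
    rw [integral_const_mul, integral_gaussian]
    have : Real.pi / (b / 2) = (4 * Real.pi) * T ^ 2 := by rw [hb]; field_simp; norm_num
    rw [this, Real.sqrt_mul (by positivity), Real.sqrt_sq hT0.le]; ring
  have hucont : Continuous (uu a b) :=
    continuous_iff_continuousAt.2 fun t => (hasDerivAt_uu a b t ha).continuousAt
  set e : ℝ → ℂ := fun t => Complex.exp (Complex.I * w * t) with he
  have hecont : Continuous e := by rw [he]; fun_prop
  have hen : ∀ t, ‖e t‖ = 1 := by
    intro t
    simp only [he, Complex.norm_exp]
    simp
  have hed : ∀ t, HasDerivAt e (Complex.I * w * e t) t := by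
    intro t
    have := ((Complex.ofRealCLM.hasDerivAt (x := t)).const_mul (Complex.I * w)).cexp
    simp only [Complex.ofRealCLM_apply, Complex.ofReal_one, mul_one] at this
    convert! this using 1
    rw [mul_comm]
  have hu_int : Integrable (uu a b) := hIntegr.mono' hucont.aestronglyMeasurable (Eventually.of_forall bu)
  have hu'_int : Integrable (deriv (uu a b)) := hIntegr.mono' (measurable_deriv _).aestronglyMeasurable (Eventually.of_forall bu')
  have mulE : ∀ f : ℝ → ℂ, Integrable f → Integrable (f * e) := by
    intro f hf
    exact hf.mul_bdd (c := 1) hecont.aestronglyMeasurable (Eventually.of_forall fun t => (hen t).le)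
  have parts := integral_mul_deriv_eq_deriv_mul_of_integrable (u := uu a b) (v := e)
    (u' := deriv (uu a b)) (v' := fun t => Complex.I * w * e t)
    (fun t _ => (hasDerivAt_uu a b t ha).differentiableAt.hasDerivAt) (fun t _ => hed t)
    (by
      have := (mulE _ hu_int).const_mul (Complex.I * w)
      refine this.congr (Eventually.of_forall fun t => ?_)
      simp only [Pi.mul_apply]; ring) (mulE _ hu'_int) (mulE _ hu_int)
  have e1 : ∫ t : ℝ, uu a b t * (Complex.I * w * e t) = Complex.I * w * ∫ t : ℝ, uu a b t * e t := by
    rw [← integral_const_mul]; congr 1; ext t; ring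
  rw [e1] at parts
  have hI : ‖∫ t : ℝ, uu a b t * e t‖ ≤ C1 * √(4 * Real.pi) * T ^ 22 / w := by
    rw [le_div_iff₀ hw]
    have h1 : ‖∫ t : ℝ, deriv (uu a b) t * e t‖ ≤ C1 * √(4 * Real.pi) * T ^ 22 := by
      rw [← hval]
      refine norm_integral_le_of_norm_le hIntegr (Eventually.of_forall fun t => ?_)
      rw [norm_mul, hen, mul_one]; exact bu' t
    have h2 := congrArg norm parts
    rw [norm_neg, norm_mul, norm_mul, Complex.norm_I, one_mul, Complex.norm_real, Real.norm_of_nonneg hw.le] at h2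
    linarith
  -- Fubini
  set F : ℝ → ℝ → ℂ := fun t v => (Complex.exp (-(b:ℂ) * (t:ℂ) ^ 2) * e t) *
      (((hh v - 1 : ℝ) : ℂ) * Complex.exp (-(pt a t - 1) * v)) with hF
  have hf1 : ∀ t : ℝ, uu a b t * e t = ∫ v in Set.Ioi (0:ℝ), F t v := by
    intro t
    simp only [hF]
    rw [integral_const_mul, hh_laplace _ (by simp [ha]), uu]; ring
  have hFint : Integrable (Function.uncurry F) (volume.prod (volume.restrict (Set.Ioi (0:ℝ)))) := by
    have hi1 : Integrable (fun t : ℝ => Real.exp (-b * t ^ 2)) := integrable_exp_neg_mul_sq hb0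
    have hi2 : Integrable (fun v : ℝ => 7 * Real.exp (-a * v)) (volume.restrict (Set.Ioi (0:ℝ))) :=
      (integrableOn_exp_mul_Ioi (by linarith) 0).const_mul 7
    refine (hi1.mul_prod hi2).mono' ?_ (Eventually.of_forall fun z => ?_)
    · have := measurable_hh
      apply Measurable.aestronglyMeasurable
      simp only [Function.uncurry_def, hF, he, pt]
      fun_prop
    · simp only [Function.uncurry_def, hF, norm_mul, hexp, hen, mul_one]
      gcongr
      · rw [Complex.norm_real, Real.norm_eq_abs, abs_le]
        have := hh_nonneg z.2
        have := hh_le z.2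
        constructor <;> linarith
      · rw [Complex.norm_exp]
        simp [pt]
  have hf2 : ∫ t : ℝ, uu a b t * e t = ∫ v in Set.Ioi (0:ℝ), ∫ t : ℝ, F t v := by
    simp_rw [hf1]
    exact integral_integral_swap hFint
  have hf3 : ∀ v : ℝ, ∫ t : ℝ, F t v = ((Real.pi / b : ℝ) : ℂ) ^ (1 / 2 : ℂ) *
      (((hh v - 1) * Real.exp (-a * v) * Real.exp (-(T ^ 2 / 2) * (v - w) ^ 2) : ℝ) : ℂ) := by
    intro v
    have h1 := fourierIntegral_gaussian (b := (b:ℂ)) (by simpa using hb0) ((w - v : ℝ) : ℂ)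
    have h2 : ∀ t : ℝ, F t v = (((hh v - 1) * Real.exp (-a * v) : ℝ) : ℂ) *
        (Complex.exp (Complex.I * ((w - v : ℝ) : ℂ) * t) * Complex.exp (-(b:ℂ) * (t:ℂ) ^ 2)) := by
      intro t
      have h3 : e t * Complex.exp (-(pt a t - 1) * v) = Complex.exp (-a * v) *
          Complex.exp (Complex.I * ((w - v : ℝ) : ℂ) * t) := by
        simp only [he, pt]
        rw [← Complex.exp_add, ← Complex.exp_add]; congr 1; push_cast; ring
      simp only [hF]
      calc _ = Complex.exp (-(b:ℂ) * (t:ℂ) ^ 2) * ((hh v - 1 : ℝ) : ℂ) * (e t * Complex.exp (-(pt a t - 1) * v)) := by ring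
        _ = _ := by rw [h3]; push_cast; ring
    simp_rw [h2]
    rw [integral_const_mul, h1]
    have h4 : Complex.exp (-((w - v : ℝ) : ℂ) ^ 2 / (4 * b)) = ((Real.exp (-(T ^ 2 / 2) * (v - w) ^ 2) : ℝ) : ℂ) := by
      rw [Complex.ofReal_exp]; congr 1
      rw [hb]; push_cast
      have : (T:ℂ) ≠ 0 := by exact_mod_cast hT0.ne'
      field_simp; ring
    rw [h4]; push_cast; ring
  simp_rw [hf3] at hf2
  rw [integral_const_mul, integral_complex_ofReal] at hf2
  have hn := congrArg norm hf2
  rw [norm_mul, Complex.norm_real, Real.norm_eq_abs,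
    Complex.norm_cpow_eq_rpow_re_of_pos (by positivity)] at hn
  have hre : ((1 / 2 : ℂ)).re = 1 / 2 := by norm_num
  rw [hre] at hn
  have hTle : T ≤ (Real.pi / b) ^ (1 / 2 : ℝ) := by
    rw [← Real.sqrt_eq_rpow]
    apply Real.le_sqrt_of_sq_le
    have : Real.pi / b = 2 * Real.pi * T ^ 2 := by rw [hb]; field_simp
    rw [this]; nlinarith [Real.pi_gt_three]
  rw [hn] at hI
  have h5 : T * |∫ v in Set.Ioi (0:ℝ), (hh v - 1) * Real.exp (-a * v) * Real.exp (-(T ^ 2 / 2) * (v - w) ^ 2)| ≤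
      C1 * √(4 * Real.pi) * T ^ 22 / w := le_trans (by gcongr) hI
  have h6 : C1 * √(4 * Real.pi) * T ^ 22 / w = T * (C1 * √(4 * Real.pi) * T ^ 21 / w) := by ring
  rw [h6] at h5
  exact le_of_mul_le_mul_left h5 hT0

end RaceProof

end

section

open Filter Topology MeasureTheory

namespace RaceProof

lemma tauber_core : ∃ C m1 : ℝ, 0 < C ∧ 1 ≤ m1 ∧ ∀ m w ρ0 : ℝ, ∀ σ : ℝ, m1 ≤ m → m ^ 45 / 2 ≤ w →
    0 ≤ ρ0 → ρ0 ≤ 6 → (σ = 1 ∨ σ = -1) →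
    (∀ v, |v - w| ≤ 1 / m → ρ0 ≤ σ * (hh v - 1)) → ρ0 ≤ C / m := by
  obtain ⟨ρ, C, hρ, hρ1, hC, hJ⟩ := J_bound
  refine ⟨Real.exp 2 * (2 * C + 192), 2 / ρ, by positivity, ?_, ?_⟩
  · rw [le_div_iff₀ hρ]; linarith
  intro m w ρ0 σ hm hw h0 h6 hσ hf
  have hm2 : 2 ≤ m := by
    refine le_trans ?_ hm
    rw [le_div_iff₀ hρ]; linarith
  have hm0 : 0 < m := by linarith
  have hmρ : 2 ≤ ρ * m := by rw [div_le_iff₀ hρ] at hm; linarith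
  have hmm : m ≤ m ^ 45 := le_self_pow₀ (by linarith) (by norm_num)
  have hw1 : 1 ≤ w := by linarith
  have hw0 : 0 < w := by linarith
  have ha : 1 / w ≤ ρ := by
    rw [div_le_iff₀ hw0]; nlinarith
  set T : ℝ := m ^ 2 with hT
  have hT1 : 1 ≤ T := one_le_pow₀ (by linarith)
  have hT0 : 0 < T := by linarith
  have hJ1 := hJ (1 / w) T w (by positivity) ha hT1 hw0
  set k : ℝ → ℝ := fun v => Real.exp (-(T ^ 2 / 2) * (v - w) ^ 2) with hk
  set k2 : ℝ → ℝ := fun v => Real.exp (-(T ^ 2 / 4) * (v - w) ^ 2) with hk2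
  have ik : Integrable k := (integrable_exp_neg_mul_sq (b := T ^ 2 / 2) (by positivity)).comp_sub_right w
  have ik2 : Integrable k2 := (integrable_exp_neg_mul_sq (b := T ^ 2 / 4) (by positivity)).comp_sub_right w
  have vk : ∫ v, k v = √(2 * Real.pi) / T := by
    have := integral_sub_right_eq_self (μ := volume) (fun v : ℝ => Real.exp (-(T ^ 2 / 2) * v ^ 2)) w
    rw [hk, this, integral_gaussian]
    rw [show Real.pi / (T ^ 2 / 2) = 2 * Real.pi / T ^ 2 by field_simp, Real.sqrt_div (by positivity), Real.sqrt_sq hT0.le]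
  have vk2 : ∫ v, k2 v = √(4 * Real.pi) / T := by
    have := integral_sub_right_eq_self (μ := volume) (fun v : ℝ => Real.exp (-(T ^ 2 / 4) * v ^ 2)) w
    rw [hk2, this, integral_gaussian]
    rw [show Real.pi / (T ^ 2 / 4) = 4 * Real.pi / T ^ 2 by field_simp, Real.sqrt_div (by positivity), Real.sqrt_sq hT0.le]
  set E : ℝ := Real.exp (-(m ^ 2 / 4)) with hE
  have hE0 : 0 < E := Real.exp_pos _
  have hEm : E ≤ 4 / m := by
    have h1 := Real.add_one_le_exp (m ^ 2 / 4)
    rw [hE, Real.exp_neg, inv_le_comm₀ (Real.exp_pos _) (by positivity), inv_div]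
    nlinarith
  have kle : ∀ v, 1 / m ≤ |v - w| → k v ≤ E * k2 v := by
    intro v hv
    simp only [hk, hk2, hE, ← Real.exp_add]
    apply Real.exp_le_exp.2
    have h1 : (1 / m) ^ 2 ≤ (v - w) ^ 2 := by
      rw [← sq_abs (v - w)]; gcongr
    have h2 : m ^ 2 = T ^ 2 * (1 / m) ^ 2 := by rw [hT]; field_simp
    have h3 : T ^ 2 * (1 / m) ^ 2 ≤ T ^ 2 * (v - w) ^ 2 := by gcongr
    linarith
  set g : ℝ → ℝ := fun v => σ * ((hh v - 1) * Real.exp (-(1 / w) * v) * k v) with hg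
  have hbd : ∀ v, |σ * (hh v - 1)| ≤ 6 := by
    intro v
    have := hh_nonneg v
    have := hh_le v
    rcases hσ with h | h <;> rw [h, abs_le] <;> constructor <;> linarith
  have ig : IntegrableOn g (Set.Ioi 0) := by
    refine Integrable.mono' (g := fun v => 6 * k v) (ik.const_mul 6).integrableOn ?_ ?_
    · have := measurable_hh
      simp only [hg, hk]
      apply Measurable.aestronglyMeasurable
      fun_prop
    · refine (ae_restrict_iff' measurableSet_Ioi).2 (Eventually.of_forall fun v hv => ?_)
      have hv' : 0 < v := hv
      have h1 : Real.exp (-(1 / w) * v) ≤ 1 := by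
        apply Real.exp_le_one_iff.2
        have : 0 ≤ 1 / w * v := by positivity
        linarith
      have e : g v = (σ * (hh v - 1)) * (Real.exp (-(1 / w) * v) * k v) := by simp only [hg]; ring
      rw [e, norm_mul, Real.norm_eq_abs, norm_mul, Real.norm_of_nonneg (Real.exp_pos _).le, Real.norm_of_nonneg (Real.exp_pos _).le]
      have : Real.exp (-(1 / w) * v) * k v ≤ 1 * k v := mul_le_mul_of_nonneg_right h1 (Real.exp_pos _).le
      rw [one_mul] at this
      have hk0 : 0 ≤ k v := (Real.exp_pos _).le
      gcongr
      exact hbd v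
  have he2 : Real.exp (-2) ≤ 1 := by apply Real.exp_le_one_iff.2; norm_num
  have hge2 : ρ0 * Real.exp (-2) ≤ 6 := by nlinarith [Real.exp_pos (-2)]
  have pointwise : ∀ v, ρ0 * Real.exp (-2) * k v - 12 * E * k2 v ≤ (Set.Ioi (0:ℝ)).indicator g v := by
    intro v
    have hk0 : 0 < k v := Real.exp_pos _
    have hk20 : 0 < k2 v := Real.exp_pos _
    by_cases hv : 0 < v
    · rw [Set.indicator_of_mem (show v ∈ Set.Ioi (0:ℝ) from hv)]
      have e : g v = (σ * (hh v - 1)) * Real.exp (-(1 / w) * v) * k v := by simp only [hg]; ring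
      rw [e]
      by_cases hd : |v - w| ≤ 1 / m
      · have h1 := hf v hd
        have h2 : Real.exp (-2) ≤ Real.exp (-(1 / w) * v) := by
          apply Real.exp_le_exp.2
          have h3 : 1 / m ≤ 1 := by rw [div_le_one hm0]; linarith
          have h4 : v ≤ 2 * w := by linarith [(abs_le.1 hd).2]
          have h5 : 1 / w * v ≤ 2 := by rw [one_div, ← div_eq_inv_mul, div_le_iff₀ hw0]; exact h4
          linarith
        have h3 : ρ0 * Real.exp (-2) ≤ (σ * (hh v - 1)) * Real.exp (-(1 / w) * v) :=
          mul_le_mul h1 h2 (Real.exp_pos _).le (by linarith)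
        have h4 := mul_le_mul_of_nonneg_right h3 hk0.le
        have : 0 < 12 * E * k2 v := by positivity
        linarith
      · push Not at hd
        have h1 := kle v hd.le
        have h2 : Real.exp (-(1 / w) * v) ≤ 1 := by
          apply Real.exp_le_one_iff.2
          have : 0 ≤ 1 / w * v := by positivity
          linarith
        have h3 : -6 ≤ (σ * (hh v - 1)) * Real.exp (-(1 / w) * v) := by
          have := (abs_le.1 (hbd v)).1
          nlinarith [Real.exp_pos (-(1 / w) * v)]
        nlinarith
    · rw [Set.indicator_of_notMem (by simpa using hv)]
      push Not at hv
      have hd : 1 / m ≤ |v - w| := by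
        rw [abs_sub_comm]
        refine le_trans ?_ (le_abs_self _)
        have h3 : 1 / m ≤ 1 := by rw [div_le_one hm0]; linarith
        linarith
      have h1 := kle v hd
      nlinarith
  have hi := integral_mono ((ik.const_mul (ρ0 * Real.exp (-2))).sub (ik2.const_mul (12 * E)))
    (ig.integrable_indicator measurableSet_Ioi) pointwise
  rw [integral_indicator measurableSet_Ioi, integral_sub' (ik.const_mul _) (ik2.const_mul _),
    integral_const_mul, integral_const_mul, vk, vk2] at hi
  have hJ2 : ∫ v in Set.Ioi (0:ℝ), g v ≤ C * T ^ 21 / w := by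
    simp only [hg]
    rw [integral_const_mul]
    refine le_trans ?_ hJ1
    rcases hσ with h | h <;> rw [h]
    · rw [one_mul]; exact le_abs_self _
    · rw [neg_one_mul]; exact neg_le_abs _
  have s1 : 1 ≤ √(2 * Real.pi) := by
    rw [Real.one_le_sqrt]; linarith [Real.pi_gt_three]
  have s2 : √(4 * Real.pi) ≤ 4 := by
    rw [Real.sqrt_le_left (by norm_num)]; linarith [Real.pi_lt_four]
  have hw2 : C * T ^ 21 / w * T ≤ 2 * C / m := by
    rw [div_mul_eq_mul_div, div_le_div_iff₀ hw0 hm0]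
    have : C * T ^ 21 * T * m = 2 * C * (m ^ 45 / 2) := by rw [hT]; ring
    rw [this]; gcongr
  have h7 : ρ0 * Real.exp (-2) * √(2 * Real.pi) ≤ C * T ^ 21 / w * T + 12 * E * √(4 * Real.pi) := by
    have := mul_le_mul_of_nonneg_right (hi.trans hJ2) hT0.le
    have e : (ρ0 * Real.exp (-2) * (√(2 * Real.pi) / T) - 12 * E * (√(4 * Real.pi) / T)) * T =
      ρ0 * Real.exp (-2) * √(2 * Real.pi) - 12 * E * √(4 * Real.pi) := by field_simp
    rw [e] at this
    linarith
  have h8 : ρ0 * Real.exp (-2) ≤ 2 * C / m + 192 / m := by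
    have a1 : ρ0 * Real.exp (-2) * 1 ≤ ρ0 * Real.exp (-2) * √(2 * Real.pi) := by gcongr
    have a2 : 12 * E * √(4 * Real.pi) ≤ 12 * (4 / m) * 4 := by gcongr
    have a3 : 12 * (4 / m) * 4 = 192 / m := by ring
    linarith
  calc ρ0 = Real.exp 2 * (ρ0 * Real.exp (-2)) := by
        rw [mul_comm ρ0, ← mul_assoc, ← Real.exp_add]; simp
    _ ≤ Real.exp 2 * (2 * C / m + 192 / m) := by gcongr
    _ = _ := by ring

lemma hh_rate : ∃ C V : ℝ, 0 < C ∧ 1 ≤ V ∧ ∀ v, V ≤ v → |hh v - 1| ≤ C * v ^ (-(1 / 45 : ℝ)) := by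
  obtain ⟨C, m1, hC, hm1, hc⟩ := tauber_core
  refine ⟨C + 12, (2 * m1) ^ 45, by positivity, one_le_pow₀ (by linarith), fun v hv => ?_⟩
  set m : ℝ := v ^ (1 / 45 : ℝ) with hm
  have hv0 : 0 < v := lt_of_lt_of_le (by positivity) hv
  have hmv : m ^ 45 = v := by
    rw [hm, ← Real.rpow_natCast, ← Real.rpow_mul hv0.le]; norm_num
  have hmm : 2 * m1 ≤ m := by
    rw [← hmv] at hv
    exact le_of_pow_le_pow_left₀ (by norm_num) (by positivity) hv
  have hm2 : 2 ≤ m := by linarith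
  have hm0 : 0 < m := by linarith
  have hrw : (C + 12) * v ^ (-(1 / 45 : ℝ)) = C / m + 12 * (1 / m) := by
    rw [Real.rpow_neg hv0.le, ← hm]; ring
  rw [hrw]
  set δ : ℝ := 1 / m with hδ
  have hδ0 : 0 < δ := by positivity
  have hδ1 : δ ≤ 1 / 2 := by rw [hδ]; gcongr
  have hvm : m ≤ v := by rw [← hmv]; exact le_self_pow₀ (by linarith) (by norm_num)
  have hCm : 0 < C / m := by positivity
  have hdecay : ∀ u v' : ℝ, u ≤ v' → v' ≤ u + 2 * δ → hh u - 12 * δ ≤ hh v' := by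
    intro u v' h1 h2
    have h3 := hh_mono h1
    have h4 : 1 - 2 * δ ≤ Real.exp (-(v' - u)) := by
      have := Real.add_one_le_exp (-(v' - u)); linarith
    have h5 : hh u * (1 - 2 * δ) ≤ hh u * Real.exp (-(v' - u)) :=
      mul_le_mul_of_nonneg_left h4 (hh_nonneg u)
    nlinarith [hh_le u, hh_nonneg u]
  rw [abs_le]
  constructor
  · by_contra hcon
    push Not at hcon
    have := hc m (v - δ) (1 - hh v - 12 * δ) (-1) (by linarith) (by rw [hmv]; linarith) (by linarith)
      (by linarith [hh_nonneg v]) (Or.inr rfl) (fun u hu => by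
        have hu' := abs_le.1 hu
        have := hdecay u v (by linarith [hu'.2]) (by linarith [hu'.1])
        linarith)
    linarith
  · by_contra hcon
    push Not at hcon
    have := hc m (v + δ) (hh v - 1 - 12 * δ) 1 (by linarith) (by rw [hmv]; linarith) (by linarith)
      (by linarith [hh_le v]) (Or.inl rfl) (fun u hu => by
        have hu' := abs_le.1 hu
        have := hdecay v u (by linarith [hu'.1]) (by linarith [hu'.2])
        linarith)
    linarith

lemma psi_rate : ∃ C X : ℝ, 0 < C ∧ 3 ≤ X ∧ ∀ x, X ≤ x →
    |Chebyshev.psi x - x| ≤ C * x * (Real.log x) ^ (-(1 / 45 : ℝ)) := by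
  obtain ⟨C, V, hC, hV, h⟩ := hh_rate
  refine ⟨C, max 3 (Real.exp V), hC, le_max_left _ _, fun x hx => ?_⟩
  have hx0 : 0 < x := by linarith [(le_max_left 3 (Real.exp V)).trans hx]
  have h1 := h (Real.log x) ((Real.le_log_iff_exp_le hx0).2 ((le_max_right _ _).trans hx))
  simp only [hh, Real.exp_neg, Real.exp_log hx0] at h1
  have e : Chebyshev.psi x * x⁻¹ - 1 = (Chebyshev.psi x - x) / x := by field_simp
  rw [e, abs_div, abs_of_pos hx0, div_le_iff₀ hx0] at h1
  linarith

end RaceProof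

end

section

open Filter Topology MeasureTheory

namespace RaceProof

/-- prime counting with real argument -/
noncomputable def PI (x : ℝ) : ℝ := (Nat.primeCounting ⌊x⌋₊ : ℝ)

lemma PI_nonneg (x : ℝ) : 0 ≤ PI x := Nat.cast_nonneg _

lemma PI_mono : Monotone PI := fun _ _ h =>
  Nat.cast_le.2 (Nat.monotone_primeCounting (Nat.floor_mono h))

lemma primeCounting_eq_card (n : ℕ) :
    Nat.primeCounting n = ((Finset.range (n + 1)).filter Nat.Prime).card := by
  rw [Nat.primeCounting, Nat.primeCounting', Nat.count_eq_card_filter_range]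

lemma primeCounting_le_self (n : ℕ) : Nat.primeCounting n ≤ n := by
  rw [primeCounting_eq_card]
  have : (Finset.range (n + 1)).filter Nat.Prime ⊆ Finset.Ioc 0 n := by
    intro p hp
    simp only [Finset.mem_filter, Finset.mem_range, Finset.mem_Ioc] at *
    exact ⟨hp.2.pos, by omega⟩
  simpa using Finset.card_le_card this

lemma PI_rate : ∃ C X : ℝ, 0 < C ∧ 3 ≤ X ∧ ∀ x, X ≤ x →
    |PI x - x / Real.log x| ≤ C * (x / Real.log x) * (Real.log x) ^ (-(1 / 45 : ℝ)) := by
  obtain ⟨C, X, hC, hX, h⟩ := psi_rate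
  obtain ⟨C2, hC2, h2⟩ := Chebyshev.primeCounting_sub_theta_div_log_isBigO.exists_pos
  rw [Asymptotics.IsBigOWith_def] at h2
  have h3 := (isLittleO_log_rpow_rpow_atTop (s := 1 / 2) 2 (by norm_num)).bound (c := 1) (by norm_num)
  obtain ⟨X1, hX1⟩ := eventually_atTop.1 (h2.and h3)
  refine ⟨C + C2 + 2, max X X1, by positivity, hX.trans (le_max_left _ _), fun x hx => ?_⟩
  obtain ⟨g2, g3⟩ := hX1 x ((le_max_right _ _).trans hx)
  have g1 := h x ((le_max_left _ _).trans hx)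
  have hx3 : 3 ≤ x := hX.trans ((le_max_left _ _).trans hx)
  have hx0 : 0 < x := by linarith
  have hl1 : 1 ≤ Real.log x := by
    rw [Real.le_log_iff_exp_le hx0]; linarith [Real.exp_one_lt_d9]
  set l := Real.log x with hl
  have hl0 : 0 < l := by linarith
  set η := l ^ (-(1 / 45 : ℝ)) with hη
  have hη0 : 0 < η := Real.rpow_pos_of_pos hl0 _
  have hηl : 1 / l ≤ η := by
    rw [hη, one_div, ← Real.rpow_neg_one]
    exact Real.rpow_le_rpow_of_exponent_le hl1 (by norm_num)
  have g4 := Chebyshev.abs_psi_sub_theta_le_sqrt_mul_log (x := x) (by linarith)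
  have g5 : l ^ 2 ≤ √x := by
    rw [one_mul, Real.norm_eq_abs, Real.norm_eq_abs, abs_of_nonneg (by positivity), abs_of_nonneg (by positivity),
      ← Real.sqrt_eq_rpow] at g3
    exact_mod_cast g3
  have g6 : √x * l ≤ x * (1 / l) := by
    rw [mul_one_div, le_div_iff₀ hl0]
    calc √x * l * l = √x * l ^ 2 := by ring
      _ ≤ √x * √x := by gcongr
      _ = x := Real.mul_self_sqrt hx0.le
  have g7 : |Chebyshev.theta x - x| ≤ (C + 2) * x * η := by
    have e : Chebyshev.theta x - x = (Chebyshev.psi x - x) - (Chebyshev.psi x - Chebyshev.theta x) := by ring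
    rw [e]
    refine (abs_sub _ _).trans ?_
    have : x * (1 / l) ≤ x * η := by gcongr
    have hg : 2 * √x * l = 2 * (√x * l) := by ring
    have : |Chebyshev.psi x - Chebyshev.theta x| ≤ 2 * (x * η) := by
      rw [← hl] at g4; linarith
    nlinarith
  rw [Real.norm_eq_abs, Real.norm_of_nonneg (by positivity)] at g2
  have e : PI x - x / l = (PI x - Chebyshev.theta x / l) + (Chebyshev.theta x - x) / l := by ring
  rw [e]
  refine (abs_add_le _ _).trans ?_
  rw [abs_div, abs_of_pos hl0]
  have a1 : |Chebyshev.theta x - x| / l ≤ (C + 2) * x * η / l := by gcongr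
  have a2 : C2 * (x / l ^ 2) ≤ C2 * (x / l) * η := by
    have : C2 * (x / l ^ 2) = C2 * (x / l) * (1 / l) := by field_simp
    rw [this]; gcongr
  have e2 : (C + C2 + 2) * (x / l) * η = C2 * (x / l) * η + (C + 2) * x * η / l := by ring
  rw [e2]
  refine add_le_add (le_trans ?_ a2) a1
  exact g2

/-- sum of reciprocals of primes up to `n` -/
noncomputable def PS (n : ℕ) : ℝ := ∑ p ∈ (Finset.range (n + 1)).filter Nat.Prime, 1 / (p : ℝ)

lemma PS_mono : Monotone PS := by
  intro a b h
  refine Finset.sum_le_sum_of_subset_of_nonneg ?_ (fun _ _ _ => by positivity)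
  exact Finset.filter_subset_filter _ (Finset.range_mono (by omega))

lemma PS_nonneg (n : ℕ) : 0 ≤ PS n := Finset.sum_nonneg fun _ _ => by positivity

lemma mertens_core (C a b : ℝ) (ha : 3 ≤ a) (hab : a ≤ b) (hC : 0 < C)
    (hP : ∀ x, a ≤ x → |PI x - x / Real.log x| ≤ C * (x / Real.log x) * (Real.log x) ^ (-(1 / 45 : ℝ))) :
    |PS ⌊b⌋₊ - PS ⌊a⌋₊ - (Real.log (Real.log b) - Real.log (Real.log a))| ≤ 1 + 45 * C := by
  have hlog : ∀ t, a ≤ t → 1 ≤ Real.log t := by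
    intro t ht
    rw [Real.le_log_iff_exp_le (by linarith)]; linarith [Real.exp_one_lt_d9]
  set c : ℕ → ℝ := fun k => if k.Prime then 1 else 0 with hc
  have hPI : ∀ t : ℝ, ∑ k ∈ Finset.Icc 0 ⌊t⌋₊, c k = PI t := by
    intro t
    rw [PI, Nat.primeCounting, Nat.primeCounting', Nat.count_eq_card_filter_range]
    simp only [hc, Finset.sum_boole]
    congr 2
    ext k; simp
  have habel := sum_mul_eq_sub_sub_integral_mul c (f := fun t : ℝ => t⁻¹) (a := a) (b := b) (by linarith) hab
    (fun t ht => differentiableAt_inv (by linarith [ht.1]))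
    (by
      simp only [deriv_inv']
      apply ContinuousOn.integrableOn_Icc
      apply ContinuousOn.neg
      apply ContinuousOn.inv₀ (by fun_prop)
      intro t ht
      have : 0 < t := by linarith [ht.1]
      positivity)
  simp only [hPI, deriv_inv'] at habel
  have hsum : ∑ k ∈ Finset.Ioc ⌊a⌋₊ ⌊b⌋₊, ((k:ℝ))⁻¹ * c k = PS ⌊b⌋₊ - PS ⌊a⌋₊ := by
    have hPS : ∀ n, PS n = ∑ k ∈ Finset.range (n + 1), ((k:ℝ))⁻¹ * c k := by
      intro n
      simp [PS, hc, Finset.sum_filter]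
    have hfl : ⌊a⌋₊ ≤ ⌊b⌋₊ := Nat.floor_mono hab
    rw [hPS, hPS, eq_sub_iff_add_eq']
    rw [← Finset.sum_union]
    · congr 1
      ext k; simp only [Finset.mem_union, Finset.mem_range, Finset.mem_Ioc]; omega
    · rw [Finset.disjoint_left]; intro k hk; simp only [Finset.mem_range, Finset.mem_Ioc] at *; omega
  rw [hsum] at habel
  have hne : ∀ t ∈ Set.uIcc a b, 0 < t ∧ 1 ≤ Real.log t := by
    intro t ht
    rw [Set.uIcc_of_le hab] at ht
    exact ⟨by linarith [ht.1], hlog t ht.1⟩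
  have i1 : IntervalIntegrable (fun t : ℝ => t⁻¹ / Real.log t) volume a b := by
    apply ContinuousOn.intervalIntegrable
    apply ContinuousOn.div
    · exact continuousOn_inv₀.mono (fun t ht => (hne t ht).1.ne')
    · exact Real.continuousOn_log.mono (fun t ht => (hne t ht).1.ne')
    · intro t ht; linarith [(hne t ht).2]
  have i2 : IntervalIntegrable (fun t : ℝ => PI t * (t ^ 2)⁻¹) volume a b := by
    apply (PI_mono.monotoneOn _).intervalIntegrable.mul_continuousOn
    apply ContinuousOn.inv₀ (by fun_prop)
    intro t ht
    have := (hne t ht).1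
    positivity
  have i3 : IntervalIntegrable (fun t : ℝ => C * (t⁻¹ * (Real.log t) ^ (-(1 / 45 : ℝ) - 1))) volume a b := by
    apply ContinuousOn.intervalIntegrable
    apply ContinuousOn.mul continuousOn_const
    apply ContinuousOn.mul
    · exact continuousOn_inv₀.mono (fun t ht => (hne t ht).1.ne')
    · apply ContinuousOn.rpow_const
      · exact Real.continuousOn_log.mono (fun t ht => (hne t ht).1.ne')
      · intro t ht; left; linarith [(hne t ht).2]
  have v1 : ∫ t in a..b, t⁻¹ / Real.log t = Real.log (Real.log b) - Real.log (Real.log a) := by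
    refine intervalIntegral.integral_eq_sub_of_hasDerivAt (f := fun t => Real.log (Real.log t)) (fun t ht => ?_) i1
    obtain ⟨h1, h2⟩ := hne t ht
    exact (Real.hasDerivAt_log h1.ne').log (by linarith)
  have v3 : ∫ t in a..b, C * (t⁻¹ * (Real.log t) ^ (-(1 / 45 : ℝ) - 1)) ≤ 45 * C := by
    have : ∫ t in a..b, C * (t⁻¹ * (Real.log t) ^ (-(1 / 45 : ℝ) - 1)) =
        (-45 * C) * (Real.log b) ^ (-(1 / 45 : ℝ)) - (-45 * C) * (Real.log a) ^ (-(1 / 45 : ℝ)) := by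
      refine intervalIntegral.integral_eq_sub_of_hasDerivAt
        (f := fun t => (-45 * C) * (Real.log t) ^ (-(1 / 45 : ℝ))) (fun t ht => ?_) i3
      obtain ⟨h1, h2⟩ := hne t ht
      have := ((Real.hasDerivAt_log h1.ne').rpow_const (p := -(1 / 45 : ℝ)) (Or.inl (by linarith))).const_mul (-45 * C)
      convert! this using 1
      ring
    rw [this]
    have h1 : 0 ≤ (Real.log b) ^ (-(1 / 45 : ℝ)) := Real.rpow_nonneg (by linarith [hlog b hab]) _
    have h2 : (Real.log a) ^ (-(1 / 45 : ℝ)) ≤ 1 := Real.rpow_le_one_of_one_le_of_nonpos (hlog a le_rfl) (by norm_num)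
    nlinarith
  have hdiff : |(∫ t in a..b, PI t * (t ^ 2)⁻¹) - ∫ t in a..b, t⁻¹ / Real.log t| ≤ 45 * C := by
    rw [← intervalIntegral.integral_sub i2 i1]
    refine le_trans ?_ v3
    rw [← Real.norm_eq_abs]
    refine intervalIntegral.norm_integral_le_of_norm_le hab (Eventually.of_forall fun t ht => ?_) i3
    have ht0 : 0 < t := by linarith [ht.1]
    have hl := hlog t ht.1.le
    have h1 := hP t ht.1.le
    have e : PI t * (t ^ 2)⁻¹ - t⁻¹ / Real.log t = (PI t - t / Real.log t) * (t ^ 2)⁻¹ := by field_simp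
    rw [e, norm_mul, Real.norm_eq_abs, Real.norm_of_nonneg (by positivity)]
    refine (mul_le_mul_of_nonneg_right h1 (by positivity)).trans (le_of_eq ?_)
    rw [Real.rpow_sub_one (by linarith)]
    field_simp
  have hIntegr : ∫ t in Set.Ioc a b, -(t ^ 2)⁻¹ * PI t = -∫ t in a..b, PI t * (t ^ 2)⁻¹ := by
    rw [intervalIntegral.integral_of_le hab, ← integral_neg]
    congr 1; ext t; ring
  rw [hIntegr] at habel
  rw [v1] at hdiff
  have hbd : ∀ t, a ≤ t → 0 ≤ t⁻¹ * PI t ∧ t⁻¹ * PI t ≤ 1 := by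
    intro t ht
    have ht0 : 0 < t := by linarith
    refine ⟨mul_nonneg (by positivity) (PI_nonneg t), ?_⟩
    rw [← div_eq_inv_mul, div_le_one ht0]
    refine le_trans ?_ (Nat.floor_le ht0.le)
    exact Nat.cast_le.2 (primeCounting_le_self _)
  have hb1 := hbd b hab
  have ha1 := hbd a le_rfl
  rw [habel]
  rw [abs_le] at hdiff ⊢
  constructor <;> linarith [hdiff.1, hdiff.2, hb1.1, hb1.2, ha1.1, ha1.2]

lemma mertens : ∃ C : ℝ, 0 < C ∧ ∀ x : ℝ, 3 ≤ x → |PS ⌊x⌋₊ - Real.log (Real.log x)| ≤ C := by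
  obtain ⟨C, X, hC, hX, h⟩ := PI_rate
  have hll : ∀ x : ℝ, 3 ≤ x → 0 ≤ Real.log (Real.log x) := by
    intro x hx
    apply Real.log_nonneg
    rw [Real.le_log_iff_exp_le (by linarith)]; linarith [Real.exp_one_lt_d9]
  have hX0 := hll X hX
  have hP0 := PS_nonneg ⌊X⌋₊
  refine ⟨1 + 45 * C + PS ⌊X⌋₊ + Real.log (Real.log X), by positivity, fun x hx => ?_⟩
  rcases le_total X x with hxX | hxX
  · have h1 := mertens_core C X x hX hxX hC h
    rw [abs_le] at h1 ⊢
    constructor <;> linarith [h1.1, h1.2]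
  · have h1 := PS_nonneg ⌊x⌋₊
    have h2 := PS_mono (Nat.floor_mono hxX)
    have h3 := hll x hx
    have hl : 1 ≤ Real.log x := by
      rw [Real.le_log_iff_exp_le (by linarith)]; linarith [Real.exp_one_lt_d9]
    have h4 : Real.log (Real.log x) ≤ Real.log (Real.log X) :=
      Real.log_le_log (by linarith) (Real.log_le_log (by linarith) hxX)
    rw [abs_le]
    constructor <;> linarith

end RaceProof

end

section

open Filter Topology

namespace RaceProof

/-- the Jacobi symbol as a character of `ZMod m` -/
noncomputable def jc (m : ℕ) [NeZero m] : MulChar (ZMod m) ℤ where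
  toFun a := jacobiSym (a.val : ℤ) m
  map_one' := by
    rw [ZMod.val_one_eq_one_mod]
    push_cast
    rw [← jacobiSym.mod_left, jacobiSym.one_left]
  map_mul' a b := by
    rw [ZMod.val_mul]
    push_cast
    rw [← jacobiSym.mod_left, jacobiSym.mul_left]
  map_nonunit' a ha := by
    rw [jacobiSym.eq_zero_iff_not_coprime]
    intro h
    apply ha
    rw [← ZMod.natCast_zmod_val a, ZMod.isUnit_iff_coprime]
    exact_mod_cast h

lemma jc_natCast (m : ℕ) [NeZero m] (n : ℕ) : jc m (n : ZMod m) = jacobiSym (n : ℤ) m := by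
  change jacobiSym (((n : ZMod m).val : ℕ) : ℤ) m = _
  rw [ZMod.val_natCast]
  push_cast
  rw [← jacobiSym.mod_left]

lemma jac_abs_le (a : ℤ) (b : ℕ) : |jacobiSym a b| ≤ 1 := by
  rcases jacobiSym.trichotomy a b with h | h | h <;> rw [h] <;> norm_num

/-- key lemma: for `q` exactly dividing `m`, there is `a ≡ 1 mod m/q` with symbol `-1`. -/
lemma exists_neg_one (q r : ℕ) (hq : q.Prime) (hq2 : q ≠ 2) (hr : r ≠ 0) (hcop : Nat.Coprime q r) :
    ∃ a : ℕ, a ≡ 1 [MOD r] ∧ jacobiSym (a : ℤ) (q * r) = -1 := by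
  have := Fact.mk hq
  obtain ⟨b, hb⟩ := quadraticChar_exists_neg_one (F := ZMod q) (by rw [ZMod.ringChar_zmod_n]; exact hq2)
  obtain ⟨a, ha1, ha2⟩ := Nat.chineseRemainder hcop b.val 1
  refine ⟨a, ha2, ?_⟩
  rw [jacobiSym.mul_right' _ hq.ne_zero hr]
  have h1 : jacobiSym (a : ℤ) q = -1 := by
    rw [← jacobiSym.legendreSym.to_jacobiSym, legendreSym]
    have : ((a : ℤ) : ZMod q) = b := by
      have := (ZMod.natCast_eq_natCast_iff _ _ _).2 ha1
      rw [ZMod.natCast_zmod_val] at this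
      exact_mod_cast this
    rw [this, hb]
  have h2 : jacobiSym (a : ℤ) r = 1 := by
    have : (a : ℤ) % r = 1 % r := by
      have := ha2
      unfold Nat.ModEq at this
      exact_mod_cast this
    rw [jacobiSym.mod_left' this, jacobiSym.one_left]
  rw [h1, h2]; norm_num

lemma jc_ne_one (m q r : ℕ) [NeZero m] (hm : m = q * r) (hq : q.Prime) (hq2 : q ≠ 2) (hr : r ≠ 0)
    (hcop : Nat.Coprime q r) : jc m ≠ 1 := by
  subst hm
  obtain ⟨a, -, ha⟩ := exists_neg_one q r hq hq2 hr hcop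
  intro h
  have h1 : jc (q * r) (a : ZMod (q * r)) = -1 := by rw [jc_natCast, ha]
  rw [h] at h1
  by_cases hu : IsUnit (a : ZMod (q * r))
  · rw [MulChar.one_apply hu] at h1; norm_num at h1
  · rw [MulChar.map_nonunit _ hu] at h1; norm_num at h1

lemma jc_abs_le (m : ℕ) [NeZero m] (a : ZMod m) : |jc m a| ≤ 1 := by
  rw [← ZMod.natCast_zmod_val a, jc_natCast]; exact jac_abs_le _ _

lemma periodic_sum_bound (m : ℕ) (hm : 0 < m) (f : ℕ → ℤ) (hper : ∀ n, f (m + n) = f n)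
    (hz : ∑ n ∈ Finset.range m, f n = 0) (hf : ∀ n, |f n| ≤ 1) (N : ℕ) :
    |∑ n ∈ Finset.range N, f n| ≤ m := by
  induction N using Nat.strong_induction_on with
  | _ N ih =>
    rcases lt_or_ge N m with h | h
    · refine (Finset.abs_sum_le_sum_abs _ _).trans ?_
      refine (Finset.sum_le_sum fun n _ => hf n).trans ?_
      simp; omega
    · obtain ⟨k, rfl⟩ := Nat.exists_eq_add_of_le h
      rw [Finset.sum_range_add, hz, zero_add]
      simp_rw [hper]
      exact ih k (by omega)

lemma jc_sum_bound (m M : ℕ) [NeZero m] (h1 : jc m ≠ 1) (hM : Nat.Coprime M m) (N : ℕ) :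
    |∑ k ∈ Finset.range N, jacobiSym ((1 + M * k : ℕ) : ℤ) m| ≤ m := by
  have hm : 0 < m := Nat.pos_of_ne_zero (NeZero.ne m)
  apply periodic_sum_bound m hm
  · intro n
    rw [← jc_natCast, ← jc_natCast]
    congr 1
    push_cast
    simp
  · have h2 : ∑ k ∈ Finset.range m, jacobiSym ((1 + M * k : ℕ) : ℤ) m =
        ∑ a : ZMod m, jc m (1 + M * a) := by
      refine Finset.sum_bij' (fun k _ => (k : ZMod m)) (fun a _ => a.val) ?_ ?_ ?_ ?_ ?_
      · intro a _; simp
      · intro a _; simpa using ZMod.val_lt a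
      · intro k hk
        exact ZMod.val_cast_of_lt (Finset.mem_range.1 hk)
      · intro a _; exact ZMod.natCast_zmod_val a
      · intro k _
        rw [← jc_natCast]; push_cast; rfl
    rw [h2]
    have hu : IsUnit (M : ZMod m) := (ZMod.isUnit_iff_coprime M m).2 hM
    obtain ⟨u, hu⟩ := hu
    rw [← hu]
    have h3 : ∑ a : ZMod m, jc m (1 + u * a) = ∑ a : ZMod m, jc m a :=
      Fintype.sum_equiv (u.mulLeft.trans (Equiv.addLeft (1 : ZMod m))) _ _ (fun a => rfl)
    rw [h3]
    exact MulChar.sum_eq_zero_of_ne_one h1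
  · intro n; exact jac_abs_le _ _

/-- the complex character -/
noncomputable def cc (m : ℕ) [NeZero m] : DirichletCharacter ℂ m :=
  (jc m).ringHomComp (Int.castRingHom ℂ)

lemma cc_natCast (m : ℕ) [NeZero m] (n : ℕ) : cc m (n : ZMod m) = ((jacobiSym (n : ℤ) m : ℤ) : ℂ) := by
  rw [cc, MulChar.ringHomComp_apply, jc_natCast]; simp

lemma cc_quadratic (m : ℕ) [NeZero m] : MulChar.IsQuadratic (cc m) := by
  intro a
  rw [← ZMod.natCast_zmod_val a, cc_natCast]
  rcases jacobiSym.trichotomy (a.val : ℤ) m with h | h | h <;> rw [h] <;> simp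

lemma cc_primitive (m : ℕ) [NeZero m] (hodd : Odd m) (hsq : Squarefree m) : (cc m).IsPrimitive := by
  rw [DirichletCharacter.isPrimitive_def]
  by_contra hne
  set c := (cc m).conductor with hc
  have hcd : c ∣ m := DirichletCharacter.conductor_dvd_level _
  obtain ⟨e, he⟩ := hcd
  have he1 : e ≠ 1 := by rintro rfl; apply hne; rw [he, mul_one]
  obtain ⟨q, hq, hqe⟩ := Nat.exists_prime_and_dvd he1
  obtain ⟨e', he'⟩ := hqe
  have hm : m = q * (c * e') := by rw [he, he']; ring
  have hm0 : m ≠ 0 := NeZero.ne m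
  have hr0 : c * e' ≠ 0 := by intro h; rw [h] at hm; omega
  have hcop : Nat.Coprime q (c * e') := by
    rw [hm] at hsq
    exact Nat.coprime_of_squarefree_mul hsq
  have hq2 : q ≠ 2 := by
    rintro rfl
    rw [hm] at hodd
    rw [Nat.odd_mul] at hodd
    exact absurd hodd.1 (by decide)
  obtain ⟨a, ha1, ha⟩ := exists_neg_one q (c * e') hq hq2 hr0 hcop
  rw [← hm] at ha
  have hcm : c ∣ m := ⟨e, he⟩
  have hf := (DirichletCharacter.factorsThrough_iff_ker_unitsMap hcm).1 (DirichletCharacter.factorsThrough_conductor (cc m))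
  have hcopa : Nat.Coprime a m := by
    by_contra hcon
    have : jacobiSym (a : ℤ) m = 0 := jacobiSym.eq_zero_iff_not_coprime.2 (by exact_mod_cast hcon)
    rw [this] at ha; norm_num at ha
  have hmem : ZMod.unitOfCoprime a hcopa ∈ (ZMod.unitsMap hcm).ker := by
    rw [MonoidHom.mem_ker, Units.ext_iff, ZMod.unitsMap_val]
    simp only [ZMod.coe_unitOfCoprime, Units.val_one]
    rw [ZMod.cast_natCast hcm]
    have : a ≡ 1 [MOD c] := ha1.of_mul_right _
    have := (ZMod.natCast_eq_natCast_iff _ _ _).2 this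
    simpa using this
  have h2 := hf hmem
  rw [MonoidHom.mem_ker, Units.ext_iff, MulChar.coe_toUnitHom, ZMod.coe_unitOfCoprime, cc_natCast, ha] at h2
  norm_num at h2

lemma jac_small_prime (d p : ℕ) (hp : p.Prime) (hd8 : d % 8 = 1) (hdp : d % p = 1) : jacobiSym (p : ℤ) d = 1 := by
  have hodd : Odd d := by rw [Nat.odd_iff]; omega
  rcases hp.eq_two_or_odd' with rfl | hpo
  · have := jacobiSym.at_two hodd
    push_cast
    rw [this, ZMod.χ₈_nat_mod_eight, hd8]; rfl
  · rw [jacobiSym.quadratic_reciprocity_one_mod_four' hpo (by omega), jacobiSym.mod_left]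
    have : ((d : ℤ) % (p : ℤ)) = 1 := by exact_mod_cast hdp
    rw [this, jacobiSym.one_left]

end RaceProof

end

section

open Filter Topology

namespace RaceProof

/-- real valued Jacobi symbol `(n|d)` -/
noncomputable def JJ (n d : ℕ) : ℝ := ((jacobiSym (n : ℤ) d : ℤ) : ℝ)

lemma JJ_abs_le (n d : ℕ) : |JJ n d| ≤ 1 := by
  unfold JJ; exact_mod_cast jac_abs_le _ _

lemma JJ_mul_self_le (n d : ℕ) : JJ n d * JJ n d ≤ 1 := by
  have := abs_le.1 (JJ_abs_le n d); nlinarith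

lemma card_sq_dvd (M K q : ℕ) (hcop : Nat.Coprime M q) :
    ((Finset.range K).filter (fun k => q ^ 2 ∣ 1 + M * k)).card ≤ K / q ^ 2 + 1 := by
  have hc2 : Nat.Coprime (q ^ 2) M := (hcop.pow_right 2).symm
  calc _ ≤ (Finset.range (K / q ^ 2 + 1)).card := by
        apply Finset.card_le_card_of_injOn (fun k => k / q ^ 2)
        · intro k hk
          simp only [Finset.coe_filter, Set.mem_ofPred_eq, Finset.mem_range] at hk
          simp only [Finset.coe_range, Set.mem_Iio]
          exact Nat.lt_succ_of_le (Nat.div_le_div_right hk.1.le)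
        · intro k hk k' hk' h
          simp only [Finset.coe_filter, Set.mem_ofPred_eq, Finset.mem_range] at hk hk'
          have h1 : 1 + M * k ≡ 1 + M * k' [MOD q ^ 2] :=
            ((Nat.modEq_zero_iff_dvd).2 hk.2).trans ((Nat.modEq_zero_iff_dvd).2 hk'.2).symm
          have h2 : M * k ≡ M * k' [MOD q ^ 2] := Nat.ModEq.add_left_cancel' 1 h1
          have h3 : k ≡ k' [MOD q ^ 2] := Nat.ModEq.cancel_left_of_coprime hc2 h2
          have h4 := Nat.div_add_mod k (q ^ 2)
          have h5 := Nat.div_add_mod k' (q ^ 2)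
          simp only at h
          unfold Nat.ModEq at h3
          rw [h, h3] at h4
          omega
    _ = _ := by simp

lemma sum_inv_sq (Y Q : ℕ) (hY : 0 < Y) : ∑ q ∈ Finset.Ioc Y Q, (1 / (q : ℝ) ^ 2) ≤ 1 / (Y:ℝ) := by
  rcases le_or_gt Q Y with h | h
  · rw [Finset.Ioc_eq_empty_of_le h]; simp
  have key : ∀ n, Y ≤ n → ∑ q ∈ Finset.Ioc Y n, (1 / (q : ℝ) ^ 2) ≤ 1 / (Y:ℝ) - 1 / (n:ℝ) := by
    intro n hn
    induction n, hn using Nat.le_induction with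
    | base => simp
    | succ n hn ih =>
      rw [Finset.sum_Ioc_succ_top (by omega)]
      have hn0 : (0:ℝ) < n := by exact_mod_cast (by omega : 0 < n)
      have : 1 / ((n + 1 : ℕ) : ℝ) ^ 2 ≤ 1 / (n:ℝ) - 1 / ((n + 1 : ℕ) : ℝ) := by
        push_cast
        rw [div_sub_div _ _ hn0.ne' (by positivity), div_le_div_iff₀ (by positivity) (by positivity)]
        nlinarith
      linarith
  have h1 := key Q h.le
  have h2 : (0:ℝ) ≤ 1 / Q := by positivity
  linarith

lemma nonsquarefree_count (M K Y D : ℕ) (hY : 0 < Y) (hM : ∀ q, q.Prime → q ≤ Y → q ∣ M)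
    (hD : ∀ k < K, 1 + M * k ≤ D) :
    (((Finset.range K).filter (fun k => ¬ Squarefree (1 + M * k))).card : ℝ) ≤ (K:ℝ) / (Y:ℝ) + (Nat.sqrt D : ℝ) := by
  have hsub : (Finset.range K).filter (fun k => ¬ Squarefree (1 + M * k)) ⊆
      ((Finset.Ioc Y (Nat.sqrt D)).filter (fun q => Nat.Coprime M q)).biUnion
        (fun q => (Finset.range K).filter (fun k => q ^ 2 ∣ 1 + M * k)) := by
    intro k hk
    rw [Finset.mem_filter, Finset.mem_range] at hk
    rw [Nat.squarefree_iff_prime_squarefree] at hk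
    obtain ⟨hk1, hk2⟩ := hk
    push Not at hk2
    obtain ⟨q, hq, hqd⟩ := hk2
    have hqd1 : q ∣ 1 + M * k := (Dvd.intro _ rfl).trans hqd
    have hqM : ¬ q ∣ M := by
      intro h
      have : q ∣ 1 := (Nat.dvd_add_left (h.mul_right k)).1 hqd1
      exact hq.one_lt.ne' (Nat.dvd_one.1 this)
    simp only [Finset.mem_biUnion, Finset.mem_filter, Finset.mem_Ioc, Finset.mem_range]
    refine ⟨q, ⟨⟨?_, ?_⟩, ?_⟩, hk1, by rw [pow_two]; exact hqd⟩
    · by_contra hcon; exact hqM (hM q hq (by omega))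
    · rw [Nat.le_sqrt]; exact (Nat.le_of_dvd (by omega) hqd).trans (hD k hk1)
    · exact ((Nat.Prime.coprime_iff_not_dvd hq).2 hqM).symm
  have h1 := (Finset.card_le_card hsub).trans Finset.card_biUnion_le
  have h2 : ((∑ q ∈ (Finset.Ioc Y (Nat.sqrt D)).filter (fun q => Nat.Coprime M q),
      ((Finset.range K).filter (fun k => q ^ 2 ∣ 1 + M * k)).card : ℕ) : ℝ) ≤
      ∑ q ∈ Finset.Ioc Y (Nat.sqrt D), (K * (1 / (q:ℝ) ^ 2) + 1) := by
    push_cast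
    rw [Finset.sum_filter]
    apply Finset.sum_le_sum
    intro q hq
    rw [Finset.mem_Ioc] at hq
    split_ifs with h
    · have := card_sq_dvd M K q h
      have h3 : (((Finset.range K).filter (fun k => q ^ 2 ∣ 1 + M * k)).card : ℝ) ≤ ((K / q ^ 2 + 1 : ℕ) : ℝ) := by
        exact_mod_cast this
      refine h3.trans ?_
      have h4 : ((K / q ^ 2 : ℕ) : ℝ) ≤ (K : ℝ) / ((q ^ 2 : ℕ) : ℝ) := Nat.cast_div_le
      push_cast at h4 ⊢
      rw [mul_one_div]
      linarith
    · positivity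
  have h3 : ∑ q ∈ Finset.Ioc Y (Nat.sqrt D), (K * (1 / (q:ℝ) ^ 2) + 1) ≤ (K:ℝ) / (Y:ℝ) + (Nat.sqrt D : ℝ) := by
    rw [Finset.sum_add_distrib, ← Finset.mul_sum]
    have := mul_le_mul_of_nonneg_left (sum_inv_sq Y (Nat.sqrt D) hY) (Nat.cast_nonneg (α := ℝ) K)
    rw [mul_one_div] at this
    have h5 : ∑ q ∈ Finset.Ioc Y (Nat.sqrt D), (1:ℝ) ≤ Nat.sqrt D := by
      simp
    linarith
  calc _ ≤ _ := Nat.cast_le.2 h1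
    _ ≤ _ := h2.trans h3

lemma mid_sum (M K : ℕ) (h8 : 4 ∣ M) (P : Finset ℕ) (hP : ∀ p ∈ P, p.Prime ∧ Nat.Coprime M p)
    (b : ℕ → ℝ) (hb : ∀ p, 0 ≤ b p) :
    ∑ k ∈ Finset.range K, (∑ p ∈ P, b p * JJ p (1 + M * k)) ^ 2 ≤
      K * ∑ p ∈ P, b p ^ 2 + (∑ p ∈ P, p * b p) ^ 2 := by
  have hexp : ∑ k ∈ Finset.range K, (∑ p ∈ P, b p * JJ p (1 + M * k)) ^ 2 =
      ∑ p ∈ P, ∑ p' ∈ P, b p * b p' * ∑ k ∈ Finset.range K, JJ p (1 + M * k) * JJ p' (1 + M * k) := by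
    simp_rw [pow_two, Finset.sum_mul_sum]
    rw [Finset.sum_comm]
    refine Finset.sum_congr rfl fun p _ => ?_
    rw [Finset.sum_comm]
    refine Finset.sum_congr rfl fun p' _ => ?_
    rw [Finset.mul_sum]
    refine Finset.sum_congr rfl fun k _ => ?_
    ring
  have hrhs : K * ∑ p ∈ P, b p ^ 2 + (∑ p ∈ P, p * b p) ^ 2 =
      ∑ p ∈ P, ∑ p' ∈ P, ((if p = p' then K * b p ^ 2 else 0) + b p * b p' * (p * p')) := by
    simp_rw [Finset.sum_add_distrib]
    congr 1
    · rw [Finset.mul_sum]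
      refine Finset.sum_congr rfl fun p hp => ?_
      rw [Finset.sum_ite_eq, if_pos hp]
    · rw [pow_two, Finset.sum_mul_sum]
      refine Finset.sum_congr rfl fun p _ => Finset.sum_congr rfl fun p' _ => ?_
      ring
  rw [hexp, hrhs]
  refine Finset.sum_le_sum fun p hp => Finset.sum_le_sum fun p' hp' => ?_
  obtain ⟨hpp, hpM⟩ := hP p hp
  obtain ⟨hpp', hpM'⟩ := hP p' hp'
  have hbb : 0 ≤ b p * b p' := mul_nonneg (hb p) (hb p')
  split_ifs with h
  · subst h
    have h1 : ∑ k ∈ Finset.range K, JJ p (1 + M * k) * JJ p (1 + M * k) ≤ K := by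
      refine (Finset.sum_le_sum fun k _ => JJ_mul_self_le p (1 + M * k)).trans ?_
      simp
    have h2 := mul_le_mul_of_nonneg_left h1 hbb
    have h3 : 0 ≤ b p * b p * ((p:ℝ) * p) := by positivity
    nlinarith
  · rw [zero_add]
    apply mul_le_mul_of_nonneg_left _ hbb
    have hodd : ∀ q : ℕ, q.Prime → Nat.Coprime M q → q ≠ 2 := by
      rintro q _ hq rfl
      have : 2 ∣ Nat.gcd M 2 := Nat.dvd_gcd ((by norm_num : 2 ∣ 4).trans h8) dvd_rfl
      rw [hq] at this
      norm_num at this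
    have hp2 := hodd p hpp hpM
    have hp2' := hodd p' hpp' hpM'
    have hne : NeZero (p * p') := ⟨mul_ne_zero hpp.ne_zero hpp'.ne_zero⟩
    have h1 := jc_sum_bound (p * p') M
      (jc_ne_one (p * p') p p' rfl hpp hp2 hpp'.ne_zero ((Nat.coprime_primes hpp hpp').2 h))
      (hpM.mul_right hpM') K
    have h2 : ∑ k ∈ Finset.range K, JJ p (1 + M * k) * JJ p' (1 + M * k) =
        ((∑ k ∈ Finset.range K, jacobiSym ((1 + M * k : ℕ) : ℤ) (p * p') : ℤ) : ℝ) := by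
      push_cast
      refine Finset.sum_congr rfl fun k _ => ?_
      have h4 : (1 + M * k) % 4 = 1 := by
        obtain ⟨c, rfl⟩ := h8
        rw [mul_assoc]; omega
      unfold JJ
      rw [jacobiSym.quadratic_reciprocity_one_mod_four' (hpp.odd_of_ne_two hp2) h4,
        jacobiSym.quadratic_reciprocity_one_mod_four' (hpp'.odd_of_ne_two hp2') h4,
        jacobiSym.mul_right' _ hpp.ne_zero hpp'.ne_zero]
      push_cast
      rfl
    rw [h2]
    have h3 : ((∑ k ∈ Finset.range K, jacobiSym ((1 + M * k : ℕ) : ℤ) (p * p') : ℤ) : ℝ) ≤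
        ((p * p' : ℕ) : ℤ) := by exact_mod_cast (le_abs_self _).trans h1
    refine h3.trans (le_of_eq ?_)
    push_cast; rfl

end RaceProof

end

section

open Filter Topology

namespace RaceProof

lemma abel_bound (f : ℕ → ℝ) (m : ℝ) (hF : ∀ N, |∑ k ∈ Finset.range N, f (1 + k)| ≤ m) (P X : ℕ) :
    |∑ n ∈ Finset.Ioc P X, f n / n| ≤ 2 * m / (P + 1) := by
  have hm : 0 ≤ m := (abs_nonneg _).trans (hF 0)
  rcases le_or_gt X P with h | h
  · rw [Finset.Ioc_eq_empty_of_le h]; simp; positivity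
  set F : ℕ → ℝ := fun N => ∑ k ∈ Finset.range N, f (1 + k) with hFdef
  have key : ∀ n, P ≤ n → |∑ i ∈ Finset.Ioc P n, f i / i - F n / (n + 1) + F P / (P + 1)| ≤
      m * (1 / ((P : ℝ) + 1) - 1 / ((n : ℝ) + 1)) := by
    intro n hn
    induction n, hn using Nat.le_induction with
    | base => simp
    | succ n hn ih =>
      rw [Finset.sum_Ioc_succ_top (by omega)]
      have hf : f (n + 1) = F (n + 1) - F n := by
        simp only [hFdef, Finset.sum_range_succ]; rw [add_comm n 1]; ring
      have e : ∑ i ∈ Finset.Ioc P n, f i / i + f (n + 1) / ((n + 1 : ℕ) : ℝ)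
          - F (n + 1) / (((n + 1 : ℕ) : ℝ) + 1) + F P / (P + 1) =
          (∑ i ∈ Finset.Ioc P n, f i / i - F n / (n + 1) + F P / (P + 1)) +
          F (n + 1) * (1 / ((n:ℝ) + 1) - 1 / (((n + 1 : ℕ) : ℝ) + 1)) := by
        rw [hf]; push_cast
        ring
      rw [e]
      refine (abs_add_le _ _).trans ?_
      have h0 : 0 ≤ 1 / ((n:ℝ) + 1) - 1 / (((n + 1 : ℕ) : ℝ) + 1) := by
        rw [sub_nonneg]
        apply one_div_le_one_div_of_le (by positivity)
        push_cast; linarith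
      have h1 : |F (n + 1) * (1 / ((n:ℝ) + 1) - 1 / (((n + 1 : ℕ) : ℝ) + 1))| ≤
          m * (1 / ((n:ℝ) + 1) - 1 / (((n + 1 : ℕ) : ℝ) + 1)) := by
        rw [abs_mul, abs_of_nonneg h0]
        exact mul_le_mul_of_nonneg_right (hF _) h0
      push_cast at *
      linarith
  have h1 := abs_le.1 (key X h.le)
  have h2 := abs_le.1 (hF X)
  have h3 := abs_le.1 (hF P)
  have hX : (0:ℝ) < 1 / ((X:ℝ) + 1) := by positivity
  have hP : (0:ℝ) < 1 / ((P:ℝ) + 1) := by positivity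
  have e1 : F X / ((X:ℝ) + 1) = F X * (1 / ((X:ℝ) + 1)) := by ring
  have e2 : F P / ((P:ℝ) + 1) = F P * (1 / ((P:ℝ) + 1)) := by ring
  have e3 : 2 * m / ((P:ℝ) + 1) = 2 * m * (1 / ((P:ℝ) + 1)) := by ring
  rw [e1, e2] at h1
  rw [e3, abs_le]
  change -m ≤ F X ∧ F X ≤ m at h2
  change -m ≤ F P ∧ F P ≤ m at h3
  constructor <;> nlinarith

lemma jc_ne_one_mul (d d' : ℕ) [NeZero (d * d')] (ho : Odd d) (ho' : Odd d') (hs : Squarefree d)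
    (hs' : Squarefree d') (hne : d ≠ d') : jc (d * d') ≠ 1 := by
  have hd0 := hs.ne_zero
  have hd0' := hs'.ne_zero
  have h1 : ∃ q, q.Prime ∧ ¬ (q ∣ d ↔ q ∣ d') := by
    by_contra hcon
    push Not at hcon
    apply hne
    rw [Nat.Squarefree.ext_iff hs hs']
    intro p hp
    have := hcon p hp
    tauto
  obtain ⟨q, hq, hqd⟩ := h1
  have key : ∀ a b : ℕ, Odd a → Squarefree a → Squarefree b → q ∣ a → ¬ q ∣ b →
      ∃ r, a * b = q * r ∧ q ≠ 2 ∧ r ≠ 0 ∧ Nat.Coprime q r := by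
    rintro a b hao ha hb ⟨c, rfl⟩ hqb
    refine ⟨c * b, by ring, ?_, ?_, ?_⟩
    · rintro rfl
      rw [Nat.odd_mul] at hao
      exact absurd hao.1 (by decide)
    · exact mul_ne_zero (right_ne_zero_of_mul ha.ne_zero) hb.ne_zero
    · exact Nat.Coprime.mul_right (Nat.coprime_of_squarefree_mul ha) ((Nat.Prime.coprime_iff_not_dvd hq).2 hqb)
  by_cases h : q ∣ d
  · have h' : ¬ q ∣ d' := by tauto
    obtain ⟨r, h1, h2, h3, h4⟩ := key d d' ho hs hs' h h'
    exact jc_ne_one _ q r h1 hq h2 h3 h4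
  · have h' : q ∣ d' := by tauto
    obtain ⟨r, h1, h2, h3, h4⟩ := key d' d ho' hs' hs h' h
    exact jc_ne_one _ q r (by rw [mul_comm, h1]) hq h2 h3 h4

lemma offdiag (d d' P X : ℕ) (ho : Odd d) (ho' : Odd d') (hs : Squarefree d)
    (hs' : Squarefree d') (hne : d ≠ d') :
    |∑ n ∈ Finset.Ioc P X, JJ n d * JJ n d' / n| ≤ 2 * ((d:ℝ) * d') / (P + 1) := by
  have h0 : NeZero (d * d') := ⟨mul_ne_zero hs.ne_zero hs'.ne_zero⟩
  apply abel_bound (fun n => JJ n d * JJ n d')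
  intro N
  have h1 := jc_sum_bound (d * d') 1 (jc_ne_one_mul d d' ho ho' hs hs' hne) (Nat.coprime_one_left _) N
  have h2 : ∑ k ∈ Finset.range N, JJ (1 + k) d * JJ (1 + k) d' =
      ((∑ k ∈ Finset.range N, jacobiSym ((1 + 1 * k : ℕ) : ℤ) (d * d') : ℤ) : ℝ) := by
    push_cast
    refine Finset.sum_congr rfl fun k _ => ?_
    unfold JJ
    rw [jacobiSym.mul_right' _ hs.ne_zero hs'.ne_zero]
    push_cast
    simp
  rw [h2]
  have : ((|∑ k ∈ Finset.range N, jacobiSym ((1 + 1 * k : ℕ) : ℤ) (d * d')| : ℤ) : ℝ) ≤ ((d * d' : ℕ) : ℝ) := by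
    exact_mod_cast h1
  push_cast at this ⊢
  exact this

/-- harmonic sum -/
noncomputable def HH (X : ℕ) : ℝ := ∑ n ∈ Finset.Ioc 0 X, 1 / (n : ℝ)

lemma HH_nonneg (X : ℕ) : 0 ≤ HH X := Finset.sum_nonneg fun _ _ => by positivity

lemma HH_le (X : ℕ) : HH X ≤ 1 + Real.log X := by
  have h := harmonic_le_one_add_log X
  rw [harmonic_eq_sum_Icc] at h
  push_cast at h
  unfold HH
  refine le_trans (le_of_eq ?_) h
  refine Finset.sum_congr ?_ fun i _ => by rw [one_div]
  ext; simp [Nat.lt_iff_add_one_le]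

lemma large_sieve (S : Finset ℕ) (D X : ℕ) (hS : ∀ d ∈ S, 0 < d ∧ d ≤ D ∧ Odd d ∧ Squarefree d)
    (a : ℕ → ℝ) :
    ∑ d ∈ S, (∑ n ∈ Finset.Ioc (D ^ 3) X, a n * JJ n d) ^ 2 ≤
      (∑ n ∈ Finset.Ioc (D ^ 3) X, n * a n ^ 2) * (HH X + 2) := by
  set I := Finset.Ioc (D ^ 3) X with hI
  set T : ℕ → ℝ := fun d => ∑ n ∈ I, a n * JJ n d with hT
  set Q := ∑ d ∈ S, T d ^ 2 with hQ
  set W := ∑ n ∈ I, n * a n ^ 2 with hW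
  have hQ0 : 0 ≤ Q := Finset.sum_nonneg fun _ _ => sq_nonneg _
  have hW0 : 0 ≤ W := Finset.sum_nonneg fun _ _ => by positivity
  have hpos : ∀ n ∈ I, (0:ℝ) < n := by
    intro n hn
    rw [hI, Finset.mem_Ioc] at hn
    exact_mod_cast (by omega : 0 < n)
  have e1 : Q = ∑ n ∈ I, (Real.sqrt n * a n) * ((∑ d ∈ S, T d * JJ n d) / Real.sqrt n) := by
    have : Q = ∑ d ∈ S, ∑ n ∈ I, T d * (a n * JJ n d) := by
      rw [hQ]
      refine Finset.sum_congr rfl fun d _ => ?_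
      rw [pow_two, ← Finset.mul_sum]
    rw [this, Finset.sum_comm]
    refine Finset.sum_congr rfl fun n hn => ?_
    have hs : Real.sqrt n ≠ 0 := (Real.sqrt_pos.2 (hpos n hn)).ne'
    have e0 : (Real.sqrt n * a n) * ((∑ d ∈ S, T d * JJ n d) / Real.sqrt n) =
        a n * ∑ d ∈ S, T d * JJ n d := by field_simp
    rw [e0, Finset.mul_sum]
    exact Finset.sum_congr rfl fun d _ => by ring
  have e2 : Q ^ 2 ≤ W * ∑ n ∈ I, (∑ d ∈ S, T d * JJ n d) ^ 2 / n := by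
    rw [e1]
    refine (Finset.sum_mul_sq_le_sq_mul_sq _ _ _).trans (le_of_eq ?_)
    rw [hW]
    congr 1
    · exact Finset.sum_congr rfl fun n hn => by rw [mul_pow, Real.sq_sqrt (hpos n hn).le]
    · exact Finset.sum_congr rfl fun n hn => by rw [div_pow, Real.sq_sqrt (hpos n hn).le]
  have e3 : ∑ n ∈ I, (∑ d ∈ S, T d * JJ n d) ^ 2 / n =
      ∑ d ∈ S, ∑ d' ∈ S, T d * T d' * ∑ n ∈ I, JJ n d * JJ n d' / n := by
    simp_rw [pow_two, Finset.sum_mul_sum, Finset.sum_div]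
    rw [Finset.sum_comm]
    refine Finset.sum_congr rfl fun p _ => ?_
    rw [Finset.sum_comm]
    refine Finset.sum_congr rfl fun p' _ => ?_
    rw [Finset.mul_sum]
    refine Finset.sum_congr rfl fun k _ => ?_
    ring
  have e4 : ∑ d ∈ S, ∑ d' ∈ S, T d * T d' * ∑ n ∈ I, JJ n d * JJ n d' / n ≤
      HH X * Q + 2 / ((D:ℝ) ^ 3 + 1) * (∑ d ∈ S, (d:ℝ) * |T d|) ^ 2 := by
    have hrhs : HH X * Q + 2 / ((D:ℝ) ^ 3 + 1) * (∑ d ∈ S, (d:ℝ) * |T d|) ^ 2 =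
        ∑ d ∈ S, ∑ d' ∈ S, ((if d = d' then HH X * T d ^ 2 else 0) +
          |T d| * |T d'| * (2 * ((d:ℝ) * d') / ((D:ℝ) ^ 3 + 1))) := by
      simp_rw [Finset.sum_add_distrib]
      congr 1
      · rw [hQ, Finset.mul_sum]
        refine Finset.sum_congr rfl fun p hp => ?_
        rw [Finset.sum_ite_eq, if_pos hp]
      · rw [pow_two, Finset.sum_mul_sum, Finset.mul_sum]
        refine Finset.sum_congr rfl fun p _ => ?_
        rw [Finset.mul_sum]
        refine Finset.sum_congr rfl fun p' _ => ?_
        ring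
    rw [hrhs]
    refine Finset.sum_le_sum fun d hd => Finset.sum_le_sum fun d' hd' => ?_
    obtain ⟨-, -, ho, hs⟩ := hS d hd
    obtain ⟨-, -, ho', hs'⟩ := hS d' hd'
    split_ifs with h
    · subst h
      have h1 : ∑ n ∈ I, JJ n d * JJ n d / n ≤ HH X := by
        calc _ ≤ ∑ n ∈ I, 1 / (n:ℝ) := Finset.sum_le_sum fun n _ =>
              div_le_div_of_nonneg_right (JJ_mul_self_le n d) (Nat.cast_nonneg n)
          _ ≤ HH X := Finset.sum_le_sum_of_subset_of_nonneg
              (Finset.Ioc_subset_Ioc_left (Nat.zero_le _)) fun _ _ _ => by positivity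
      have h2 := mul_le_mul_of_nonneg_left h1 (mul_self_nonneg (T d))
      have h3 : 0 ≤ |T d| * |T d| * (2 * ((d:ℝ) * d) / ((D:ℝ) ^ 3 + 1)) := by positivity
      nlinarith
    · rw [zero_add]
      refine (le_abs_self _).trans ?_
      rw [abs_mul, abs_mul]
      apply mul_le_mul_of_nonneg_left _ (by positivity)
      have := offdiag d d' (D ^ 3) X ho ho' hs hs' h
      push_cast at this
      exact this
  have e5 : (∑ d ∈ S, (d:ℝ) * |T d|) ^ 2 ≤ (D:ℝ) ^ 3 * Q := by
    refine (Finset.sum_mul_sq_le_sq_mul_sq _ _ _).trans ?_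
    have h1 : ∑ d ∈ S, |T d| ^ 2 = Q := Finset.sum_congr rfl fun d _ => sq_abs _
    rw [h1]
    apply mul_le_mul_of_nonneg_right _ hQ0
    have h2 : S ⊆ Finset.Ioc 0 D := by
      intro d hd
      rw [Finset.mem_Ioc]; exact ⟨(hS d hd).1, (hS d hd).2.1⟩
    calc ∑ d ∈ S, (d:ℝ) ^ 2 ≤ ∑ d ∈ Finset.Ioc 0 D, (d:ℝ) ^ 2 :=
          Finset.sum_le_sum_of_subset_of_nonneg h2 fun _ _ _ => by positivity
      _ ≤ ∑ d ∈ Finset.Ioc 0 D, (D:ℝ) ^ 2 := by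
          refine Finset.sum_le_sum fun d hd => ?_
          rw [Finset.mem_Ioc] at hd
          have : (d:ℝ) ≤ D := by exact_mod_cast hd.2
          gcongr
      _ = (D:ℝ) ^ 3 := by simp; ring
  have e6 : 2 / ((D:ℝ) ^ 3 + 1) * (∑ d ∈ S, (d:ℝ) * |T d|) ^ 2 ≤ 2 * Q := by
    rw [div_mul_eq_mul_div, div_le_iff₀ (by positivity)]
    nlinarith
  have e7 : Q ^ 2 ≤ W * ((HH X + 2) * Q) := by
    refine e2.trans (mul_le_mul_of_nonneg_left ?_ hW0)
    rw [e3]; linarith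
  rcases hQ0.eq_or_lt with h | h
  · rw [← h]; exact mul_nonneg hW0 (by linarith [HH_nonneg X])
  · nlinarith

/-- `V_{d,q}` -/
noncomputable def VV (D X d q : ℕ) : ℝ :=
  ∑ p ∈ (Finset.Ioc (D ^ 3) (X / q)).filter Nat.Prime, JJ p d

noncomputable def RR (D X d : ℕ) : ℝ := ∑ q ∈ Finset.Ioc 0 X, |VV D X d q|

lemma VV_sum (S : Finset ℕ) (D X q : ℕ) (hS : ∀ d ∈ S, 0 < d ∧ d ≤ D ∧ Odd d ∧ Squarefree d) :
    ∑ d ∈ S, VV D X d q ^ 2 ≤ ((X:ℝ) / q) ^ 2 * (HH X + 2) := by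
  have h := large_sieve S D (X / q) hS (fun n => if n.Prime then 1 else 0)
  have h1 : ∀ d, ∑ n ∈ Finset.Ioc (D ^ 3) (X / q), (if n.Prime then (1:ℝ) else 0) * JJ n d = VV D X d q := by
    intro d
    rw [VV, Finset.sum_filter]
    refine Finset.sum_congr rfl fun n _ => ?_
    split_ifs <;> simp
  simp_rw [h1] at h
  refine h.trans ?_
  have h2 : HH (X / q) ≤ HH X := Finset.sum_le_sum_of_subset_of_nonneg
    (Finset.Ioc_subset_Ioc_right (Nat.div_le_self _ _)) fun _ _ _ => by positivity
  have h3 : ∑ n ∈ Finset.Ioc (D ^ 3) (X / q), (n:ℝ) * (if n.Prime then (1:ℝ) else 0) ^ 2 ≤ ((X:ℝ) / q) ^ 2 := by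
    have h4 : ((X / q : ℕ) : ℝ) ≤ (X:ℝ) / q := Nat.cast_div_le
    calc _ ≤ ∑ n ∈ Finset.Ioc 0 (X / q), (n:ℝ) * (if n.Prime then (1:ℝ) else 0) ^ 2 :=
          Finset.sum_le_sum_of_subset_of_nonneg
              (Finset.Ioc_subset_Ioc_left (Nat.zero_le _)) fun _ _ _ => by positivity
      _ ≤ ∑ n ∈ Finset.Ioc 0 (X / q), ((X / q : ℕ) : ℝ) := by
          refine Finset.sum_le_sum fun n hn => ?_
          rw [Finset.mem_Ioc] at hn
          have : (n:ℝ) ≤ ((X / q : ℕ) : ℝ) := by exact_mod_cast hn.2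
          split_ifs
          · simpa using this
          · simp
      _ = ((X / q : ℕ) : ℝ) ^ 2 := by simp; ring
      _ ≤ _ := by gcongr
  have := HH_nonneg (X / q)
  gcongr

lemma RR_sum (S : Finset ℕ) (D X : ℕ) (hS : ∀ d ∈ S, 0 < d ∧ d ≤ D ∧ Odd d ∧ Squarefree d) :
    ∑ d ∈ S, RR D X d ^ 2 ≤ (X:ℝ) ^ 2 * (HH X) ^ 2 * (HH X + 2) := by
  have h1 : ∀ d, RR D X d ^ 2 ≤ HH X * ∑ q ∈ Finset.Ioc 0 X, q * VV D X d q ^ 2 := by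
    intro d
    have e : RR D X d = ∑ q ∈ Finset.Ioc 0 X, (1 / Real.sqrt q) * (Real.sqrt q * |VV D X d q|) := by
      refine Finset.sum_congr rfl fun q hq => ?_
      rw [Finset.mem_Ioc] at hq
      have : Real.sqrt q ≠ 0 := (Real.sqrt_pos.2 (by exact_mod_cast hq.1)).ne'
      field_simp
    rw [e]
    refine (Finset.sum_mul_sq_le_sq_mul_sq _ _ _).trans (le_of_eq ?_)
    congr 1
    · exact Finset.sum_congr rfl fun q _ => by rw [div_pow, Real.sq_sqrt (Nat.cast_nonneg q), one_pow]
    · exact Finset.sum_congr rfl fun q _ => by rw [mul_pow, Real.sq_sqrt (Nat.cast_nonneg q), sq_abs]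
  calc _ ≤ ∑ d ∈ S, HH X * ∑ q ∈ Finset.Ioc 0 X, q * VV D X d q ^ 2 := Finset.sum_le_sum fun d _ => h1 d
    _ = HH X * ∑ q ∈ Finset.Ioc 0 X, q * ∑ d ∈ S, VV D X d q ^ 2 := by
        rw [← Finset.mul_sum, Finset.sum_comm]; simp_rw [Finset.mul_sum]
    _ ≤ HH X * ∑ q ∈ Finset.Ioc 0 X, q * (((X:ℝ) / q) ^ 2 * (HH X + 2)) := by
        apply mul_le_mul_of_nonneg_left _ (HH_nonneg X)
        refine Finset.sum_le_sum fun q hq => ?_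
        rw [Finset.mem_Ioc] at hq
        exact mul_le_mul_of_nonneg_left (VV_sum S D X q hS) (Nat.cast_nonneg q)
    _ = HH X * ∑ q ∈ Finset.Ioc 0 X, ((X:ℝ) ^ 2 * (HH X + 2)) * (1 / (q:ℝ)) := by
        congr 1
        refine Finset.sum_congr rfl fun q hq => ?_
        rw [Finset.mem_Ioc] at hq
        have : (q:ℝ) ≠ 0 := by exact_mod_cast hq.1.ne'
        field_simp
    _ = _ := by
        rw [← Finset.mul_sum]; change HH X * (_ * HH X) = _; ring

end RaceProof

end

section

open Filter Topology

namespace RaceProof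

/-- primes up to `N` -/
def pr (N : ℕ) : Finset ℕ := (Finset.range (N + 1)).filter Nat.Prime

lemma mem_pr {N p : ℕ} : p ∈ pr N ↔ p ≤ N ∧ p.Prime := by
  simp [pr]

lemma card_pr (N : ℕ) : (pr N).card = Nat.primeCounting N := (primeCounting_eq_card N).symm

/-- pairs of primes with product at most `X` -/
def PP (X : ℕ) : Finset (ℕ × ℕ) := (pr X ×ˢ pr X).filter (fun t => t.1 * t.2 ≤ X)

lemma mem_PP {X : ℕ} {t : ℕ × ℕ} : t ∈ PP X ↔ t.1.Prime ∧ t.2.Prime ∧ t.1 * t.2 ≤ X := by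
  simp only [PP, Finset.mem_filter, Finset.mem_product, mem_pr]
  constructor
  · rintro ⟨⟨⟨-, h1⟩, -, h2⟩, h3⟩; exact ⟨h1, h2, h3⟩
  · rintro ⟨h1, h2, h3⟩
    refine ⟨⟨⟨?_, h1⟩, ?_, h2⟩, h3⟩
    · exact (Nat.le_mul_of_pos_right _ h2.pos).trans h3
    · exact (Nat.le_mul_of_pos_left _ h1.pos).trans h3

lemma sum_PP (X : ℕ) (F : ℕ → ℕ → ℝ) :
    ∑ t ∈ PP X, F t.1 t.2 = ∑ p ∈ pr X, ∑ q ∈ pr (X / p), F p q := by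
  rw [PP, Finset.sum_filter, Finset.sum_product]
  refine Finset.sum_congr rfl fun p hp => ?_
  rw [← Finset.sum_filter]
  refine Finset.sum_congr ?_ fun _ _ => rfl
  ext q
  simp only [Finset.mem_filter, mem_pr]
  have hp0 := (mem_pr.1 hp).2.pos
  rw [Nat.le_div_iff_mul_le hp0, mul_comm q p]
  constructor
  · rintro ⟨⟨-, h⟩, h'⟩; exact ⟨h', h⟩
  · rintro ⟨h', h⟩; exact ⟨⟨(Nat.le_mul_of_pos_left _ hp0).trans h', h⟩, h'⟩

lemma sum_PP' (X : ℕ) (F : ℕ → ℕ → ℝ) :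
    ∑ t ∈ PP X, F t.1 t.2 = ∑ q ∈ pr X, ∑ p ∈ pr (X / q), F p q := by
  rw [← sum_PP X (fun q p => F p q)]
  refine Finset.sum_bij' (fun t _ => t.swap) (fun t _ => t.swap) ?_ ?_ ?_ ?_ ?_
  · rintro ⟨a, b⟩ h
    rw [mem_PP] at h ⊢
    exact ⟨h.2.1, h.1, by simpa [mul_comm] using h.2.2⟩
  · rintro ⟨a, b⟩ h
    rw [mem_PP] at h ⊢
    exact ⟨h.2.1, h.1, by simpa [mul_comm] using h.2.2⟩
  all_goals intros; rfl


/-- the error quantity -/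
noncomputable def TT (X d : ℕ) : ℝ := ∑ t ∈ PP X, JJ t.1 d * (2 * (JJ t.2 d) ^ 2 + JJ t.2 d)

lemma JJ_tri (n d : ℕ) : JJ n d = 0 ∨ JJ n d = 1 ∨ JJ n d = -1 := by
  unfold JJ
  rcases jacobiSym.trichotomy (n : ℤ) d with h | h | h <;> rw [h] <;> simp

lemma TT_lower (D X d : ℕ) (hd : 0 < d) (hdD : d ≤ D) (hX : D ^ 3 ≤ X) :
    2 * ∑ p ∈ pr (D ^ 3), JJ p d * (Nat.primeCounting (X / p) : ℝ) - 4 * RR D X d - 5 * ((D:ℝ) ^ 3) ^ 2 ≤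
      TT X d := by
  set P0 := D ^ 3 with hP0
  set w : ℕ → ℝ := fun q => 2 * (JJ q d) ^ 2 + JJ q d with hw
  have hw0 : ∀ q, 0 ≤ w q := by
    intro q; simp only [hw]; rcases JJ_tri q d with h | h | h <;> rw [h] <;> norm_num
  have hw3 : ∀ q, w q ≤ 3 := by
    intro q; simp only [hw]; rcases JJ_tri q d with h | h | h <;> rw [h] <;> norm_num
  have hprsub : pr X ⊆ Finset.Ioc 0 X := by
    intro p hp; rw [mem_pr] at hp; rw [Finset.mem_Ioc]; exact ⟨hp.2.pos, hp.1⟩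
  have hR0 : ∑ q ∈ pr X, |VV D X d q| ≤ RR D X d :=
    Finset.sum_le_sum_of_subset_of_nonneg hprsub fun _ _ _ => abs_nonneg _
  have hsplit : ∀ N, pr N = (pr N).filter (fun p => p ≤ P0) ∪ (Finset.Ioc P0 N).filter Nat.Prime := by
    intro N; ext p
    simp only [Finset.mem_union, Finset.mem_filter, mem_pr, Finset.mem_Ioc]
    constructor
    · rintro ⟨h1, h2⟩
      rcases le_or_gt p P0 with h | h
      · left; exact ⟨⟨h1, h2⟩, h⟩
      · right; exact ⟨⟨h, h1⟩, h2⟩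
    · rintro (h | h)
      · exact h.1
      · exact ⟨h.1.2, h.2⟩
  have hdisj : ∀ N, Disjoint ((pr N).filter (fun p => p ≤ P0)) ((Finset.Ioc P0 N).filter Nat.Prime) := by
    intro N
    rw [Finset.disjoint_left]
    intro p h1 h2
    simp only [Finset.mem_filter, Finset.mem_Ioc] at h1 h2
    omega
  have hsum : ∀ N (F : ℕ → ℝ), ∑ p ∈ pr N, F p = ∑ p ∈ (pr N).filter (fun p => p ≤ P0), F p +
      ∑ p ∈ (Finset.Ioc P0 N).filter Nat.Prime, F p := by
    intro N F
    conv_lhs => rw [hsplit N]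
    rw [Finset.sum_union (hdisj N)]
  have hsmallcard : ∀ N, (((pr N).filter (fun p => p ≤ P0)).card : ℝ) ≤ P0 := by
    intro N
    have : (pr N).filter (fun p => p ≤ P0) ⊆ Finset.Ioc 0 P0 := by
      intro p hp
      rw [Finset.mem_filter, mem_pr] at hp
      rw [Finset.mem_Ioc]; exact ⟨hp.1.2.pos, hp.2⟩
    have := Finset.card_le_card this
    rw [Nat.card_Ioc] at this
    exact_mod_cast this
  -- split of TT
  have h1 : TT X d = ∑ t ∈ PP X, (if t.1 ≤ P0 then JJ t.1 d else 0) * w t.2 +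
      ∑ t ∈ PP X, (if t.1 ≤ P0 then 0 else JJ t.1 d) * w t.2 := by
    rw [TT, ← Finset.sum_add_distrib]
    refine Finset.sum_congr rfl fun t _ => ?_
    split_ifs <;> simp [hw]
  have h2 : -(3 * RR D X d) ≤ ∑ t ∈ PP X, (if t.1 ≤ P0 then 0 else JJ t.1 d) * w t.2 := by
    rw [sum_PP' X (fun p q => (if p ≤ P0 then 0 else JJ p d) * w q)]
    have e : ∀ q, ∑ p ∈ pr (X / q), (if p ≤ P0 then 0 else JJ p d) * w q = VV D X d q * w q := by
      intro q
      rw [← Finset.sum_mul, hsum]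
      congr 1
      rw [Finset.sum_eq_zero, zero_add, VV]
      · refine Finset.sum_congr rfl fun p hp => ?_
        rw [Finset.mem_filter, Finset.mem_Ioc] at hp
        rw [if_neg (by omega)]
      · intro p hp
        rw [Finset.mem_filter] at hp
        rw [if_pos hp.2]
    simp_rw [e]
    have : ∑ q ∈ pr X, -(3 * |VV D X d q|) ≤ ∑ q ∈ pr X, VV D X d q * w q := by
      refine Finset.sum_le_sum fun q _ => ?_
      have := neg_abs_le (VV D X d q)
      have := abs_nonneg (VV D X d q)
      nlinarith [hw0 q, hw3 q]
    rw [Finset.sum_neg_distrib, ← Finset.mul_sum] at this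
    linarith
  have h3 : ∑ t ∈ PP X, (if t.1 ≤ P0 then JJ t.1 d else 0) * w t.2 =
      ∑ p ∈ pr P0, JJ p d * ∑ q ∈ pr (X / p), w q := by
    rw [sum_PP X (fun p q => (if p ≤ P0 then JJ p d else 0) * w q)]
    have : pr P0 = (pr X).filter (fun p => p ≤ P0) := by
      ext p; simp only [Finset.mem_filter, mem_pr]
      constructor
      · rintro ⟨h, h'⟩; exact ⟨⟨h.trans hX, h'⟩, h⟩
      · rintro ⟨h, h'⟩; exact ⟨h', h.2⟩
    rw [this, Finset.sum_filter]
    refine Finset.sum_congr rfl fun p _ => ?_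
    rw [← Finset.mul_sum]
    split_ifs <;> simp
  have h4 : ∀ p, 2 * (JJ p d * (Nat.primeCounting (X / p) : ℝ)) - 5 * (P0:ℝ) - |VV D X d p| ≤
      JJ p d * ∑ q ∈ pr (X / p), w q := by
    intro p
    have a1 : ∑ q ∈ (Finset.Ioc P0 (X / p)).filter Nat.Prime, w q =
        2 * (((Finset.Ioc P0 (X / p)).filter Nat.Prime).card : ℝ) + VV D X d p := by
      rw [VV, Finset.card_eq_sum_ones]
      push_cast
      rw [Finset.mul_sum, ← Finset.sum_add_distrib]
      refine Finset.sum_congr rfl fun q hq => ?_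
      rw [Finset.mem_filter, Finset.mem_Ioc] at hq
      have hdq : d < q := by
        have : D ≤ D ^ 3 := Nat.le_self_pow (by norm_num) D
        omega
      have hne : JJ q d ≠ 0 := by
        unfold JJ
        rw [Int.cast_ne_zero]
        intro h
        have := jacobiSym.eq_zero_iff.1 h
        apply this.2
        have hc : Nat.Coprime q d := (Nat.Prime.coprime_iff_not_dvd hq.2).2 (fun h => absurd (Nat.le_of_dvd hd h) (by omega))
        exact_mod_cast hc
      simp only [hw]
      rcases JJ_tri q d with h | h | h
      · exact absurd h hne
      · rw [h]; norm_num
      · rw [h]; norm_num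
    have a2 := hsum (X / p) w
    have a3 := hsum (X / p) (fun _ => 1)
    simp only [Finset.sum_const, nsmul_eq_mul, mul_one] at a3
    rw [card_pr] at a3
    have a4 := hsmallcard (X / p)
    have a5 : ∑ p ∈ (pr (X / p)).filter (fun p => p ≤ P0), w p ≤ 3 * P0 := by
      refine (Finset.sum_le_sum fun q _ => hw3 q).trans ?_
      simp only [Finset.sum_const, nsmul_eq_mul]
      linarith
    have a6 : 0 ≤ ∑ p ∈ (pr (X / p)).filter (fun p => p ≤ P0), w p := Finset.sum_nonneg fun q _ => hw0 q
    have a7 : (0:ℝ) ≤ (((pr (X / p)).filter (fun p => p ≤ P0)).card : ℝ) := Nat.cast_nonneg _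
    have a8 := le_abs_self (VV D X d p)
    have a9 := neg_abs_le (VV D X d p)
    rw [a1] at a2
    rw [a2]
    rcases JJ_tri p d with h | h | h <;> rw [h]
    · have : (0:ℝ) ≤ P0 := Nat.cast_nonneg _
      linarith
    · linarith
    · linarith
  have h5 : ∑ p ∈ pr P0, (2 * (JJ p d * (Nat.primeCounting (X / p) : ℝ)) - 5 * (P0:ℝ) - |VV D X d p|) ≤
      ∑ p ∈ pr P0, JJ p d * ∑ q ∈ pr (X / p), w q := Finset.sum_le_sum fun p _ => h4 p
  rw [Finset.sum_sub_distrib, Finset.sum_sub_distrib, ← Finset.mul_sum] at h5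
  have h6 : ∑ p ∈ pr P0, 5 * (P0:ℝ) ≤ 5 * ((D:ℝ) ^ 3) ^ 2 := by
    simp only [Finset.sum_const, nsmul_eq_mul, card_pr]
    have : (Nat.primeCounting P0 : ℝ) ≤ P0 := by exact_mod_cast primeCounting_le_self P0
    have e : (P0:ℝ) = (D:ℝ) ^ 3 := by rw [hP0]; push_cast; rfl
    rw [← e]
    nlinarith [Nat.cast_nonneg (α := ℝ) P0]
  have h7 : ∑ p ∈ pr P0, |VV D X d p| ≤ RR D X d := by
    refine le_trans ?_ hR0
    refine Finset.sum_le_sum_of_subset_of_nonneg ?_ fun _ _ _ => abs_nonneg _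
    intro p hp; rw [mem_pr] at hp ⊢; exact ⟨hp.1.trans hX, hp.2⟩
  rw [h1, h3]
  linarith

end RaceProof

end

section

open Filter Topology

namespace RaceProof

lemma pairCount_eq (x : ℝ) (hx : 0 ≤ x) (Q : ℕ → ℕ → Prop) [DecidablePred (fun t : ℕ × ℕ => Q t.1 t.2)] :
    pairCount x Q = ((PP ⌊x⌋₊).filter (fun t => Q t.1 t.2)).card := by
  rw [pairCount]
  apply Nat.subtype_card
  rintro ⟨p, q⟩
  rw [Finset.mem_filter, mem_PP, Nat.le_floor_iff hx]
  simp only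
  tauto

lemma JJ_ne_zero_iff (p d : ℕ) [NeZero d] : JJ p d ≠ 0 ↔ Nat.Coprime p d := by
  unfold JJ
  rw [Int.cast_ne_zero, ne_eq, jacobiSym.eq_zero_iff_not_coprime, not_not]
  norm_cast

lemma raceRatio_ge (x : ℝ) (hx : 0 ≤ x) (d : ℕ) [NeZero d] (T B r : ℝ) (hT : T ≤ TT ⌊x⌋₊ d) (hT0 : 0 < T)
    (hB : ((PP ⌊x⌋₊).card : ℝ) ≤ B) (hr : r * B ≤ T) :
    1 + r ≤ raceRatio (cc d) 1 x := by
  classical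
  rw [raceRatio, pairCount_eq x hx, pairCount_eq x hx]
  set X := ⌊x⌋₊
  set a := ((PP X).filter (fun t => cc d t.1 = 1 ∧ cc d t.2 = 1)).card with ha
  set n := ((PP X).filter (fun t => Nat.gcd (t.1 * t.2) d = 1)).card with hn
  have hcc : ∀ p : ℕ, cc d (p : ZMod d) = 1 ↔ JJ p d = 1 := by
    intro p
    rw [cc_natCast, JJ]
    norm_cast
  have ha' : (a : ℝ) = ∑ t ∈ PP X, if (JJ t.1 d = 1 ∧ JJ t.2 d = 1) then (1:ℝ) else 0 := by
    rw [ha, Finset.sum_boole]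
    congr 2
    refine Finset.filter_congr fun t _ => ?_
    rw [hcc, hcc]
  have hn' : (n : ℝ) = ∑ t ∈ PP X, JJ t.1 d ^ 2 * JJ t.2 d ^ 2 := by
    rw [hn, Finset.card_filter]
    push_cast
    refine Finset.sum_congr rfl fun t _ => ?_
    have h1 : Nat.gcd (t.1 * t.2) d = 1 ↔ (JJ t.1 d ≠ 0 ∧ JJ t.2 d ≠ 0) := by
      rw [JJ_ne_zero_iff, JJ_ne_zero_iff]; exact Nat.coprime_mul_iff_left
    rw [if_congr h1 rfl rfl]
    rcases JJ_tri t.1 d with h | h | h <;> rcases JJ_tri t.2 d with h' | h' | h' <;> rw [h, h'] <;> norm_num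
  have hsw : ∑ t ∈ PP X, JJ t.1 d * JJ t.2 d ^ 2 = ∑ t ∈ PP X, JJ t.2 d * JJ t.1 d ^ 2 := by
    rw [sum_PP X (fun p q => JJ p d * JJ q d ^ 2), sum_PP' X (fun p q => JJ q d * JJ p d ^ 2)]
  have hid : 4 * (a : ℝ) = n + TT X d := by
    have hTT : TT X d = ∑ t ∈ PP X, JJ t.1 d * JJ t.2 d ^ 2 + ∑ t ∈ PP X, JJ t.2 d * JJ t.1 d ^ 2 +
        ∑ t ∈ PP X, JJ t.1 d * JJ t.2 d := by
      rw [← hsw, TT, ← Finset.sum_add_distrib, ← Finset.sum_add_distrib]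
      exact Finset.sum_congr rfl fun t _ => by ring
    rw [hTT, hn', ha', Finset.mul_sum, ← Finset.sum_add_distrib, ← Finset.sum_add_distrib, ← Finset.sum_add_distrib]
    refine Finset.sum_congr rfl fun t _ => ?_
    rcases JJ_tri t.1 d with h | h | h <;> rcases JJ_tri t.2 d with h' | h' | h' <;> rw [h, h'] <;> norm_num
  have h3 : TT X d ≤ 3 * n := by
    rw [TT, hn', Finset.mul_sum]
    refine Finset.sum_le_sum fun t _ => ?_
    rcases JJ_tri t.1 d with h | h | h <;> rcases JJ_tri t.2 d with h' | h' | h' <;> rw [h, h'] <;> norm_num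
  have hnpos : (0:ℝ) < n := by linarith
  have hnB : (n:ℝ) ≤ B := by
    refine le_trans ?_ hB
    exact_mod_cast Finset.card_filter_le _ _
  rw [le_div_iff₀ (by positivity)]
  have hrn : r * n ≤ TT X d := by
    rcases le_or_gt 0 r with h | h
    · nlinarith
    · nlinarith
  linarith

lemma card_PP_le (X : ℕ) : ((PP X).card : ℝ) ≤ 2 * ∑ p ∈ pr (Nat.sqrt X), (Nat.primeCounting (X / p) : ℝ) := by
  have h0 : ((PP X).card : ℝ) ≤ ∑ t ∈ PP X, (if t.1 ≤ Nat.sqrt X then (1:ℝ) else 0) +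
      ∑ t ∈ PP X, (if t.2 ≤ Nat.sqrt X then (1:ℝ) else 0) := by
    rw [Finset.card_eq_sum_ones, ← Finset.sum_add_distrib]
    push_cast
    refine Finset.sum_le_sum fun t ht => ?_
    have h := (mem_PP.1 ht).2.2
    have : t.1 ≤ Nat.sqrt X ∨ t.2 ≤ Nat.sqrt X := by
      by_contra hcon
      push Not at hcon
      have := Nat.lt_succ_sqrt X
      have h2 : (Nat.sqrt X).succ * (Nat.sqrt X).succ ≤ t.1 * t.2 := Nat.mul_le_mul hcon.1 hcon.2
      omega
    rcases this with h | h
    · rw [if_pos h]; split_ifs <;> norm_num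
    · rw [if_pos h]; split_ifs <;> norm_num
  have e : ∑ p ∈ pr X, ∑ q ∈ pr (X / p), (if p ≤ Nat.sqrt X then (1:ℝ) else 0) =
      ∑ p ∈ pr (Nat.sqrt X), (Nat.primeCounting (X / p) : ℝ) := by
    have : pr (Nat.sqrt X) = (pr X).filter (fun p => p ≤ Nat.sqrt X) := by
      ext p; simp only [Finset.mem_filter, mem_pr]
      constructor
      · rintro ⟨h, h'⟩; exact ⟨⟨h.trans (Nat.sqrt_le_self X), h'⟩, h⟩
      · rintro ⟨h, h'⟩; exact ⟨h', h.2⟩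
    rw [this, Finset.sum_filter]
    refine Finset.sum_congr rfl fun p _ => ?_
    rw [Finset.sum_const, card_pr]
    split_ifs <;> simp
  rw [sum_PP X (fun p q => if p ≤ Nat.sqrt X then (1:ℝ) else 0),
    sum_PP' X (fun p q => if q ≤ Nat.sqrt X then (1:ℝ) else 0), e] at h0
  linarith

end RaceProof

end

section

open Filter Topology

namespace RaceProof

lemma sum_log_div (n : ℕ) (hn : 0 < n) :
    ∑ p ∈ pr n, Real.log p / p ≤ Real.log n + Real.log 4 := by
  have h1 : ∏ p ∈ pr n, p ^ (n / p) ∣ n.factorial := by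
    apply Finset.prod_dvd_of_isRelPrime
    · intro p hp q hq hpq
      have hp' := (mem_pr.1 hp).2
      have hq' := (mem_pr.1 hq).2
      exact (Nat.coprime_iff_isRelPrime.1 (((Nat.coprime_primes hp' hq').2 hpq).pow _ _))
    · intro p hp
      have hp' := (mem_pr.1 hp).2
      rw [hp'.pow_dvd_factorial_iff (b := Nat.log p n + 2) (by omega)]
      have := Finset.single_le_sum (f := fun i => n / p ^ i) (s := Finset.Ico 1 (Nat.log p n + 2))
        (fun _ _ => Nat.zero_le _) (Finset.mem_Ico.2 ⟨le_rfl, by omega⟩)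
      simpa using this
  have h2 : ∏ p ∈ pr n, p ^ (n / p) ≤ n ^ n :=
    (Nat.le_of_dvd (Nat.factorial_pos n) h1).trans (Nat.factorial_le_pow n)
  have hn0 : (0:ℝ) < n := by exact_mod_cast hn
  have h3 : ∑ p ∈ pr n, ((n / p : ℕ) : ℝ) * Real.log p ≤ n * Real.log n := by
    have h4 : Real.log ((∏ p ∈ pr n, p ^ (n / p) : ℕ) : ℝ) ≤ Real.log ((n ^ n : ℕ) : ℝ) := by
      apply Real.log_le_log
      · have : 0 < ∏ p ∈ pr n, p ^ (n / p) := Finset.prod_pos fun p hp => pow_pos (mem_pr.1 hp).2.pos _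
        exact_mod_cast this
      · exact_mod_cast h2
    push_cast at h4
    rw [Real.log_pow, Real.log_prod] at h4
    · simp_rw [Real.log_pow] at h4; exact h4
    · intro p hp
      have := (mem_pr.1 hp).2.ne_zero
      positivity
  have h5 : ∑ p ∈ pr n, Real.log p ≤ n * Real.log 4 := by
    have h6 := Real.log_le_log (by exact_mod_cast primorial_pos n)
      (show ((primorial n : ℕ) : ℝ) ≤ ((4 ^ n : ℕ) : ℝ) by exact_mod_cast primorial_le_four_pow n)
    rw [primorial] at h6
    push_cast at h6
    rw [Real.log_pow, Real.log_prod] at h6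
    · exact h6
    · intro p hp
      have := (Finset.mem_filter.1 hp).2.ne_zero
      exact_mod_cast this
  have h7 : ∑ p ∈ pr n, (n * (Real.log p / p) - Real.log p) ≤ n * Real.log n := by
    refine le_trans (Finset.sum_le_sum fun p hp => ?_) h3
    have hp' := (mem_pr.1 hp).2
    have hlog : 0 ≤ Real.log p := Real.log_natCast_nonneg p
    have h8 : (n:ℝ) / p - 1 ≤ ((n / p : ℕ) : ℝ) := by
      rw [← Nat.floor_div_eq_div (K := ℝ)]
      exact (Nat.sub_one_lt_floor _).le
    have := mul_le_mul_of_nonneg_right h8 hlog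
    calc _ = ((n:ℝ) / p - 1) * Real.log p := by ring
      _ ≤ _ := this
  rw [Finset.sum_sub_distrib, ← Finset.mul_sum] at h7
  have : (n:ℝ) * ∑ p ∈ pr n, Real.log p / p ≤ n * (Real.log n + Real.log 4) := by linarith
  exact le_of_mul_le_mul_left this hn0

lemma tendsto_LL : Tendsto (fun x : ℝ => Real.log (Real.log x)) atTop atTop :=
  Real.tendsto_log_atTop.comp Real.tendsto_log_atTop

lemma pi_pt : ∃ η : ℝ → ℝ, (∀ c : ℝ, ∀ᶠ x in atTop, η x * (Real.log (Real.log x) + c) ≤ 1) ∧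
    (∀ᶠ x in atTop, 0 ≤ η x) ∧
    ∀ᶠ x in atTop, ∀ p : ℕ, 1 ≤ p → (p : ℝ) ≤ Real.sqrt x →
      x / Real.log x * (1 / p) * (1 - η x) ≤ PI (x / p) ∧
      PI (x / p) ≤ x / Real.log x * (1 / p) * (1 + 2 * Real.log p / Real.log x) * (1 + η x) := by
  obtain ⟨C, X0, hC, hX0, hP⟩ := PI_rate
  refine ⟨fun x => C * (Real.log x / 2) ^ (-(1 / 45 : ℝ)), ?_, ?_, ?_⟩
  · intro c
    have h1 : Tendsto (fun y : ℝ => C * (y / 2) ^ (-(1 / 45 : ℝ)) * (Real.log y + c)) atTop (𝓝 0) := by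
      have a : Tendsto (fun y : ℝ => Real.log y / y ^ (1 / 45 : ℝ)) atTop (𝓝 0) :=
        (isLittleO_log_rpow_atTop (by norm_num)).tendsto_div_nhds_zero
      have b : Tendsto (fun y : ℝ => y ^ (-(1 / 45 : ℝ))) atTop (𝓝 0) := tendsto_rpow_neg_atTop (by norm_num)
      have c' : Tendsto (fun y : ℝ => C * (1 / 2 : ℝ) ^ (-(1 / 45 : ℝ)) * (Real.log y / y ^ (1 / 45 : ℝ) + c * y ^ (-(1 / 45 : ℝ))))
          atTop (𝓝 (C * (1 / 2 : ℝ) ^ (-(1 / 45 : ℝ)) * (0 + c * 0))) := (a.add (b.const_mul c)).const_mul _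
      simp only [mul_zero, add_zero] at c'
      refine c'.congr' ?_
      filter_upwards [eventually_gt_atTop 0] with y hy
      rw [div_eq_mul_one_div y 2, Real.mul_rpow hy.le (by norm_num), Real.rpow_neg hy.le]
      field_simp
    exact (h1.comp Real.tendsto_log_atTop).eventually (eventually_le_nhds (by norm_num))
  · filter_upwards [eventually_ge_atTop 1] with x hx
    have := Real.log_nonneg hx
    positivity
  · filter_upwards [eventually_ge_atTop (X0 ^ 2), eventually_ge_atTop 3] with x hx hx3 p hp1 hp
    have hx0 : 0 < x := by linarith
    have hp0 : (0:ℝ) < p := by exact_mod_cast hp1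
    have hp1' : (1:ℝ) ≤ p := by exact_mod_cast hp1
    set L := Real.log x with hL
    have hL0 : 0 < L := Real.log_pos (by linarith)
    set y := x / p with hy
    have hsq : Real.sqrt x * Real.sqrt x = x := Real.mul_self_sqrt hx0.le
    have hys : Real.sqrt x ≤ y := by
      rw [hy, le_div_iff₀ hp0]; nlinarith [Real.sqrt_nonneg x]
    have hyX : X0 ≤ y := le_trans (Real.le_sqrt_of_sq_le hx) hys
    have hy0 : 0 < y := by linarith
    have hlogy : Real.log y = L - Real.log p := Real.log_div hx0.ne' hp0.ne'
    have hlp : 0 ≤ Real.log p := Real.log_nonneg hp1'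
    have hlp2 : Real.log p ≤ L / 2 := by
      rw [hL, ← Real.log_sqrt hx0.le]; exact Real.log_le_log hp0 hp
    have hly : L / 2 ≤ Real.log y := by linarith
    have hly0 : 0 < Real.log y := by linarith
    have hη : (Real.log y) ^ (-(1 / 45 : ℝ)) ≤ (L / 2) ^ (-(1 / 45 : ℝ)) :=
      Real.rpow_le_rpow_of_nonpos (by linarith) hly (by norm_num)
    set e := C * (L / 2) ^ (-(1 / 45 : ℝ)) with he
    have he0 : 0 ≤ e := by positivity
    have hmain := hP y hyX
    have hyl : 0 < y / Real.log y := by positivity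
    have hmain2 : |PI y - y / Real.log y| ≤ y / Real.log y * e := by
      refine hmain.trans ?_
      rw [he]
      calc _ = y / Real.log y * (C * Real.log y ^ (-(1 / 45 : ℝ))) := by ring
        _ ≤ _ := by gcongr
    have hm := abs_le.1 hmain2
    have e1 : x / L * (1 / p) = y / L := by rw [hy]; ring
    rw [e1]
    have e2 : y / L ≤ y / Real.log y := by
      apply div_le_div_of_nonneg_left hy0.le hly0; linarith
    have e3 : y / Real.log y ≤ y / L * (1 + 2 * Real.log p / L) := by
      rw [div_mul_eq_mul_div, div_le_div_iff₀ hly0 hL0, mul_assoc, mul_le_mul_iff_right₀ hy0]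
      have : L * (1 - Real.log p / L) * (1 + 2 * Real.log p / L) = (1 + 2 * Real.log p / L) * Real.log y := by
        rw [hlogy]; field_simp
      rw [← this, mul_assoc]
      have h1 : Real.log p / L ≤ 1 / 2 := by rw [div_le_iff₀ hL0]; linarith
      have h2 : 0 ≤ Real.log p / L := by positivity
      have h3 : 1 ≤ (1 - Real.log p / L) * (1 + 2 * Real.log p / L) := by
        rw [mul_div_assoc]; nlinarith
      nlinarith
    have hyL : 0 < y / L := by positivity
    constructor
    · rcases le_or_gt 1 e with h | h
      · have := PI_nonneg y
        nlinarith
      · nlinarith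
    · have : y / Real.log y * (1 + e) ≤ y / L * (1 + 2 * Real.log p / L) * (1 + e) :=
        mul_le_mul_of_nonneg_right e3 (by linarith)
      linarith

end RaceProof

end

section

open Filter Topology

namespace RaceProof

lemma PI_div (x : ℝ) (p : ℕ) : (Nat.primeCounting (⌊x⌋₊ / p) : ℝ) = PI (x / p) := by
  rw [PI, Nat.floor_div_natCast]

lemma PS_eq (n : ℕ) : PS n = ∑ p ∈ pr n, 1 / (p:ℝ) := rfl

lemma PP_upper : ∃ c : ℝ, 0 < c ∧ ∀ᶠ x in atTop,
    ((PP ⌊x⌋₊).card : ℝ) ≤ 2 * (x / Real.log x * (Real.log (Real.log x) + c)) := by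
  obtain ⟨η, h1, h2, h3⟩ := pi_pt
  obtain ⟨Cm, hCm, hm⟩ := mertens
  set c := Cm + 1 + 2 * Real.log 4 with hc
  have hl4 : 0 < Real.log 4 := Real.log_pos (by norm_num)
  refine ⟨c + 1, by positivity, ?_⟩
  filter_upwards [h1 c, h2, h3, eventually_ge_atTop 4, tendsto_LL.eventually_ge_atTop 0,
    Real.tendsto_log_atTop.eventually_ge_atTop 1] with x g1 g2 g3 hx hLL hL1
  have hx0 : 0 ≤ x := by linarith
  set L := Real.log x with hL
  set X := ⌊x⌋₊ with hX
  set n := Nat.sqrt X with hn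
  have hX4 : 4 ≤ X := Nat.le_floor (by exact_mod_cast hx)
  have hn0 : 0 < n := Nat.sqrt_pos.2 (by omega)
  have hnx : (n:ℝ) ≤ Real.sqrt x := by
    apply Real.le_sqrt_of_sq_le
    have : n ^ 2 ≤ X := Nat.sqrt_le' X
    calc ((n:ℝ)) ^ 2 = ((n ^ 2 : ℕ) : ℝ) := by push_cast; rfl
      _ ≤ X := by exact_mod_cast this
      _ ≤ x := Nat.floor_le hx0
  refine (card_PP_le X).trans ?_
  apply mul_le_mul_of_nonneg_left _ (by norm_num)
  have s1 : ∑ p ∈ pr n, (Nat.primeCounting (X / p) : ℝ) ≤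
      ∑ p ∈ pr n, x / L * (1 + η x) * (1 / p + 2 / L * (Real.log p / p)) := by
    refine Finset.sum_le_sum fun p hp => ?_
    rw [PI_div]
    have hp' := mem_pr.1 hp
    refine (g3 p hp'.2.one_lt.le (le_trans (by exact_mod_cast hp'.1) hnx)).2.trans (le_of_eq ?_)
    ring
  refine s1.trans ?_
  rw [← Finset.mul_sum, Finset.sum_add_distrib, ← Finset.mul_sum, ← PS_eq]
  have s2 : PS n ≤ Real.log L + Cm := by
    have : PS n ≤ PS X := PS_mono (Nat.sqrt_le_self X)
    have := (abs_le.1 (hm x (by linarith))).2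
    linarith
  have s3 : 2 / L * ∑ p ∈ pr n, Real.log p / p ≤ 1 + 2 * Real.log 4 := by
    have a := sum_log_div n hn0
    have b : Real.log n ≤ L / 2 := by
      rw [hL, ← Real.log_sqrt hx0]; exact Real.log_le_log (by exact_mod_cast hn0) hnx
    have : ∑ p ∈ pr n, Real.log p / p ≤ L / 2 + Real.log 4 := by linarith
    calc _ ≤ 2 / L * (L / 2 + Real.log 4) := by gcongr
      _ = 1 + 2 * Real.log 4 / L := by field_simp
      _ ≤ _ := by
        have : 2 * Real.log 4 / L ≤ 2 * Real.log 4 := div_le_self (by positivity) hL1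
        linarith
  have hxL : 0 ≤ x / L := by positivity
  rw [mul_assoc]
  apply mul_le_mul_of_nonneg_left _ hxL
  calc _ ≤ (1 + η x) * (Real.log L + c) := by
        apply mul_le_mul_of_nonneg_left _ (by linarith)
        rw [hc]; linarith
    _ ≤ _ := by linarith

lemma PI_upper : ∀ᶠ x in atTop, ∀ p : ℕ, 1 ≤ p → (p : ℝ) ≤ Real.sqrt x →
    PI (x / p) ≤ 4 * (x / Real.log x) * (1 / p) := by
  obtain ⟨η, h1, h2, h3⟩ := pi_pt
  filter_upwards [h1 0, h2, h3, eventually_ge_atTop 4, tendsto_LL.eventually_ge_atTop 1,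
    Real.tendsto_log_atTop.eventually_ge_atTop 1] with x g1 g2 g3 hx hLL hL1 p hp1 hp
  refine (g3 p hp1 hp).2.trans ?_
  have hη : η x ≤ 1 := by nlinarith
  have hp0 : (0:ℝ) < p := by exact_mod_cast hp1
  have hlog : 2 * Real.log p / Real.log x ≤ 1 := by
    rw [div_le_one (by linarith)]
    have : Real.log p ≤ Real.log x / 2 := by
      rw [← Real.log_sqrt (by linarith)]; exact Real.log_le_log hp0 hp
    linarith
  have hlog0 : 0 ≤ 2 * Real.log p / Real.log x := by
    have := Real.log_natCast_nonneg p
    positivity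
  have ha : 0 ≤ x / Real.log x * (1 / p) := by positivity
  calc _ ≤ x / Real.log x * (1 / p) * (1 + 1) * (1 + 1) := by
        apply mul_le_mul (mul_le_mul_of_nonneg_left (by linarith) ha) (by linarith) (by linarith) (by positivity)
    _ = _ := by ring

lemma tendsto_s : Tendsto (fun x : ℝ => Real.sqrt (Real.log x)) atTop atTop :=
  Real.tendsto_sqrt_atTop.comp Real.tendsto_log_atTop

lemma E_lower : ∃ c : ℝ, 0 < c ∧ ∀ᶠ x in atTop,
    x / Real.log x * (Real.log (Real.log (Real.log x)) - c) ≤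
      ∑ p ∈ pr ⌊Real.sqrt (Real.sqrt (Real.log x))⌋₊, PI (x / p) := by
  obtain ⟨η, h1, h2, h3⟩ := pi_pt
  obtain ⟨Cm, hCm, hm⟩ := mertens
  have hl4 : 0 < Real.log 4 := Real.log_pos (by norm_num)
  refine ⟨Cm + Real.log 4 + 1, by positivity, ?_⟩
  filter_upwards [h1 Cm, h2, h3, eventually_ge_atTop 4, tendsto_LL.eventually_ge_atTop 1,
    Real.tendsto_log_atTop.eventually_ge_atTop 1,
    tendsto_s.eventually_ge_atTop 9] with x g1 g2 g3 hx hLL hL1 hs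
  set L := Real.log x with hL
  set s := Real.sqrt L with hs'
  have hx0 : 0 < x := by linarith
  have hLx : L ≤ x := (Real.log_le_sub_one_of_pos hx0).trans (by linarith)
  have hy3 : 3 ≤ Real.sqrt s := Real.le_sqrt_of_sq_le (by linarith)
  have hs1 : s ≤ Real.sqrt x := Real.sqrt_le_sqrt hLx
  have hss : Real.sqrt s ≤ s := by
    rw [Real.sqrt_le_left (by linarith)]; nlinarith
  have hLLs : Real.log (Real.log (Real.sqrt s)) = Real.log (Real.log L) - Real.log 4 := by
    rw [Real.log_sqrt (by linarith), hs', Real.log_sqrt (by linarith), div_div,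
      Real.log_div (by linarith) (by norm_num)]
    norm_num
  have hM := abs_le.1 (hm (Real.sqrt s) hy3)
  rw [hLLs] at hM
  set Y := ⌊Real.sqrt s⌋₊ with hY
  have hYle : (Y:ℝ) ≤ Real.sqrt s := Nat.floor_le (Real.sqrt_nonneg _)
  have hLLL : Real.log (Real.log L) ≤ Real.log L := by
    have := Real.log_le_sub_one_of_pos (by linarith : 0 < Real.log L); linarith
  have s1 : ∑ p ∈ pr Y, x / L * (1 - η x) * (1 / p) ≤ ∑ p ∈ pr Y, PI (x / p) := by
    refine Finset.sum_le_sum fun p hp => ?_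
    have hp' := mem_pr.1 hp
    have hpY : (p:ℝ) ≤ Y := by exact_mod_cast hp'.1
    refine le_trans (le_of_eq ?_) (g3 p hp'.2.one_lt.le (by linarith)).1
    ring
  rw [← Finset.mul_sum, ← PS_eq] at s1
  refine le_trans ?_ s1
  rw [mul_assoc]
  have hxL : 0 ≤ x / L := by positivity
  apply mul_le_mul_of_nonneg_left _ hxL
  have hb : PS Y ≤ Real.log L + Cm := by linarith
  have : η x * PS Y ≤ 1 := (mul_le_mul_of_nonneg_left hb g2).trans g1
  linarith

lemma Mid_upper : ∃ c : ℝ, 0 < c ∧ ∀ᶠ x in atTop,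
    ∑ p ∈ (pr (⌊Real.exp (Real.sqrt (Real.log x))⌋₊ ^ 3)).filter
      (fun p => ⌊Real.exp (Real.sqrt (Real.log x) / 4)⌋₊ < p), PI (x / p) ≤ x / Real.log x * c := by
  obtain ⟨Cm, hCm, hm⟩ := mertens
  have hl4 : 0 < Real.log 12 := Real.log_pos (by norm_num)
  refine ⟨4 * (Real.log 12 + 2 * Cm), by positivity, ?_⟩
  filter_upwards [PI_upper, eventually_ge_atTop 4, 
    Real.tendsto_log_atTop.eventually_ge_atTop 1,
    tendsto_s.eventually_ge_atTop 12] with x g hx hL1 hs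
  set L := Real.log x with hL
  set s := Real.sqrt L with hs'
  have hx0 : 0 < x := by linarith
  have hs2 : s * s = L := Real.mul_self_sqrt (by linarith)
  set D := ⌊Real.exp s⌋₊ with hD
  set z := ⌊Real.exp (s / 4)⌋₊ with hz
  have hD3 : ((D ^ 3 : ℕ) : ℝ) ≤ Real.exp (3 * s) := by
    push_cast
    have : (D:ℝ) ≤ Real.exp s := Nat.floor_le (Real.exp_pos _).le
    calc (D:ℝ) ^ 3 ≤ Real.exp s ^ 3 := by gcongr
      _ = _ := by rw [← Real.exp_nat_mul]; norm_num
  have hsq : Real.exp (3 * s) ≤ Real.sqrt x := by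
    apply Real.le_sqrt_of_sq_le
    rw [← Real.exp_nat_mul, ← Real.exp_log hx0]
    apply Real.exp_le_exp.2
    rw [← hL, ← hs2]; push_cast; nlinarith
  have s1 : ∑ p ∈ (pr (D ^ 3)).filter (fun p => z < p), PI (x / p) ≤
      4 * (x / L) * ∑ p ∈ (pr (D ^ 3)).filter (fun p => z < p), 1 / (p:ℝ) := by
    rw [Finset.mul_sum]
    refine Finset.sum_le_sum fun p hp => ?_
    have hp' := mem_pr.1 (Finset.mem_filter.1 hp).1
    have : (p:ℝ) ≤ ((D ^ 3 : ℕ) : ℝ) := by exact_mod_cast hp'.1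
    exact g p hp'.2.one_lt.le (by linarith)
  refine s1.trans ?_
  have s2 : ∑ p ∈ (pr (D ^ 3)).filter (fun p => z < p), 1 / (p:ℝ) ≤ PS (D ^ 3) - PS z := by
    rw [PS_eq, PS_eq, ← Finset.sum_filter_add_sum_filter_not (pr (D ^ 3)) (fun p => z < p)]
    have : ∑ p ∈ pr z, 1 / (p:ℝ) ≤ ∑ p ∈ (pr (D ^ 3)).filter (fun p => ¬ z < p), 1 / (p:ℝ) := by
      apply Finset.sum_le_sum_of_subset_of_nonneg
      · intro p hp
        rw [mem_pr] at hp
        rw [Finset.mem_filter, mem_pr]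
        refine ⟨⟨hp.1.trans ?_, hp.2⟩, by omega⟩
        calc z ≤ D := Nat.floor_mono (Real.exp_le_exp.2 (by linarith))
          _ ≤ D ^ 3 := Nat.le_self_pow (by norm_num) D
      · intros; positivity
    linarith
  have e3 : ∀ t : ℝ, 3 ≤ t → 3 ≤ Real.exp t := by
    intro t ht; have := Real.add_one_le_exp t; linarith
  have a := (abs_le.1 (hm (Real.exp (3 * s)) (e3 _ (by linarith)))).2
  have b := (abs_le.1 (hm (Real.exp (s / 4)) (e3 _ (by linarith)))).1
  have c : PS (D ^ 3) ≤ PS ⌊Real.exp (3 * s)⌋₊ := PS_mono (Nat.le_floor hD3)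
  rw [Real.log_exp] at a b
  have d : Real.log (3 * s) - Real.log (s / 4) = Real.log 12 := by
    rw [← Real.log_div (by positivity) (by positivity)]
    congr 1; field_simp; norm_num
  have f : ∑ p ∈ (pr (D ^ 3)).filter (fun p => z < p), 1 / (p:ℝ) ≤ Real.log 12 + 2 * Cm := by linarith
  calc _ ≤ 4 * (x / L) * (Real.log 12 + 2 * Cm) := mul_le_mul_of_nonneg_left f (by positivity)
    _ = _ := by ring

end RaceProof

end

section

open Filter Topology

namespace RaceProof

lemma good_ratio : ∃ A : ℝ, 0 < A ∧ ∀ᶠ x in atTop, ∀ (d : ℕ) [NeZero d],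
    d ≤ ⌊Real.exp (Real.sqrt (Real.log x))⌋₊ →
    (∀ p ∈ pr ⌊Real.sqrt (Real.sqrt (Real.log x))⌋₊, JJ p d = 1) →
    |∑ p ∈ (pr ⌊Real.exp (Real.sqrt (Real.log x) / 4)⌋₊).filter
      (fun p => ⌊Real.sqrt (Real.sqrt (Real.log x))⌋₊ < p), PI (x / p) * JJ p d| ≤ x / Real.log x →
    RR ⌊Real.exp (Real.sqrt (Real.log x))⌋₊ ⌊x⌋₊ d ≤ x / Real.log x →
    1 + (Real.log (Real.log (Real.log x)) - A) / Real.log (Real.log x) ≤ raceRatio (cc d) 1 x := by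
  obtain ⟨c2, hc2, g2⟩ := PP_upper
  obtain ⟨c1, hc1, g1⟩ := E_lower
  obtain ⟨c3, hc3, g3⟩ := Mid_upper
  set c := c1 + 1 + c3 + 2 + 1 with hc
  refine ⟨c + c2, by positivity, ?_⟩
  filter_upwards [g1, g2, g3, eventually_ge_atTop 4, tendsto_LL.eventually_ge_atTop 1,
    (Real.tendsto_log_atTop.comp tendsto_LL).eventually_ge_atTop (c + 1),
    Real.tendsto_log_atTop.eventually_ge_atTop 1,
    tendsto_s.eventually_ge_atTop 16] with x g1 g2 g3 hx hLL hLLL hL1 hs d _ hdD hY hU hR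
  simp only [Function.comp_apply] at hLLL
  set L := Real.log x with hL
  set s := Real.sqrt L with hs'
  have hx0 : 0 < x := by linarith
  have hs2 : s * s = L := Real.mul_self_sqrt (by linarith)
  set D := ⌊Real.exp s⌋₊ with hD
  set z := ⌊Real.exp (s / 4)⌋₊ with hz
  set Y := ⌊Real.sqrt s⌋₊ with hYd
  set X := ⌊x⌋₊ with hX
  have hd0 : 0 < d := Nat.pos_of_ne_zero (NeZero.ne d)
  have hDe : (D:ℝ) ≤ Real.exp s := Nat.floor_le (Real.exp_pos _).le
  have hxe : x = Real.exp (s * s) := by rw [hs2, hL, Real.exp_log hx0]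
  have hD3 : ((D ^ 3 : ℕ) : ℝ) ≤ Real.exp (3 * s) := by
    push_cast
    calc (D:ℝ) ^ 3 ≤ Real.exp s ^ 3 := by gcongr
      _ = _ := by rw [← Real.exp_nat_mul]; norm_num
  have hD3X : D ^ 3 ≤ X := by
    apply Nat.le_floor
    refine hD3.trans ?_
    rw [hxe]; apply Real.exp_le_exp.2; nlinarith
  have hxL : 0 < x / L := by positivity
  have hP : 5 * ((D:ℝ) ^ 3) ^ 2 ≤ 2 * (x / L) := by
    have a : ((D:ℝ) ^ 3) ^ 2 ≤ Real.exp (6 * s) := by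
      calc ((D:ℝ) ^ 3) ^ 2 = (D:ℝ) ^ 6 := by ring
        _ ≤ Real.exp s ^ 6 := by gcongr
        _ = _ := by rw [← Real.exp_nat_mul]; norm_num
    have b : L ≤ Real.exp (2 * s) := by
      have : s ≤ Real.exp s := by linarith [Real.add_one_le_exp s]
      calc L = s * s := hs2.symm
        _ ≤ Real.exp s * Real.exp s := by gcongr
        _ = _ := by rw [← Real.exp_add]; ring_nf
    have c5 : 5 / 2 ≤ Real.exp (2 * s) := by linarith [Real.add_one_le_exp (2 * s)]
    rw [mul_div_assoc', le_div_iff₀ (by linarith)]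
    have e : Real.exp (2 * s) * Real.exp (6 * s) * Real.exp (2 * s) ≤ x := by
      rw [← Real.exp_add, ← Real.exp_add, hxe]; apply Real.exp_le_exp.2; nlinarith
    have f : 5 / 2 * ((D:ℝ) ^ 3) ^ 2 * L ≤ Real.exp (2 * s) * Real.exp (6 * s) * Real.exp (2 * s) := by
      gcongr
    linarith
  have hTT := TT_lower D X d hd0 hdD hD3X
  have hYz : Y ≤ z := by
    apply Nat.floor_mono
    have h1 : s / 4 + 1 ≤ Real.exp (s / 4) := Real.add_one_le_exp _
    have h2 : Real.sqrt s ≤ s / 4 := by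
      rw [Real.sqrt_le_left (by linarith)]; nlinarith
    linarith
  have hzD : z ≤ D ^ 3 := by
    calc z ≤ D := Nat.floor_mono (Real.exp_le_exp.2 (by linarith))
      _ ≤ D ^ 3 := Nat.le_self_pow (by norm_num) D
  have hsplit : ∑ p ∈ pr (D ^ 3), JJ p d * (Nat.primeCounting (X / p) : ℝ) =
      ∑ p ∈ pr Y, PI (x / p) * JJ p d + ∑ p ∈ (pr z).filter (fun p => Y < p), PI (x / p) * JJ p d
      + ∑ p ∈ (pr (D ^ 3)).filter (fun p => z < p), PI (x / p) * JJ p d := by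
    rw [← Finset.sum_filter_not_add_sum_filter (pr (D ^ 3)) (fun p => z < p)]
    have e1 : (pr (D ^ 3)).filter (fun p => ¬ z < p) = pr z := by
      ext p; simp only [Finset.mem_filter, mem_pr]
      constructor
      · rintro ⟨h, h'⟩; exact ⟨by omega, h.2⟩
      · rintro ⟨h, h'⟩; exact ⟨⟨by omega, h'⟩, by omega⟩
    have e2 : (pr z).filter (fun p => ¬ Y < p) = pr Y := by
      ext p; simp only [Finset.mem_filter, mem_pr]
      constructor
      · rintro ⟨h, h'⟩; exact ⟨by omega, h.2⟩
      · rintro ⟨h, h'⟩; exact ⟨⟨by omega, h'⟩, by omega⟩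
    rw [e1, ← Finset.sum_filter_not_add_sum_filter (pr z) (fun p => Y < p), e2]
    simp_rw [hX, PI_div, mul_comm (JJ _ d)]
  have t1 : ∑ p ∈ pr Y, PI (x / p) * JJ p d = ∑ p ∈ pr Y, PI (x / p) :=
    Finset.sum_congr rfl fun p hp => by rw [hY p hp, mul_one]
  have t2 := (abs_le.1 hU).1
  have t3 : -∑ p ∈ (pr (D ^ 3)).filter (fun p => z < p), PI (x / p) ≤
      ∑ p ∈ (pr (D ^ 3)).filter (fun p => z < p), PI (x / p) * JJ p d := by
    rw [← Finset.sum_neg_distrib]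
    refine Finset.sum_le_sum fun p _ => ?_
    have := PI_nonneg (x / p)
    have := (abs_le.1 (JJ_abs_le p d)).1
    nlinarith
  rw [hsplit, t1] at hTT
  apply raceRatio_ge x hx0.le d (2 * (x / L * (Real.log (Real.log L) - c)))
    (2 * (x / L * (Real.log L + c2)))
  · rw [hc]
    linarith
  · have : 0 < Real.log (Real.log L) - c := by linarith
    positivity
  · exact g2
  · have hl : Real.log (Real.log L) ≤ Real.log L := by
      have := Real.log_le_sub_one_of_pos (by linarith : 0 < Real.log L); linarith
    have key : (Real.log (Real.log L) - (c + c2)) / Real.log L * (Real.log L + c2) ≤ Real.log (Real.log L) - c := by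
      rw [div_mul_eq_mul_div, div_le_iff₀ (by linarith)]
      have : 0 < c := by rw [hc]; positivity
      nlinarith
    calc _ = 2 * (x / L * ((Real.log (Real.log L) - (c + c2)) / Real.log L * (Real.log L + c2))) := by ring
      _ ≤ _ := by gcongr

lemma cheb (S : Finset ℕ) (f : ℕ → ℝ) (T B : ℝ) (hT : 0 < T) (h : ∑ k ∈ S, f k ^ 2 ≤ T ^ 2 * B) :
    ((S.filter (fun k => T < |f k|)).card : ℝ) ≤ B := by
  have h1 : ∑ k ∈ S.filter (fun k => T < |f k|), T ^ 2 ≤ ∑ k ∈ S, f k ^ 2 := by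
    refine le_trans (Finset.sum_le_sum fun k hk => ?_)
      (Finset.sum_le_sum_of_subset_of_nonneg (Finset.filter_subset _ S) fun _ _ _ => sq_nonneg _)
    rw [← sq_abs (f k)]
    have := (Finset.mem_filter.1 hk).2
    gcongr
  rw [Finset.sum_const, nsmul_eq_mul] at h1
  have : 0 < T ^ 2 := by positivity
  nlinarith

/-- number of good `k` -/
lemma good_count (x T : ℝ) (hT : 0 < T) (hx : 1 ≤ x) (hTx : T = x / Real.log x) (hL : 1 ≤ Real.log x)
    (M K Y z D : ℕ) (hY : 2 ≤ Y) (hM : M = 8 * primorial Y) (hK : K = D / M)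
    (hPI : ∀ p : ℕ, 1 ≤ p → p ≤ z → PI (x / p) ≤ 4 * (x / Real.log x) * (1 / p)) :
    (K:ℝ) - 17 * (K / Y) - Nat.sqrt D - 16 * (z:ℝ) ^ 2 - (Real.log x + 3) ^ 5 ≤
      (((Finset.range K).filter (fun k => Squarefree (1 + M * k) ∧
        |∑ p ∈ (pr z).filter (fun p => Y < p), PI (x / p) * JJ p (1 + M * k)| ≤ T ∧
        RR D ⌊x⌋₊ (1 + M * k) ≤ T)).card : ℝ) := by
  classical
  have hMpos : 0 < M := by rw [hM]; have := primorial_pos Y; omega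
  have hkD : ∀ k < K, 1 + M * k ≤ D := by
    intro k hk
    have h1 : M * (k + 1) ≤ M * K := Nat.mul_le_mul_left _ hk
    have h2 : M * K ≤ D := by rw [hK]; exact Nat.mul_div_le D M
    rw [mul_add, mul_one] at h1; omega
  have h8 : 8 ∣ M := by rw [hM]; exact Dvd.intro _ rfl
  set U : ℕ → ℝ := fun k => ∑ p ∈ (pr z).filter (fun p => Y < p), PI (x / p) * JJ p (1 + M * k) with hU
  set R : ℕ → ℝ := fun k => RR D ⌊x⌋₊ (1 + M * k) with hR
  set b1 := (Finset.range K).filter (fun k => ¬ Squarefree (1 + M * k)) with hb1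
  set b2 := (Finset.range K).filter (fun k => T < |U k|) with hb2
  set b3 := ((Finset.range K).filter (fun k => Squarefree (1 + M * k))).filter (fun k => T < |R k|) with hb3
  set G := (Finset.range K).filter (fun k => Squarefree (1 + M * k) ∧ |U k| ≤ T ∧ R k ≤ T) with hG
  have hcover : Finset.range K ⊆ G ∪ (b1 ∪ (b2 ∪ b3)) := by
    intro k hk
    simp only [hG, hb1, hb2, hb3, Finset.mem_union, Finset.mem_filter]
    by_cases h1 : Squarefree (1 + M * k)
    · by_cases h2 : |U k| ≤ T
      · by_cases h3 : R k ≤ T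
        · left; exact ⟨hk, h1, h2, h3⟩
        · right; right; right; exact ⟨⟨hk, h1⟩, lt_of_lt_of_le (not_le.1 h3) (le_abs_self _)⟩
      · right; right; left; exact ⟨hk, not_le.1 h2⟩
    · right; left; exact ⟨hk, h1⟩
  have hcard : (K:ℝ) ≤ G.card + (b1.card + (b2.card + b3.card)) := by
    have h1 := Finset.card_le_card hcover
    rw [Finset.card_range] at h1
    have h2 := Finset.card_union_le G (b1 ∪ (b2 ∪ b3))
    have h3 := Finset.card_union_le b1 (b2 ∪ b3)
    have h4 := Finset.card_union_le b2 b3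
    exact_mod_cast (by omega : K ≤ G.card + (b1.card + (b2.card + b3.card)))
  have hY0 : (0:ℝ) < Y := by exact_mod_cast (by omega : 0 < Y)
  have c1 : (b1.card : ℝ) ≤ K / Y + Nat.sqrt D := by
    apply nonsquarefree_count M K Y D (by omega) _ hkD
    intro q hq hqY
    rw [hM]
    apply Dvd.dvd.mul_left
    rw [primorial]
    apply Finset.dvd_prod_of_mem
    simp [hq]; omega
  have c2 : (b2.card : ℝ) ≤ 16 * (K / Y) + 16 * (z:ℝ) ^ 2 := by
    apply cheb _ U T _ hT
    have hPP : ∀ p ∈ (pr z).filter (fun p => Y < p), p.Prime ∧ Nat.Coprime M p := by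
      intro p hp
      rw [Finset.mem_filter, mem_pr] at hp
      obtain ⟨⟨hpz, hpp⟩, hpY⟩ := hp
      refine ⟨hpp, Nat.Coprime.symm ?_⟩
      rw [hM]
      apply Nat.Coprime.mul_right
      · have : Nat.Coprime p 2 := (Nat.coprime_primes hpp Nat.prime_two).2 (by omega)
        have h := this.pow_right 3
        norm_num at h; exact h
      · rw [primorial]
        apply Nat.Coprime.prod_right
        intro q hq
        rw [Finset.mem_filter, Finset.mem_range] at hq
        exact (Nat.coprime_primes hpp hq.2).2 (by omega)
    refine (mid_sum M K ((by norm_num : 4 ∣ 8).trans h8) _ hPP (fun p => PI (x / p)) (fun p => PI_nonneg _)).trans ?_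
    have hb : ∀ p ∈ (pr z).filter (fun p => Y < p), PI (x / p) ≤ 4 * T * (1 / (p:ℝ)) := by
      intro p hp
      rw [Finset.mem_filter, mem_pr] at hp
      rw [hTx]; exact hPI p hp.1.2.one_lt.le hp.1.1
    have i1 : ∑ p ∈ (pr z).filter (fun p => Y < p), PI (x / p) ^ 2 ≤ 16 * T ^ 2 * (1 / Y) := by
      calc _ ≤ ∑ p ∈ (pr z).filter (fun p => Y < p), 16 * T ^ 2 * (1 / (p:ℝ) ^ 2) := by
            refine Finset.sum_le_sum fun p hp => ?_
            calc PI (x / p) ^ 2 ≤ (4 * T * (1 / (p:ℝ))) ^ 2 :=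
                  pow_le_pow_left₀ (PI_nonneg _) (hb p hp) 2
              _ = _ := by ring
        _ = 16 * T ^ 2 * ∑ p ∈ (pr z).filter (fun p => Y < p), (1 / (p:ℝ) ^ 2) := by rw [Finset.mul_sum]
        _ ≤ 16 * T ^ 2 * ∑ p ∈ Finset.Ioc Y z, (1 / (p:ℝ) ^ 2) := by
            apply mul_le_mul_of_nonneg_left _ (by positivity)
            apply Finset.sum_le_sum_of_subset_of_nonneg
            · intro p hp
              rw [Finset.mem_filter, mem_pr] at hp
              rw [Finset.mem_Ioc]; exact ⟨hp.2, hp.1.1⟩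
            · intros; positivity
        _ ≤ _ := mul_le_mul_of_nonneg_left (sum_inv_sq Y z (by omega)) (by positivity)
    have i2 : ∑ p ∈ (pr z).filter (fun p => Y < p), (p:ℝ) * PI (x / p) ≤ 4 * T * z := by
      calc _ ≤ ∑ p ∈ (pr z).filter (fun p => Y < p), 4 * T := by
            refine Finset.sum_le_sum fun p hp => ?_
            have hp0 : (0:ℝ) < p := by
              rw [Finset.mem_filter, mem_pr] at hp
              exact_mod_cast hp.1.2.pos
            calc (p:ℝ) * PI (x / p) ≤ p * (4 * T * (1 / (p:ℝ))) :=
                  mul_le_mul_of_nonneg_left (hb p hp) hp0.le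
              _ = _ := by field_simp
        _ = (((pr z).filter (fun p => Y < p)).card : ℝ) * (4 * T) := by rw [Finset.sum_const, nsmul_eq_mul]
        _ ≤ z * (4 * T) := by
            apply mul_le_mul_of_nonneg_right _ (by positivity)
            have h1 := Finset.card_filter_le (pr z) (fun p => Y < p)
            rw [card_pr] at h1
            exact_mod_cast h1.trans (primeCounting_le_self z)
        _ = _ := by ring
    have i0 : 0 ≤ ∑ p ∈ (pr z).filter (fun p => Y < p), (p:ℝ) * PI (x / p) :=
      Finset.sum_nonneg fun p _ => mul_nonneg (Nat.cast_nonneg _) (PI_nonneg _)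
    calc _ ≤ (K:ℝ) * (16 * T ^ 2 * (1 / Y)) + (4 * T * z) ^ 2 := by
          apply add_le_add
          · exact mul_le_mul_of_nonneg_left i1 (Nat.cast_nonneg _)
          · exact pow_le_pow_left₀ i0 i2 2
      _ = _ := by ring
  have c3 : (b3.card : ℝ) ≤ (Real.log x + 3) ^ 5 := by
    apply cheb _ R T _ hT
    set Sk := (Finset.range K).filter (fun k => Squarefree (1 + M * k)) with hSk
    have hinj : Set.InjOn (fun k => 1 + M * k) Sk := by
      intro a _ b _ h
      have : M * a = M * b := by simpa using h
      exact Nat.eq_of_mul_eq_mul_left hMpos this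
    have e : ∑ k ∈ Sk, R k ^ 2 = ∑ d ∈ Sk.image (fun k => 1 + M * k), RR D ⌊x⌋₊ d ^ 2 := by
      rw [Finset.sum_image hinj]
    rw [e]
    refine (RR_sum _ D ⌊x⌋₊ ?_).trans ?_
    · intro d hd
      rw [Finset.mem_image] at hd
      obtain ⟨k, hk, rfl⟩ := hd
      rw [hSk, Finset.mem_filter, Finset.mem_range] at hk
      refine ⟨by omega, hkD k hk.1, ?_, hk.2⟩
      obtain ⟨c, rfl⟩ := h8
      rw [Nat.odd_iff, mul_assoc]; omega
    · have hXx : (⌊x⌋₊ : ℝ) ≤ x := Nat.floor_le (by linarith)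
      have hX0 : 0 < ⌊x⌋₊ := Nat.floor_pos.2 hx
      have hH : HH ⌊x⌋₊ ≤ Real.log x + 1 := by
        have := HH_le ⌊x⌋₊
        have h2 : Real.log ⌊x⌋₊ ≤ Real.log x := Real.log_le_log (by exact_mod_cast hX0) hXx
        linarith
      have hH0 := HH_nonneg ⌊x⌋₊
      have hL0 : 0 < Real.log x := by linarith
      have hxx : x = T * Real.log x := by rw [hTx]; field_simp
      calc (⌊x⌋₊ : ℝ) ^ 2 * HH ⌊x⌋₊ ^ 2 * (HH ⌊x⌋₊ + 2) ≤
            x ^ 2 * (Real.log x + 1) ^ 2 * ((Real.log x + 1) + 2) := by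
            gcongr
        _ = T ^ 2 * (Real.log x ^ 2 * (Real.log x + 1) ^ 2 * (Real.log x + 3)) := by
            nth_rw 1 [hxx]; ring
        _ ≤ T ^ 2 * ((Real.log x + 3) ^ 2 * (Real.log x + 3) ^ 2 * (Real.log x + 3)) := by
            gcongr <;> linarith
        _ = _ := by ring
  have : (G.card : ℝ) ≥ K - (K / Y + Nat.sqrt D) - (16 * (K / Y) + 16 * (z:ℝ) ^ 2) - (Real.log x + 3) ^ 5 := by
    linarith
  linarith

end RaceProof

end

section

open Filter Topology

namespace RaceProof

lemma K_lower (s : ℝ) (hs : 16 ≤ s) (hu : 24 ≤ Real.exp (Real.sqrt s)) :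
    Real.exp (s - 3 * Real.sqrt s) ≤
      ((⌊Real.exp s⌋₊ / (8 * primorial ⌊Real.sqrt s⌋₊) : ℕ) : ℝ) := by
  set u := Real.sqrt s with hu'
  have huu : u * u = s := Real.mul_self_sqrt (by linarith)
  have hu4 : 4 ≤ u := Real.le_sqrt_of_sq_le (by linarith)
  set M := 8 * primorial ⌊u⌋₊ with hM
  have hM1 : 1 ≤ M := by have := primorial_pos ⌊u⌋₊; omega
  have hM1' : (1:ℝ) ≤ M := by exact_mod_cast hM1
  have hMu : (M:ℝ) ≤ 8 * Real.exp (2 * u) := by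
    have h1 : (primorial ⌊u⌋₊ : ℝ) ≤ (4:ℝ) ^ ⌊u⌋₊ := by exact_mod_cast primorial_le_four_pow ⌊u⌋₊
    have h4 : (4:ℝ) ≤ Real.exp 2 := by
      have : Real.exp 2 = Real.exp 1 * Real.exp 1 := by rw [← Real.exp_add]; norm_num
      have := Real.exp_one_gt_d9
      nlinarith
    have h2 : (4:ℝ) ^ ⌊u⌋₊ ≤ Real.exp (2 * u) := by
      calc (4:ℝ) ^ ⌊u⌋₊ ≤ Real.exp 2 ^ ⌊u⌋₊ := by gcongr
        _ = Real.exp (⌊u⌋₊ * 2) := by rw [← Real.exp_nat_mul]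
        _ ≤ _ := by
          apply Real.exp_le_exp.2
          have := Nat.floor_le (Real.sqrt_nonneg s)
          linarith
    rw [hM]; push_cast; linarith
  have h1 : (⌊Real.exp s⌋₊ : ℝ) / M - 1 ≤ ((⌊Real.exp s⌋₊ / M : ℕ) : ℝ) := by
    rw [← Nat.floor_div_eq_div (K := ℝ)]
    exact (Nat.sub_one_lt_floor _).le
  have h2 : Real.exp s - 1 ≤ (⌊Real.exp s⌋₊ : ℝ) := (Nat.sub_one_lt_floor _).le
  have h3 : Real.exp s / M - 1 ≤ (⌊Real.exp s⌋₊ : ℝ) / M := by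
    have : (Real.exp s - 1) / M ≤ (⌊Real.exp s⌋₊ : ℝ) / M := by gcongr
    rw [sub_div] at this
    have h5 : 1 / (M:ℝ) ≤ 1 := by rw [div_le_one (by linarith)]; exact hM1'
    linarith
  set E := Real.exp (s - 3 * u) with hE
  have hE1 : 1 ≤ E := Real.one_le_exp (by nlinarith)
  have h4 : 3 * E ≤ Real.exp s / M := by
    rw [le_div_iff₀ (by linarith)]
    have e : Real.exp s = E * Real.exp u * Real.exp (2 * u) := by
      rw [hE, ← Real.exp_add, ← Real.exp_add]; ring_nf
    rw [e]
    have := Real.exp_pos (2 * u)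
    calc 3 * E * M ≤ 3 * E * (8 * Real.exp (2 * u)) := by gcongr
      _ = E * 24 * Real.exp (2 * u) := by ring
      _ ≤ _ := by gcongr
  linarith

lemma poly_exp : ∀ᶠ s : ℝ in atTop, (s ^ 2 + 3) ^ 5 ≤ Real.exp (s / 2) := by
  have h := (isLittleO_pow_exp_pos_mul_atTop 10 (by norm_num : (0:ℝ) < 1 / 2)).bound
    (by norm_num : (0:ℝ) < 1 / 32)
  filter_upwards [h, eventually_ge_atTop 2] with s hs hs2
  rw [Real.norm_of_nonneg (by positivity), Real.norm_of_nonneg (Real.exp_pos _).le] at hs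
  have h1 : s ^ 2 + 3 ≤ 2 * s ^ 2 := by nlinarith
  calc (s ^ 2 + 3) ^ 5 ≤ (2 * s ^ 2) ^ 5 := by gcongr
    _ = 32 * s ^ 10 := by ring
    _ ≤ Real.exp (1 / 2 * s) := by linarith
    _ = _ := by ring_nf

lemma num_big (s u : ℝ) (hu1 : 69 ≤ u) (huu : u * u = s) : 71 + s / 2 ≤ s - 3 * u := by
  have h : 69 * u ≤ u * u := by gcongr
  linarith

lemma num_fin (s u ε K : ℝ) (hε : 0 < ε) (hu1 : 69 ≤ u) (hu2 : 4 / ε ≤ u) (huu : u * u = s)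
    (hKl : Real.exp (s - 3 * u) ≤ K) : Real.exp (s * (1 - ε)) ≤ K / 2 := by
  have h2 : (2:ℝ) ≤ Real.exp 1 := by linarith [Real.add_one_le_exp (1:ℝ)]
  have h3 : Real.exp (s * (1 - ε)) * Real.exp 1 ≤ Real.exp (s - 3 * u) := by
    rw [← Real.exp_add]
    apply Real.exp_le_exp.2
    have h4 : 4 ≤ u * ε := by rwa [div_le_iff₀ hε] at hu2
    have h5 : 4 * u ≤ u * ε * u := mul_le_mul_of_nonneg_right h4 (by linarith)
    have h6 : s * ε = u * ε * u := by rw [← huu]; ring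
    have h7 : s * (1 - ε) = s - s * ε := by ring
    linarith
  have h8 := mul_le_mul_of_nonneg_left h2 (Real.exp_pos (s * (1 - ε))).le
  linarith

set_option maxHeartbeats 1000000 in
lemma race_main (ε : ℝ) (hε : 0 < ε) :
    ∃ C > (0:ℝ), ∃ A > (0:ℝ), ∀ᶠ x : ℝ in atTop,
      Real.exp (C * Real.sqrt (Real.log x)) ^ (1 - ε) ≤
        (Nat.card {d : ℕ // (d : ℝ) ≤ Real.exp (C * Real.sqrt (Real.log x)) ∧
          IsFundamentalDiscriminant d ∧
          ∃ χ : DirichletCharacter ℂ d, χ.IsPrimitive ∧ MulChar.IsQuadratic χ ∧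
            1 + (Real.log (Real.log (Real.log x)) - A) / Real.log (Real.log x) ≤
              raceRatio χ 1 x} : ℝ) := by
  classical
  obtain ⟨A, hA, hgood⟩ := good_ratio
  refine ⟨1, one_pos, A, hA, ?_⟩
  have hsu : Tendsto (fun x : ℝ => Real.sqrt (Real.sqrt (Real.log x))) atTop atTop :=
    Real.tendsto_sqrt_atTop.comp tendsto_s
  filter_upwards [hgood, PI_upper, eventually_ge_atTop 4,
    Real.tendsto_log_atTop.eventually_ge_atTop 1,
    hsu.eventually_ge_atTop 69, hsu.eventually_ge_atTop (4 / ε), tendsto_s.eventually_ge_atTop 16,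
    tendsto_s.eventually poly_exp] with x hgood hPI hx hL1 hu1 hu2 hs hpoly
  rw [one_mul]
  set L := Real.log x with hL
  set s := Real.sqrt L with hs'
  set u := Real.sqrt s with hu'
  have hx0 : 0 < x := by linarith
  have hs2 : s * s = L := Real.mul_self_sqrt (by linarith)
  have huu : u * u = s := Real.mul_self_sqrt (by linarith)
  set D := ⌊Real.exp s⌋₊ with hD
  set z := ⌊Real.exp (s / 4)⌋₊ with hz
  set Y := ⌊u⌋₊ with hYd
  set M := 8 * primorial Y with hM
  set K := D / M with hK
  have hDe : (D:ℝ) ≤ Real.exp s := Nat.floor_le (Real.exp_pos _).le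
  have hze : (z:ℝ) ≤ Real.exp (s / 4) := Nat.floor_le (Real.exp_pos _).le
  have hY68 : 68 ≤ Y := Nat.le_floor (by push_cast; linarith)
  have hxe : x = Real.exp (s * s) := by rw [hs2, hL, Real.exp_log hx0]
  have hzx : (z:ℝ) ≤ Real.sqrt x := by
    refine hze.trans ?_
    apply Real.le_sqrt_of_sq_le
    rw [← Real.exp_nat_mul, hxe]; apply Real.exp_le_exp.2; push_cast; nlinarith
  have hMpos : 0 < M := by rw [hM]; have := primorial_pos Y; omega
  have hkD : ∀ k < K, 1 + M * k ≤ D := by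
    intro k hk
    have h1 : M * (k + 1) ≤ M * K := Nat.mul_le_mul_left _ hk
    have h2 : M * K ≤ D := by rw [hK]; exact Nat.mul_div_le D M
    rw [mul_add, mul_one] at h1; omega
  have hcount := good_count x (x / L) (by positivity) (by linarith) rfl hL1 M K Y z D (by omega) hM hK
    (fun p hp hpz => hPI p hp (le_trans (by exact_mod_cast hpz) hzx))
  set G := (Finset.range K).filter (fun k => Squarefree (1 + M * k) ∧
        |∑ p ∈ (pr z).filter (fun p => Y < p), PI (x / p) * JJ p (1 + M * k)| ≤ x / L ∧
        RR D ⌊x⌋₊ (1 + M * k) ≤ x / L) with hG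
  have hKl : Real.exp (s - 3 * u) ≤ (K:ℝ) :=
    K_lower s hs (by linarith [Real.add_one_le_exp u])
  have hsqrtD : (Nat.sqrt D : ℝ) ≤ Real.exp (s / 2) := by
    have h1 : ((Nat.sqrt D : ℝ)) ^ 2 ≤ Real.exp (s / 2) ^ 2 := by
      have : ((Nat.sqrt D : ℝ)) ^ 2 ≤ D := by exact_mod_cast Nat.sqrt_le' D
      rw [← Real.exp_nat_mul]
      refine this.trans (hDe.trans (le_of_eq ?_))
      congr 1; push_cast; ring
    exact le_of_sq_le_sq h1 (Real.exp_pos _).le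
  have hz2 : (z:ℝ) ^ 2 ≤ Real.exp (s / 2) := by
    calc (z:ℝ) ^ 2 ≤ Real.exp (s / 4) ^ 2 := by gcongr
      _ = _ := by rw [← Real.exp_nat_mul]; congr 1; push_cast; ring
  have hpoly' : (L + 3) ^ 5 ≤ Real.exp (s / 2) := by
    rw [← hs2, ← pow_two]; exact hpoly
  have hKY : 17 * ((K:ℝ) / Y) ≤ K / 4 := by
    have hY' : (68:ℝ) ≤ Y := by exact_mod_cast hY68
    have hK0 : (0:ℝ) ≤ K := Nat.cast_nonneg _
    have : (K:ℝ) / Y ≤ K / 68 := by gcongr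
    linarith
  have hbig : 72 * Real.exp (s / 2) ≤ K := by
    refine le_trans ?_ hKl
    have h72 : (72:ℝ) ≤ Real.exp 71 := by linarith [Real.add_one_le_exp (71:ℝ)]
    calc 72 * Real.exp (s / 2) ≤ Real.exp 71 * Real.exp (s / 2) := by gcongr
      _ = Real.exp (71 + s / 2) := by rw [Real.exp_add]
      _ ≤ _ := Real.exp_le_exp.2 (num_big s u hu1 huu)
  have hGK : (K:ℝ) / 2 ≤ G.card := by linarith
  have hfin : Real.exp s ^ (1 - ε) ≤ (G.card : ℝ) := by
    refine le_trans ?_ hGK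
    rw [← Real.exp_mul]
    exact num_fin s u ε K hε hu1 hu2 huu hKl
  refine hfin.trans ?_
  set P : ℕ → Prop := fun d => (d : ℝ) ≤ Real.exp s ∧
          IsFundamentalDiscriminant d ∧
          ∃ χ : DirichletCharacter ℂ d, χ.IsPrimitive ∧ MulChar.IsQuadratic χ ∧
            1 + (Real.log (Real.log L) - A) / Real.log L ≤ raceRatio χ 1 x with hP
  have hPfin : Finite {d : ℕ // P d} := by
    have : Set.Finite {d : ℕ | P d} := by
      apply (Set.finite_Iic D).subset
      intro d hd
      exact Nat.le_floor hd.1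
    exact this
  have hmem : ∀ k ∈ G, P (1 + M * k) := by
    intro k hk
    rw [hG, Finset.mem_filter, Finset.mem_range] at hk
    obtain ⟨hkK, hsq, hU, hR⟩ := hk
    have hne : NeZero (1 + M * k) := ⟨by omega⟩
    have h8 : (1 + M * k) % 8 = 1 := by rw [hM, mul_assoc]; omega
    have hdD := hkD k hkK
    refine ⟨?_, ⟨by omega, Or.inl ⟨by omega, hsq⟩⟩, cc (1 + M * k),
      cc_primitive _ (by rw [Nat.odd_iff]; omega) hsq, cc_quadratic _, ?_⟩
    · exact le_trans (by exact_mod_cast hdD) hDe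
    · apply hgood (1 + M * k) hdD _ hU hR
      intro p hp
      have hp' := mem_pr.1 hp
      have hpM : p ∣ M := by
        rw [hM]
        apply Dvd.dvd.mul_left
        rw [primorial]
        apply Finset.dvd_prod_of_mem
        simp only [Finset.mem_filter, Finset.mem_range]
        exact ⟨by omega, hp'.2⟩
      have hmod : (1 + M * k) % p = 1 := by
        obtain ⟨c, hc⟩ := hpM
        rw [hc, mul_assoc, Nat.add_mul_mod_self_left, Nat.mod_eq_of_lt hp'.2.one_lt]
      unfold JJ
      rw [jac_small_prime (1 + M * k) p hp'.2 h8 hmod]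
      norm_num
  have hle : Nat.card G ≤ Nat.card {d : ℕ // P d} := by
    apply Nat.card_le_card_of_injective (fun k : G => (⟨1 + M * k.1, hmem k.1 k.2⟩ : {d : ℕ // P d}))
    intro a b h
    have h1 : 1 + M * a.1 = 1 + M * b.1 := congrArg Subtype.val h
    have : M * a.1 = M * b.1 := by omega
    exact Subtype.ext (Nat.eq_of_mul_eq_mul_left hMpos this)
  rw [Nat.card_eq_fintype_card, Fintype.card_coe] at hle
  exact_mod_cast hle

end RaceProof

end

/-- fix `ε > 0`; with `D(x) = exp (C (log x)^{1/2})` for a suitable `C > 0`,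
there is `A > 0` such that for all large `x` there are at least `D(x)^{1-ε}` fundamental
discriminants `d ≤ D(x)` whose real primitive character `χ_d` satisfies
`raceRatio ≥ 1 + (log log log x - A)/log log x`. -/
theorem statement_1 (ε : ℝ) (hε : 0 < ε) :
    ∃ C > (0:ℝ), ∃ A > (0:ℝ), ∀ᶠ x : ℝ in atTop,
      Real.exp (C * Real.sqrt (Real.log x)) ^ (1 - ε) ≤
        (Nat.card {d : ℕ // (d : ℝ) ≤ Real.exp (C * Real.sqrt (Real.log x)) ∧
          IsFundamentalDiscriminant d ∧
          ∃ χ : DirichletCharacter ℂ d, χ.IsPrimitive ∧ MulChar.IsQuadratic χ ∧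
            1 + (Real.log (Real.log (Real.log x)) - A) / Real.log (Real.log x) ≤
              raceRatio χ 1 x} : ℝ) := by
  exact RaceProof.race_main ε hε
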